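/- arXiv:2204.06482 — 3 statements merged into one kernel-verified Lean document; each statement's English description precedes it below -/
import Mathlib

section
/- Let ℓ ≥ 0 and let (X_i)_{i≥1} be a Markov chain on ℝ^d with initial law ν₁ and transition kernel P satisfying L1, L2 and L3. Let μ be the unique invariant probability measure of P and let μ_N = (1/N)Σ_{i=1}^N δ_{X_i}. Then W_ℓ(μ_N, μ) → 0 almost surely as N → ∞, for every initial law ν₁. -/
open MeasureTheory ProbabilityTheory Filter ENNReal Topology

noncomputable section

/-- `ℝ^d` with the Euclidean norm. -/
abbrev Euc (d : ℕ) := EuclideanSpace ℝ (Fin d)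

namespace Paper

variable {E : Type*} [MeasurableSpace E]

/-- The set of couplings between two measures. -/
def couplings (μ ν : Measure E) : Set (Measure (E × E)) :=
  {ρ | IsProbabilityMeasure ρ ∧ ρ.map Prod.fst = μ ∧ ρ.map Prod.snd = ν}

/-- The `ℓ`-Wasserstein distance `W_ℓ` (in `ℝ≥0∞`), for `ℓ > 0` with cost `dist^ℓ` and
exponent `1/(ℓ ∨ 1)`, and for `ℓ = 0` with cost `1 ∧ dist`. -/
def Wl [PseudoMetricSpace E] (ℓ : ℝ) (μ ν : Measure E) : ℝ≥0∞ :=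
  ⨅ ρ ∈ couplings μ ν,
    if ℓ = 0 then ∫⁻ p, ENNReal.ofReal (min 1 (dist p.1 p.2)) ∂ρ
    else (∫⁻ p, ENNReal.ofReal (dist p.1 p.2 ^ ℓ) ∂ρ) ^ (1 / max ℓ 1)

variable [NormedAddCommGroup E]

/-- Membership in the Wasserstein space `𝒫_ℓ`. -/
def MemP (ℓ : ℝ) (μ : Measure E) : Prop :=
  IsProbabilityMeasure μ ∧ ∫⁻ x, ENNReal.ofReal (‖x‖ ^ ℓ) ∂μ < ⊤

/-- The `W_ℓ`-ball of radius `r` centered at `μ`, inside `𝒫_ℓ`. -/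
def ball (ℓ : ℝ) (μ : Measure E) (r : ℝ) : Set (Measure E) :=
  {m | MemP ℓ m ∧ Wl ℓ m μ < ENNReal.ofReal r}

/-- The average `(1/N) ∑_{i=1}^N ν_i` (indexing `ν 0 = ν_1`). -/
def avg (ν : ℕ → Measure E) (N : ℕ) : Measure E :=
  (N : ℝ≥0∞)⁻¹ • ∑ i ∈ Finset.range N, ν i

/-- The empirical measure `μ_N = (1/N) ∑_{i=1}^N δ_{X_i}` (indexing `X 0 = X_1`). -/
def emp {Ω : Type*} (X : ℕ → Ω → E) (N : ℕ) (ω : Ω) : Measure E :=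
  (N : ℝ≥0∞)⁻¹ • ∑ i ∈ Finset.range N, Measure.dirac (X i ω)

/-- Condition TX: there is `β ∈ (0,1)` with
`∑_{i≥1} (1/i) E((|X_i|^ℓ - i^β) 1_{|X_i|^ℓ > i^β}) < ∞` (indexing `X 0 = X_1`). -/
def TX {Ω : Type*} [MeasurableSpace Ω] (Pr : Measure Ω) (X : ℕ → Ω → E) (ℓ : ℝ) : Prop :=
  ∃ β ∈ Set.Ioo (0:ℝ) 1,
    (∑' i : ℕ, ((i : ℝ≥0∞) + 1)⁻¹ *
      ∫⁻ ω in {ω | ((i : ℝ) + 1) ^ β < ‖X i ω‖ ^ ℓ},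
        ENNReal.ofReal (‖X i ω‖ ^ ℓ - ((i : ℝ) + 1) ^ β) ∂Pr) < ⊤

/-- The total variation measure `|μ - ν|` of the difference of two (finite) measures. -/
def mdiff (μ ν : Measure E) : Measure E := (μ - ν) + (ν - μ)

/-- The norm `‖μ - ν‖_ℓ = sup {∫ f d(μ-ν) : f measurable, |f| ≤ 1 + |x|^ℓ}`. -/
def normLdiff (ℓ : ℝ) (μ ν : Measure E) : ℝ :=
  sSup {c | ∃ f : E → ℝ, Measurable f ∧ (∀ x, |f x| ≤ 1 + ‖x‖ ^ ℓ) ∧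
    c = ∫ x, f x ∂μ - ∫ x, f x ∂ν}

/-- Integral of `f` against a signed measure. -/
def sInt (τ : SignedMeasure E) (f : E → ℝ) : ℝ :=
  ∫ x, f x ∂τ.toJordanDecomposition.posPart - ∫ x, f x ∂τ.toJordanDecomposition.negPart

/-- `U` admits `DU` as linear functional derivative at `μ` (on `𝒫_ℓ`). -/
def HasLFDAt (ℓ : ℝ) (U : Measure E → ℝ) (μ : Measure E) (DU : E → ℝ) : Prop :=
  Measurable DU ∧ (∃ C : ℝ, ∀ y, |DU y| ≤ C * (1 + ‖y‖ ^ ℓ)) ∧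
    ∀ ν : Measure E, MemP ℓ ν →
      HasDerivWithinAt (fun ε : ℝ => U (ENNReal.ofReal (1 - ε) • μ + ENNReal.ofReal ε • ν))
        ((∫ y, DU y ∂ν) - ∫ y, DU y ∂μ) (Set.Ici 0) 0

/-- RU1: `U` admits a linear functional derivative `DU m` at every `m` in the ball `B(μ,r)`. -/
def RU1 (ℓ r : ℝ) (U : Measure E → ℝ) (μ : Measure E) (DU : Measure E → E → ℝ) : Prop :=
  ∀ m ∈ ball ℓ μ r, HasLFDAt ℓ U m (DU m)

/-- RU2: uniform growth bound `|δU/δm(m,x)| ≤ C (1+|x|^{ℓ/2})` on the ball. -/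
def RU2 (ℓ r : ℝ) (μ : Measure E) (DU : Measure E → E → ℝ) : Prop :=
  ∃ C : ℝ, ∀ m ∈ ball ℓ μ r, ∀ x, |DU m x| ≤ C * (1 + ‖x‖ ^ (ℓ / 2))

/-- RU3: `sup_x |δU/δm(m,x) - δU/δm(μ,x)|/(1+|x|^{ℓ/2}) → 0` as `W_ℓ(m,μ) → 0`. -/
def RU3 (ℓ r : ℝ) (μ : Measure E) (DU : Measure E → E → ℝ) : Prop :=
  ∀ ε > (0:ℝ), ∃ δ > (0:ℝ), ∀ m ∈ ball ℓ μ r, Wl ℓ m μ < ENNReal.ofReal δ →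
    ∀ x, |DU m x - DU μ x| ≤ ε * (1 + ‖x‖ ^ (ℓ / 2))

/-- RU4: `x ↦ δU/δm(μ,x)` is continuous `μ`-a.e. -/
def RU4 (μ : Measure E) (DU : Measure E → E → ℝ) : Prop :=
  ∀ᵐ x ∂μ, ContinuousAt (DU μ) x

/-- RU5 (with exponent `α`): Hölder-type stability of the derivative on the ball. -/
def RU5 (ℓ α r : ℝ) (μ : Measure E) (DU : Measure E → E → ℝ) : Prop :=
  ∃ C : ℝ, ∀ m₁ ∈ ball ℓ μ r, ∀ m₂ ∈ ball ℓ μ r, ∀ x,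
    |DU m₂ x - DU m₁ x| ≤
      C * ((1 + ‖x‖ ^ ℓ) * (((mdiff m₂ m₁) Set.univ).toReal) ^ α +
        (1 + ‖x‖ ^ (ℓ * (1 - α))) * (∫ y, ‖y‖ ^ ℓ ∂(mdiff m₂ m₁)) ^ α)

/-- RU6 (with exponent `α`): Hölder-type stability of the derivative on the ball. -/
def RU6 (ℓ α r : ℝ) (μ : Measure E) (DU : Measure E → E → ℝ) : Prop :=
  ∃ C : ℝ, ∀ m₁ ∈ ball ℓ μ r, ∀ m₂ ∈ ball ℓ μ r, ∀ x,
    |DU m₂ x - DU m₁ x| ≤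
      C * (∫ y, (1 + ‖y‖ ^ (ℓ / (2 * α))) ∂(mdiff m₂ m₁)) ^ α * (1 + ‖x‖ ^ (ℓ / 2))

/-- Lyapunov condition L1: `PV(x) ≤ γ V(x) + K`. -/
def Lyap1 (P : Kernel E E) (V : E → ℝ) (γ K : ℝ) : Prop :=
  ∀ x, ∫⁻ y, ENNReal.ofReal (V y) ∂(P x) ≤ ENNReal.ofReal (γ * V x + K)

/-- Lyapunov minorization condition: `(P(x,·) ∧ P(y,·))(ℝ^d) ≥ ρ` when `V(x)+V(y) ≤ R`. -/
def Lyap2 (P : Kernel E E) (V : E → ℝ) (R ρ : ℝ) : Prop :=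
  ∀ x y, V x + V y ≤ R → ENNReal.ofReal ρ ≤ (P x ⊓ P y) Set.univ

/-- The full Lyapunov condition with data `(V, γ, K, R, ρ)`. -/
def Lyapunov (P : Kernel E E) (V : E → ℝ) (γ K R ρ : ℝ) : Prop :=
  Measurable V ∧ (∀ x, 0 ≤ V x) ∧ γ ∈ Set.Ioo (0:ℝ) 1 ∧ 0 ≤ K ∧
    2 * K / (1 - γ) < R ∧ ρ ∈ Set.Ioc (0:ℝ) 1 ∧ Lyap1 P V γ K ∧ Lyap2 P V R ρ

/-- `n` steps of the kernel `P` starting from the measure `σ`, i.e. `σ Pⁿ`. -/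
def kIter (P : Kernel E E) (σ : Measure E) : ℕ → Measure E
  | 0 => σ
  | n + 1 => (kIter P σ n).bind (⇑P)

/-- `Pⁿ f (x)`. -/
def Pn (P : Kernel E E) (n : ℕ) (f : E → ℝ) (x : E) : ℝ :=
  ∫ y, f y ∂(kIter P (Measure.dirac x) n)

/-- The contraction factor `χ(ρ,β,γ,K,R)`. -/
def chi (ρ β γ K R : ℝ) : ℝ :=
  max (1 - ρ + β * K) ((2 + β * γ * R + 2 * β * K) / (2 + β * R))

/-- The distance `d_{V,β}(θ,σ) = sup {|θ(φ) - σ(φ)| : ‖φ‖_{V,β} ≤ 1}`. -/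
def dV (V : E → ℝ) (β : ℝ) (θ σ' : Measure E) : ℝ :=
  sSup {c | ∃ φ : E → ℝ, Measurable φ ∧ (∀ x, |φ x| ≤ 1 + β * V x) ∧
    c = |(∫ x, φ x ∂θ) - ∫ x, φ x ∂σ'|}

/-- `(X_i)_{i ≥ 1}` (indexed so that `X 0 = X_1`) is a Markov chain with initial law `ν₁`
and transition kernel `P` on the probability space `(Ω, Pr)`. -/
def IsMarkovChain {Ω : Type*} [MeasurableSpace Ω] (Pr : Measure Ω) (X : ℕ → Ω → E)
    (ν₁ : Measure E) (P : Kernel E E) : Prop :=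
  (∀ i, Measurable (X i)) ∧ Pr.map (X 0) = ν₁ ∧
    ∀ i : ℕ, ∀ A : Set E, MeasurableSet A →
      (fun ω => ((P (X i ω)) A).toReal) =ᵐ[Pr]
        Pr[fun ω => Set.indicator A (fun _ => (1:ℝ)) (X (i + 1) ω) |
          MeasurableSpace.comap (fun ω (j : Fin (i + 1)) => X j.1 ω) MeasurableSpace.pi]

/-- Convergence in distribution of the real random variables `Y N` to the law `G`. -/
def cid {Ω : Type*} [MeasurableSpace Ω] (Pr : Measure Ω) (Y : ℕ → Ω → ℝ) (G : Measure ℝ) : Prop :=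
  ∀ f : BoundedContinuousFunction ℝ ℝ,
    Tendsto (fun N => ∫ ω, f (Y N ω) ∂Pr) atTop (𝓝 (∫ x, f x ∂G))

end Paper

open Paper



namespace Harris
variable {E : Type*} [MeasurableSpace E]

/-- One-step real transition operator. -/
def TT (P : Kernel E E) (φ : E → ℝ) : E → ℝ := fun x => ∫ y, φ y ∂(P x)

lemma exists_consts (γ K R ρ : ℝ) (hγ : γ ∈ Set.Ioo (0:ℝ) 1) (hK : 0 ≤ K)
    (hR : 2 * K / (1 - γ) < R) (hρ : ρ ∈ Set.Ioc (0:ℝ) 1) :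
    ∃ β χ : ℝ, 0 < β ∧ β ≤ 1 ∧ 0 < χ ∧ χ < 1 ∧
      (∀ S, R ≤ S → 2 + β * (γ * S + 2 * K) ≤ χ * (2 + β * S)) ∧
      (∀ S, 0 ≤ S → 2 * (1 - ρ) + β * (γ * S + 2 * K) ≤ χ * (2 + β * S)) := by
  obtain ⟨hγ0, hγ1⟩ := hγ
  obtain ⟨hρ0, hρ1⟩ := hρ
  have h1γ : 0 < 1 - γ := by linarith
  have hR' : 2 * K < R * (1 - γ) := by rwa [div_lt_iff₀ h1γ] at hR
  have hR0 : 0 < R := lt_of_le_of_lt (by positivity) hR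
  set β := ρ / (2 * (K + 1)) with hβ
  have hβ0 : 0 < β := by positivity
  have hβK : β * (K + 1) = ρ / 2 := by rw [hβ]; field_simp
  have hβK' : β * K ≤ ρ / 2 := by nlinarith
  set q := (2 + 2 * β * K + β * γ * R) / (2 + β * R) with hq
  have hden : 0 < 2 + β * R := by positivity
  have hq1 : q < 1 := by
    rw [hq, div_lt_one hden]; nlinarith
  set χ := max (max (1 - ρ / 2) γ) q with hχ
  have h1 : 1 - ρ / 2 ≤ χ := le_trans (le_max_left _ _) (le_max_left _ _)
  have h2 : γ ≤ χ := le_trans (le_max_right _ _) (le_max_left _ _)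
  have h3 : q ≤ χ := le_max_right _ _
  refine ⟨β, χ, hβ0, by nlinarith, by linarith, ?_, ?_, ?_⟩
  · exact max_lt (max_lt (by linarith) hγ1) hq1
  · intro S hS
    have h4 : 2 + 2 * β * K + β * γ * R ≤ χ * (2 + β * R) := by
      rw [hq, div_le_iff₀ hden] at h3; exact h3
    have h5 : 0 ≤ β * (χ - γ) * (S - R) :=
      mul_nonneg (mul_nonneg hβ0.le (by linarith)) (by linarith)
    nlinarith
  · intro S hS
    have h5 : 0 ≤ β * (χ - γ) * S := mul_nonneg (mul_nonneg hβ0.le (by linarith)) hS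
    nlinarith

lemma exists_shift [Nonempty E] (φ W : E → ℝ) (h : ∀ x y, |φ x - φ y| ≤ W x + W y) :
    ∃ c, ∀ x, |φ x - c| ≤ W x := by
  have hb : ∀ y x, φ x - W x ≤ φ y + W y := fun y x => by
    have := (abs_le.1 (h x y)).2; linarith
  refine ⟨⨆ x, (φ x - W x), fun x => ?_⟩
  have h1 : φ x - W x ≤ ⨆ x, (φ x - W x) :=
    le_ciSup (f := fun x => φ x - W x)
      ⟨φ x + W x, by rintro _ ⟨z, rfl⟩; exact hb x z⟩ x
  have h2 : (⨆ x, (φ x - W x)) ≤ φ x + W x := ciSup_le (hb x)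
  rw [abs_le]; constructor <;> linarith

lemma meas_diff_bound (m₁ m₂ : Measure E) [IsProbabilityMeasure m₁] [IsProbabilityMeasure m₂]
    (ν : Measure E) (h1 : ν ≤ m₁) (h2 : ν ≤ m₂) (r : ℝ) (hr : r ≤ ν.real Set.univ)
    (ψ V : E → ℝ) (hψ : Measurable ψ) (hV0 : ∀ x, 0 ≤ V x)
    (hV1 : Integrable V m₁) (hV2 : Integrable V m₂) (a b : ℝ) (ha : 0 ≤ a) (hb : 0 ≤ b)
    (hψb : ∀ x, |ψ x| ≤ a + b * V x) :
    |∫ x, ψ x ∂m₁ - ∫ x, ψ x ∂m₂| ≤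
      2 * a * (1 - r) + b * (∫ x, V x ∂m₁ + ∫ x, V x ∂m₂) := by
  have key : ∀ m : Measure E, IsProbabilityMeasure m → ν ≤ m → Integrable V m →
      ∃ e, ∫ x, ψ x ∂m = ∫ x, ψ x ∂ν + e ∧ |e| ≤ a * (1 - r) + b * ∫ x, V x ∂m := by
    intro m hm hν hV
    have : IsFiniteMeasure ν := isFiniteMeasure_of_le m hν
    have hadd : m - ν + ν = m := Measure.sub_add_cancel_of_le hν
    have hle : m - ν ≤ m := Measure.sub_le
    have : IsFiniteMeasure (m - ν) := isFiniteMeasure_of_le m hle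
    have hg : Integrable (fun x => a + b * V x) m := (integrable_const a).add (hV.const_mul b)
    have hψi : Integrable ψ m := hg.mono' hψ.aestronglyMeasurable
      (Eventually.of_forall fun x => by simpa using hψb x)
    have hVs : Integrable V (m - ν) := hV.mono_measure hle
    refine ⟨∫ x, ψ x ∂(m - ν), ?_, ?_⟩
    · conv_lhs => rw [← hadd]
      rw [integral_add_measure (hψi.mono_measure hle) (hψi.mono_measure hν), add_comm]
    · have hmass : (m - ν).real Set.univ ≤ 1 - r := by
        have h3 : m.real Set.univ = (m - ν).real Set.univ + ν.real Set.univ := by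
          conv_lhs => rw [← hadd]
          rw [measureReal_add_apply]
        simp at h3
        linarith
      calc |∫ x, ψ x ∂(m - ν)| ≤ ∫ x, |ψ x| ∂(m - ν) := abs_integral_le_integral_abs
        _ ≤ ∫ x, (a + b * V x) ∂(m - ν) :=
            integral_mono (hψi.mono_measure hle).abs (hg.mono_measure hle) hψb
        _ = a * (m - ν).real Set.univ + b * ∫ x, V x ∂(m - ν) := by
            rw [integral_add (integrable_const a) (hVs.const_mul b), integral_const_mul]
            simp [mul_comm]
        _ ≤ _ := by
            gcongr
            · exact Eventually.of_forall hV0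
  obtain ⟨e1, h11, h12⟩ := key m₁ inferInstance h1 hV1
  obtain ⟨e2, h21, h22⟩ := key m₂ inferInstance h2 hV2
  rw [h11, h21]
  have : ∫ x, ψ x ∂ν + e1 - (∫ x, ψ x ∂ν + e2) = e1 - e2 := by ring
  rw [this]
  have := abs_sub e1 e2
  linarith

variable (P : Kernel E E) [IsMarkovKernel P] (V : E → ℝ) (γ K : ℝ)

lemma lyap_int (hVm : Measurable V) (hV0 : ∀ x, 0 ≤ V x) (hγ : 0 ≤ γ) (hK : 0 ≤ K)
    (hL1 : ∀ x, ∫⁻ y, ENNReal.ofReal (V y) ∂(P x) ≤ ENNReal.ofReal (γ * V x + K)) (x : E) :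
    Integrable V (P x) ∧ ∫ y, V y ∂(P x) ≤ γ * V x + K := by
  have h0 : 0 ≤ γ * V x + K := add_nonneg (mul_nonneg hγ (hV0 x)) hK
  constructor
  · rw [← lintegral_ofReal_ne_top_iff_integrable hVm.aestronglyMeasurable
      (Eventually.of_forall hV0)]
    exact ((hL1 x).trans_lt ofReal_lt_top).ne
  · rw [integral_eq_lintegral_of_nonneg_ae (Eventually.of_forall hV0) hVm.aestronglyMeasurable]
    exact ENNReal.toReal_le_of_le_ofReal h0 (hL1 x)

lemma TT_meas (φ : E → ℝ) (hφ : Measurable φ) : Measurable (TT P φ) :=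
  (hφ.stronglyMeasurable.integral_kernel (κ := P)).measurable

lemma contraction_step (hV0 : ∀ x, 0 ≤ V x)
    (hPV : ∀ x, Integrable V (P x) ∧ ∫ y, V y ∂(P x) ≤ γ * V x + K)
    (R ρ : ℝ) (hL2 : ∀ x y, V x + V y ≤ R → ENNReal.ofReal ρ ≤ (P x ⊓ P y) Set.univ)
    (β χ : ℝ) (hβ : 0 < β)
    (hc1 : ∀ S, R ≤ S → 2 + β * (γ * S + 2 * K) ≤ χ * (2 + β * S))
    (hc2 : ∀ S, 0 ≤ S → 2 * (1 - ρ) + β * (γ * S + 2 * K) ≤ χ * (2 + β * S))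
    (φ : E → ℝ) (hφ : Measurable φ) (L : ℝ) (hL : 0 ≤ L)
    (hLip : ∀ x y, |φ x - φ y| ≤ L * (2 + β * V x + β * V y)) (x y : E) :
    |TT P φ x - TT P φ y| ≤ χ * L * (2 + β * V x + β * V y) := by
  have : Nonempty E := ⟨x⟩
  obtain ⟨c, hc⟩ := exists_shift φ (fun x => L + L * β * V x) (fun x y => by
    refine (hLip x y).trans (le_of_eq (by ring)))
  have hi : ∀ z, Integrable φ (P z) := fun z => by
    have hg : Integrable (fun x => |c| + (L + L * β * V x)) (P z) :=
      (integrable_const _).add ((integrable_const _).add ((hPV z).1.const_mul _))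
    refine hg.mono' hφ.aestronglyMeasurable (Eventually.of_forall fun u => ?_)
    have h1 := hc u
    have h2 := abs_add_le (φ u - c) c
    simp only [sub_add_cancel] at h2
    simp only [Real.norm_eq_abs]; linarith
  have hshift : ∀ z, ∫ u, (φ u - c) ∂(P z) = TT P φ z - c := fun z => by
    rw [integral_sub (hi z) (integrable_const _)]; simp [TT]
  have heq : TT P φ x - TT P φ y = ∫ u, (φ u - c) ∂(P x) - ∫ u, (φ u - c) ∂(P y) := by
    rw [hshift, hshift]; ring
  rw [heq]
  have hSn : 0 ≤ V x + V y := add_nonneg (hV0 x) (hV0 y)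
  have hVs := add_le_add (hPV x).2 (hPV y).2
  have hm : Measurable (fun u => φ u - c) := hφ.sub_const c
  have hLβ : 0 ≤ L * β := mul_nonneg hL hβ.le
  rcases le_total R (V x + V y) with hS | hS
  · have := meas_diff_bound (P x) (P y) 0 (Measure.zero_le _) (Measure.zero_le _) 0 (by simp)
      _ V hm hV0 (hPV x).1 (hPV y).1 L (L * β) hL hLβ hc
    have h3 := mul_le_mul_of_nonneg_left (hc1 _ hS) hL
    have h4 := mul_le_mul_of_nonneg_left hVs hLβ
    nlinarith
  · have hν := hL2 x y hS
    have hfin : (P x ⊓ P y) Set.univ ≠ ⊤ :=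
      ((Measure.le_iff'.1 (inf_le_left : P x ⊓ P y ≤ P x) Set.univ).trans_lt
        (measure_lt_top _ _)).ne
    have := meas_diff_bound (P x) (P y) (P x ⊓ P y) inf_le_left inf_le_right ρ
      ((ENNReal.ofReal_le_iff_le_toReal hfin).1 hν)
      _ V hm hV0 (hPV x).1 (hPV y).1 L (L * β) hL hLβ hc
    have h3 := mul_le_mul_of_nonneg_left (hc2 _ hSn) hL
    have h4 := mul_le_mul_of_nonneg_left hVs hLβ
    nlinarith

lemma TT_iter_meas (φ : E → ℝ) (hφ : Measurable φ) (n : ℕ) : Measurable ((TT P)^[n] φ) := by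
  induction n with
  | zero => simpa
  | succ n ih => rw [Function.iterate_succ_apply']; exact TT_meas P _ ih

lemma TT_iter_bdd (φ : E → ℝ) (B : ℝ) (hB : ∀ x, |φ x| ≤ B) (n : ℕ) (x : E) :
    |(TT P)^[n] φ x| ≤ B := by
  induction n generalizing x with
  | zero => simpa using hB x
  | succ n ih =>
    rw [Function.iterate_succ_apply', TT]
    have := norm_integral_le_of_norm_le_const (μ := P x) (f := (TT P)^[n] φ) (C := B)
      (Eventually.of_forall fun y => ih y)
    simpa using this

lemma integral_bind' (μ : Measure E) (f : E → ℝ) (hf : Integrable f (μ.bind ⇑P)) :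
    ∫ x, f x ∂(μ.bind ⇑P) = ∫ x, TT P f x ∂μ := by
  rw [Measure.comp_eq_comp_const_apply] at hf ⊢
  rw [Kernel.integral_comp hf]
  simp [TT]

lemma inv_integral (μ : Measure E) [IsProbabilityMeasure μ] (hinv : μ.bind ⇑P = μ)
    (φ : E → ℝ) (hφ : Measurable φ) (B : ℝ) (hB : ∀ x, |φ x| ≤ B) (n : ℕ) :
    ∫ x, (TT P)^[n] φ x ∂μ = ∫ x, φ x ∂μ := by
  induction n with
  | zero => simp
  | succ n ih =>
    rw [← ih]
    simp_rw [Function.iterate_succ_apply']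
    conv_rhs => rw [← hinv]
    have hi : Integrable ((TT P)^[n] φ) (μ.bind ⇑P) := by
      rw [hinv]
      exact Integrable.of_bound (TT_iter_meas P φ hφ n).aestronglyMeasurable B
        (Eventually.of_forall fun x => TT_iter_bdd P φ B hB n x)
    rw [integral_bind' P μ _ hi]

lemma inv_V (hVm : Measurable V) (hV0 : ∀ x, 0 ≤ V x) (hγ : γ ∈ Set.Ioo (0:ℝ) 1) (hK : 0 ≤ K)
    (hL1 : ∀ x, ∫⁻ y, ENNReal.ofReal (V y) ∂(P x) ≤ ENNReal.ofReal (γ * V x + K))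
    (μ : Measure E) [IsProbabilityMeasure μ] (hinv : μ.bind ⇑P = μ) :
    Integrable V μ := by
  obtain ⟨hγ0, hγ1⟩ := hγ
  have hPV := lyap_int P V γ K hVm hV0 hγ0.le hK hL1
  -- truncated
  have hmin : ∀ M : ℕ, ∀ W : E → ℝ, Measurable W → (∀ x, 0 ≤ W x) →
      Integrable (fun x => min (W x) (M:ℝ)) μ := fun M W hW hW0 =>
    Integrable.of_bound (hW.min measurable_const).aestronglyMeasurable (M:ℝ)
      (Eventually.of_forall fun x => by
        rw [Real.norm_eq_abs, abs_of_nonneg (le_min (hW0 x) (Nat.cast_nonneg _))]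
        exact min_le_right _ _)
  have hW : Measurable fun x => γ * V x + K := (hVm.const_mul γ).add_const K
  have hW0 : ∀ x, 0 ≤ γ * V x + K := fun x => add_nonneg (mul_nonneg hγ0.le (hV0 x)) hK
  have h1 : ∀ M : ℕ, ∫ x, min (V x) (M:ℝ) ∂μ ≤ ∫ x, min (γ * V x + K) (M:ℝ) ∂μ := by
    intro M
    have := inv_integral P μ hinv (fun x => min (V x) (M:ℝ)) (hVm.min measurable_const) M
      (fun x => by
        rw [abs_of_nonneg (le_min (hV0 x) (Nat.cast_nonneg _))]
        exact min_le_right _ _) 1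
    rw [← this]
    have hb : ∀ x, TT P (fun x => min (V x) (M:ℝ)) x ≤ min (γ * V x + K) (M:ℝ) := by
      intro x
      have hi : Integrable (fun x => min (V x) (M:ℝ)) (P x) :=
        (hPV x).1.inf (integrable_const _)
      refine le_min ?_ ?_
      · exact (integral_mono hi (hPV x).1 (fun y => min_le_left _ _)).trans (hPV x).2
      · refine (integral_mono hi (integrable_const (M:ℝ)) (fun y => min_le_right _ _)).trans ?_
        simp
    refine integral_mono_of_nonneg (Eventually.of_forall fun x => ?_) (hmin M _ hW hW0)
      (Eventually.of_forall hb)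
    exact integral_nonneg fun y => le_min (hV0 y) (Nat.cast_nonneg _)
  set g : ℕ → E → ℝ := fun M x => min (V x) (M:ℝ) - min (γ * V x + K) (M:ℝ) + K with hg
  have hgm : ∀ M, Measurable (g M) := fun M =>
    ((hVm.min measurable_const).sub (hW.min measurable_const)).add_const K
  have hg0 : ∀ M x, 0 ≤ g M x := by
    intro M x
    have : 0 ≤ (1 - γ) * V x := mul_nonneg (by linarith) (hV0 x)
    simp only [hg]
    rcases le_total (V x) M with h | h
    · rw [min_eq_left h]
      have := min_le_left (γ * V x + K) (M:ℝ)
      linarith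
    · rw [min_eq_right h]
      have := min_le_right (γ * V x + K) (M:ℝ)
      linarith
  have hgi : ∀ M, Integrable (g M) μ := fun M =>
    ((hmin M V hVm hV0).sub (hmin M _ hW hW0)).add (integrable_const K)
  have hgint : ∀ M, ∫ x, g M x ∂μ ≤ K := by
    intro M
    have hs : Integrable (fun x => min (V x) (M:ℝ) - min (γ * V x + K) (M:ℝ)) μ :=
      (hmin M V hVm hV0).sub (hmin M _ hW hW0)
    simp only [hg]
    rw [integral_add hs (integrable_const K),
      integral_sub (hmin M V hVm hV0) (hmin M _ hW hW0)]
    have := h1 M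
    simp
    linarith
  have hlim : ∀ x, ENNReal.ofReal ((1 - γ) * V x) =
      liminf (fun M => ENNReal.ofReal (g M x)) atTop := by
    intro x
    refine (Tendsto.liminf_eq ?_).symm
    refine tendsto_const_nhds.congr' ?_
    filter_upwards [eventually_ge_atTop ⌈max (V x) (γ * V x + K)⌉₊] with M hM
    have hM' := Nat.ceil_le.1 hM
    simp only [hg]
    rw [min_eq_left (le_trans (le_max_left _ _) hM'), min_eq_left (le_trans (le_max_right _ _) hM')]
    congr 1; ring
  have hfat : ∫⁻ x, ENNReal.ofReal ((1 - γ) * V x) ∂μ ≤ ENNReal.ofReal K := by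
    simp_rw [hlim]
    refine (lintegral_liminf_le fun M => (hgm M).ennreal_ofReal).trans ?_
    refine liminf_le_of_le (by isBoundedDefault) (fun b hb => ?_)
    obtain ⟨M, hM⟩ := hb.exists
    refine hM.trans ?_
    rw [← ofReal_integral_eq_lintegral_ofReal (hgi M) (Eventually.of_forall (hg0 M))]
    exact ENNReal.ofReal_le_ofReal (hgint M)
  have hint : Integrable (fun x => (1 - γ) * V x) μ := by
    rw [← lintegral_ofReal_ne_top_iff_integrable (hVm.const_mul _).aestronglyMeasurable
      (Eventually.of_forall fun x => mul_nonneg (by linarith) (hV0 x))]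
    exact (hfat.trans_lt ofReal_lt_top).ne
  have := hint.const_mul (1 - γ)⁻¹
  refine this.congr (Eventually.of_forall fun x => ?_)
  have : 1 - γ ≠ 0 := by linarith
  simp; field_simp

/-- Geometric ergodicity in weighted norm, for bounded functions, with uniform constants. -/
lemma harris [Nonempty E] (hVm : Measurable V) (hV0 : ∀ x, 0 ≤ V x) (hγ : γ ∈ Set.Ioo (0:ℝ) 1)
    (hK : 0 ≤ K)
    (hL1 : ∀ x, ∫⁻ y, ENNReal.ofReal (V y) ∂(P x) ≤ ENNReal.ofReal (γ * V x + K))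
    (R ρ : ℝ) (hR : 2 * K / (1 - γ) < R) (hρ : ρ ∈ Set.Ioc (0:ℝ) 1)
    (hL2 : ∀ x y, V x + V y ≤ R → ENNReal.ofReal ρ ≤ (P x ⊓ P y) Set.univ)
    (μ : Measure E) [IsProbabilityMeasure μ] (hinv : μ.bind ⇑P = μ) :
    ∃ C χ : ℝ, 0 ≤ C ∧ 0 < χ ∧ χ < 1 ∧ ∀ (φ : E → ℝ) (B a : ℝ), Measurable φ →
      (∀ x, |φ x| ≤ B) → 0 ≤ a → (∀ x, |φ x| ≤ a * (1 + V x)) → ∀ n x,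
      |(TT P)^[n] φ x - ∫ y, φ y ∂μ| ≤ C * a * χ ^ n * (1 + V x) := by
  obtain ⟨β, χ, hβ0, hβ1, hχ0, hχ1, hc1, hc2⟩ := exists_consts γ K R ρ hγ hK hR hρ
  have hVμ := inv_V P V γ K hVm hV0 hγ hK hL1 μ hinv
  have hPV := lyap_int P V γ K hVm hV0 hγ.1.le hK hL1
  have hμV : 0 ≤ ∫ y, V y ∂μ := integral_nonneg hV0
  refine ⟨β⁻¹ * (2 + β + β * ∫ y, V y ∂μ), χ, by positivity, hχ0, hχ1, ?_⟩
  intro φ B a hφ hB ha hφa n x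
  have hiter : ∀ n x y, |(TT P)^[n] φ x - (TT P)^[n] φ y| ≤
      (χ ^ n * (a * β⁻¹)) * (2 + β * V x + β * V y) := by
    intro n
    induction n with
    | zero =>
      intro x y
      have h1 := abs_sub (φ x) (φ y)
      have h2 := hφa x
      have h3 := hφa y
      have hβi : 1 ≤ β⁻¹ := (one_le_inv₀ hβ0).2 hβ1
      have h4 : a * β⁻¹ * (2 + β * V x + β * V y) = a * (2 * β⁻¹ + V x + V y) := by
        field_simp
      have h5 : a * (2 * β⁻¹ + V x + V y) ≥ a * (2 + V x + V y) := by
        apply mul_le_mul_of_nonneg_left _ ha; linarith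
      simp only [Function.iterate_zero, id_eq, pow_zero, one_mul]
      rw [h4]; nlinarith
    | succ n ih =>
      intro x y
      rw [Function.iterate_succ_apply']
      have := contraction_step P V γ K hV0 hPV R ρ hL2 β χ hβ0 hc1 hc2 _
        (TT_iter_meas P φ hφ n) (χ ^ n * (a * β⁻¹)) (by positivity) ih x y
      refine this.trans (le_of_eq (by ring))
  rw [← inv_integral P μ hinv φ hφ B hB n]
  have hi : Integrable ((TT P)^[n] φ) μ :=
    Integrable.of_bound (TT_iter_meas P φ hφ n).aestronglyMeasurable B
        (Eventually.of_forall fun x => TT_iter_bdd P φ B hB n x)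
  have h1 : (TT P)^[n] φ x - ∫ y, (TT P)^[n] φ y ∂μ
      = ∫ y, ((TT P)^[n] φ x - (TT P)^[n] φ y) ∂μ := by
    rw [integral_sub (integrable_const _) hi]; simp
  rw [h1]
  have hgi : Integrable (fun y => (χ ^ n * (a * β⁻¹)) * (2 + β * V x + β * V y)) μ :=
    ((integrable_const _).add (hVμ.const_mul β)).const_mul _
  calc |∫ y, ((TT P)^[n] φ x - (TT P)^[n] φ y) ∂μ|
      ≤ ∫ y, |(TT P)^[n] φ x - (TT P)^[n] φ y| ∂μ := abs_integral_le_integral_abs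
    _ ≤ ∫ y, (χ ^ n * (a * β⁻¹)) * (2 + β * V x + β * V y) ∂μ :=
        integral_mono ((integrable_const _).sub hi).abs hgi (hiter n x)
    _ = (χ ^ n * (a * β⁻¹)) * (2 + β * V x + β * ∫ y, V y ∂μ) := by
        rw [integral_const_mul, integral_add (integrable_const _) (hVμ.const_mul β),
          integral_const_mul]
        simp
    _ ≤ (χ ^ n * (a * β⁻¹)) * ((2 + β + β * ∫ y, V y ∂μ) * (1 + V x)) := by
        apply mul_le_mul_of_nonneg_left _ (by positivity)
        have := mul_nonneg (mul_nonneg hβ0.le hμV) (hV0 x)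
        nlinarith [hV0 x]
    _ = _ := by ring

end Harris


namespace Harris
variable {E : Type*} [MeasurableSpace E] {Ω : Type*} [MeasurableSpace Ω]

/-- Natural filtration. -/
def FF (X : ℕ → Ω → E) (j : ℕ) : MeasurableSpace Ω :=
  MeasurableSpace.comap (fun ω (k : Fin (j + 1)) => X k.1 ω) MeasurableSpace.pi

/-- Markov property for a finite measure. -/
def MC (Q : Measure Ω) (X : ℕ → Ω → E) (P : Kernel E E) : Prop :=
  (∀ i, Measurable (X i)) ∧ ∀ j (B : Set Ω), MeasurableSet[FF X j] B →
    (Q.restrict B).map (X (j + 1)) = ((Q.restrict B).map (X j)).bind ⇑P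

lemma FF_le (X : ℕ → Ω → E) (hX : ∀ i, Measurable (X i)) (j : ℕ) :
    FF X j ≤ ‹MeasurableSpace Ω› := by
  apply Measurable.comap_le
  exact measurable_pi_lambda _ fun k => hX k

lemma FF_meas (X : ℕ → Ω → E) (i j : ℕ) (hij : i ≤ j) : Measurable[FF X j] (X i) := by
  have h1 : Measurable[FF X j] (fun ω (k : Fin (j + 1)) => X k.1 ω) := comap_measurable _
  exact (measurable_pi_apply (⟨i, by omega⟩ : Fin (j + 1))).comp h1

lemma MC_of_chain (Pr : Measure Ω) [IsProbabilityMeasure Pr] (X : ℕ → Ω → E) (P : Kernel E E)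
    [IsMarkovKernel P] (hX : ∀ i, Measurable (X i))
    (h : ∀ i : ℕ, ∀ A : Set E, MeasurableSet A →
      (fun ω => ((P (X i ω)) A).toReal) =ᵐ[Pr]
        Pr[fun ω => Set.indicator A (fun _ => (1:ℝ)) (X (i + 1) ω) |
          MeasurableSpace.comap (fun ω (j : Fin (i + 1)) => X j.1 ω) MeasurableSpace.pi]) :
    MC Pr X P := by
  refine ⟨hX, fun j B hB => ?_⟩
  have hle := FF_le X hX j
  have hB' : MeasurableSet B := hle _ hB
  ext A hA
  rw [Measure.map_apply (hX _) hA, Measure.bind_apply hA P.measurable.aemeasurable,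
    lintegral_map (P.measurable_coe hA) (hX j)]
  have h1 : ∫ ω in B, ((P (X j ω)) A).toReal ∂Pr =
      ∫ ω in B, Set.indicator A (fun _ => (1:ℝ)) (X (j + 1) ω) ∂Pr := by
    have hmi : Measurable (A.indicator (fun _ => (1:ℝ))) := measurable_const.indicator hA
    have hint : Integrable (fun ω => Set.indicator A (fun _ => (1:ℝ)) (X (j + 1) ω)) Pr :=
      Integrable.of_bound (hmi.comp (hX (j + 1))).aestronglyMeasurable 1
        (Eventually.of_forall fun ω => by
          by_cases hh : X (j + 1) ω ∈ A <;> simp [hh])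
    rw [← setIntegral_condExp hle hint hB]
    exact integral_congr_ae (ae_restrict_of_ae (h j A hA))
  have h2 : ∫ ω in B, Set.indicator A (fun _ => (1:ℝ)) (X (j + 1) ω) ∂Pr =
      ((Pr.restrict B) (X (j + 1) ⁻¹' A)).toReal := by
    have : (fun ω => Set.indicator A (fun _ => (1:ℝ)) (X (j + 1) ω)) =
        Set.indicator (X (j + 1) ⁻¹' A) (fun _ => (1:ℝ)) := by
      ext ω; by_cases hh : X (j + 1) ω ∈ A <;> simp [hh]
    rw [this, integral_indicator_const _ ((hX _) hA)]
    simp [Measure.real]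
  have hm : Measurable fun ω => (P (X j ω)) A := (P.measurable_coe hA).comp (hX j)
  have h3 : ∫ ω in B, ((P (X j ω)) A).toReal ∂Pr = (∫⁻ ω in B, (P (X j ω)) A ∂Pr).toReal :=
    integral_toReal hm.aemeasurable (Eventually.of_forall fun ω => measure_lt_top _ _)
  rw [h2, h3] at h1
  refine ((ENNReal.toReal_eq_toReal_iff' ?_ (measure_ne_top _ _)).1 h1).symm
  refine (lt_of_le_of_lt (lintegral_mono (g := fun _ => 1) fun ω => prob_le_one) ?_).ne
  simp

lemma MC_restrict (Q : Measure Ω) (X : ℕ → Ω → E) (P : Kernel E E) (h : MC Q X P)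
    (S : Set E) (hS : MeasurableSet S) : MC (Q.restrict (X 0 ⁻¹' S)) X P := by
  refine ⟨h.1, fun j B hB => ?_⟩
  have hB' : MeasurableSet B := FF_le X h.1 j _ hB
  rw [Measure.restrict_restrict hB']
  exact h.2 j _ (hB.inter (FF_meas X 0 j (Nat.zero_le _) hS))

variable (Q : Measure Ω) [IsFiniteMeasure Q] (X : ℕ → Ω → E) (P : Kernel E E) [IsMarkovKernel P]

lemma mc_int (h : MC Q X P) (i j : ℕ) (hij : i ≤ j) (g φ : E → ℝ) (hg : Measurable g)
    (hφ : Measurable φ) (Bg Bφ : ℝ) (hgB : ∀ x, |g x| ≤ Bg) (hφB : ∀ x, |φ x| ≤ Bφ) :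
    ∫ ω, g (X i ω) * φ (X (j + 1) ω) ∂Q = ∫ ω, g (X i ω) * TT P φ (X j ω) ∂Q := by
  have hle := FF_le X h.1 j
  have hTm := TT_meas P φ hφ
  have hTB : ∀ x, |TT P φ x| ≤ Bφ := fun x => TT_iter_bdd P φ Bφ hφB 1 x
  have hφi : Integrable (fun ω => φ (X (j + 1) ω)) Q :=
    Integrable.of_bound (hφ.comp (h.1 _)).aestronglyMeasurable Bφ
      (Eventually.of_forall fun ω => hφB _)
  have hTi : Integrable (fun ω => TT P φ (X j ω)) Q :=
    Integrable.of_bound (hTm.comp (h.1 _)).aestronglyMeasurable Bφ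
      (Eventually.of_forall fun ω => hTB _)
  have hc : (fun ω => TT P φ (X j ω)) =ᵐ[Q] Q[fun ω => φ (X (j + 1) ω) | FF X j] := by
    refine ae_eq_condExp_of_forall_setIntegral_eq hle hφi (fun s _ _ => hTi.integrableOn) ?_ ?_
    · intro B hB _
      have h2 := h.2 j B hB
      have e1 : ∫ ω in B, φ (X (j + 1) ω) ∂Q = ∫ x, φ x ∂((Q.restrict B).map (X (j + 1))) :=
        (integral_map (h.1 _).aemeasurable hφ.aestronglyMeasurable).symm
      have e2 : ∫ ω in B, TT P φ (X j ω) ∂Q = ∫ x, TT P φ x ∂((Q.restrict B).map (X j)) :=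
        (integral_map (h.1 _).aemeasurable hTm.aestronglyMeasurable).symm
      rw [e1, e2, h2, integral_bind']
      rw [← h2]
      exact Integrable.of_bound hφ.aestronglyMeasurable Bφ (Eventually.of_forall fun ω => hφB _)
    · exact (hTm.comp (FF_meas X j j le_rfl)).stronglyMeasurable.aestronglyMeasurable
  have hgm : StronglyMeasurable[FF X j] (fun ω => g (X i ω)) :=
    (hg.comp (FF_meas X i j hij)).stronglyMeasurable
  have h3 := condExp_stronglyMeasurable_mul_of_bound hle hgm hφi Bg
    (Eventually.of_forall fun ω => hgB _)
  have h4 := integral_condExp hle (μ := Q) (f := (fun ω => g (X i ω)) * fun ω => φ (X (j + 1) ω))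
  have h5 : ∫ ω, g (X i ω) * φ (X (j + 1) ω) ∂Q =
    ∫ ω, ((fun ω => g (X i ω)) * fun ω => φ (X (j + 1) ω)) ω ∂Q := rfl
  rw [h5, ← h4]
  refine integral_congr_ae ?_
  filter_upwards [h3, hc] with ω h6 h7
  rw [h6, Pi.mul_apply, ← h7]

lemma mc_iter (h : MC Q X P) (i n : ℕ) (g φ : E → ℝ) (hg : Measurable g)
    (hφ : Measurable φ) (Bg Bφ : ℝ) (hgB : ∀ x, |g x| ≤ Bg) (hφB : ∀ x, |φ x| ≤ Bφ) :
    ∫ ω, g (X i ω) * φ (X (i + n) ω) ∂Q = ∫ ω, g (X i ω) * (TT P)^[n] φ (X i ω) ∂Q := by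
  induction n generalizing φ with
  | zero => simp
  | succ n ih =>
    rw [Function.iterate_succ_apply, ← ih (TT P φ) (TT_meas P φ hφ)
      (fun x => TT_iter_bdd P φ Bφ hφB 1 x), ← add_assoc]
    exact mc_int Q X P h i (i + n) (Nat.le_add_right _ _) g φ hg hφ Bg Bφ hgB hφB

variable (V : E → ℝ) (γ K : ℝ)

lemma mc_V (h : MC Q X P) (hVm : Measurable V) (hV0 : ∀ x, 0 ≤ V x)
    (hγ : γ ∈ Set.Ioo (0:ℝ) 1) (hK : 0 ≤ K)
    (hL1 : ∀ x, ∫⁻ y, ENNReal.ofReal (V y) ∂(P x) ≤ ENNReal.ofReal (γ * V x + K))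
    (hX0 : Integrable (fun ω => V (X 0 ω)) Q) :
    ∃ D, ∀ i, Integrable (fun ω => V (X i ω)) Q ∧ ∫ ω, (1 + V (X i ω)) ∂Q ≤ D := by
  obtain ⟨hγ0, hγ1⟩ := hγ
  set q := Q.real Set.univ
  have hq : 0 ≤ q := measureReal_nonneg
  have h1γ : 0 < 1 - γ := by linarith
  set D := ∫ ω, V (X 0 ω) ∂Q + K * q / (1 - γ) with hD
  have hI0 : 0 ≤ ∫ ω, V (X 0 ω) ∂Q := integral_nonneg fun ω => hV0 _
  have hstep : γ * D + K * q ≤ D := by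
    have : K * q / (1 - γ) * (1 - γ) = K * q := by field_simp
    rw [hD]; nlinarith
  have main : ∀ i, Integrable (fun ω => V (X i ω)) Q ∧ ∫ ω, V (X i ω) ∂Q ≤ D := by
    intro i
    induction i with
    | zero => exact ⟨hX0, by rw [hD]; have : 0 ≤ K * q / (1 - γ) := by positivity
                             linarith⟩
    | succ i ih =>
      have e : Q.map (X (i + 1)) = (Q.map (X i)).bind ⇑P := by
        have := h.2 i Set.univ MeasurableSet.univ
        simpa using this
      have hVe : Measurable fun x => ENNReal.ofReal (V x) := hVm.ennreal_ofReal
      have h0 : ∀ ω, 0 ≤ γ * V (X i ω) + K := fun ω => add_nonneg (mul_nonneg hγ0.le (hV0 _)) hK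
      have hi : Integrable (fun ω => γ * V (X i ω) + K) Q :=
        (ih.1.const_mul γ).add (integrable_const K)
      have hl : ∫⁻ ω, ENNReal.ofReal (V (X (i + 1) ω)) ∂Q ≤
          ENNReal.ofReal (∫ ω, (γ * V (X i ω) + K) ∂Q) := by
        rw [← lintegral_map hVe (h.1 (i+1)), e,
          Measure.lintegral_bind P.measurable.aemeasurable hVe.aemeasurable,
          lintegral_map hVe.lintegral_kernel (h.1 i),
          ofReal_integral_eq_lintegral_ofReal hi (Eventually.of_forall h0)]
        exact lintegral_mono fun ω => hL1 _
      have hmeas : AEStronglyMeasurable (fun ω => V (X (i + 1) ω)) Q :=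
        (hVm.comp (h.1 _)).aestronglyMeasurable
      constructor
      · rw [← lintegral_ofReal_ne_top_iff_integrable hmeas (Eventually.of_forall fun ω => hV0 _)]
        exact (hl.trans_lt ofReal_lt_top).ne
      · rw [integral_eq_lintegral_of_nonneg_ae (Eventually.of_forall fun ω => hV0 _) hmeas]
        refine (ENNReal.toReal_le_of_le_ofReal (integral_nonneg h0) hl).trans ?_
        rw [integral_add (ih.1.const_mul γ) (integrable_const K), integral_const_mul]
        simp only [integral_const, smul_eq_mul]
        have := mul_le_mul_of_nonneg_left ih.2 hγ0.le
        change _ + q * K ≤ _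
        linarith
  refine ⟨q + D, fun i => ⟨(main i).1, ?_⟩⟩
  rw [integral_add (integrable_const _) (main i).1]
  simp only [integral_const, smul_eq_mul, mul_one]
  exact add_le_add_right (main i).2 q

lemma law_rate (h : MC Q X P) (hV0 : ∀ x, 0 ≤ V x)
    (hX0 : Integrable (fun ω => V (X 0 ω)) Q)
    (μ : Measure E) [IsProbabilityMeasure μ] (C χ D : ℝ) (hC : 0 ≤ C) (hχ : 0 < χ)
    (hD : ∫ ω, (1 + V (X 0 ω)) ∂Q ≤ D)
    (hH : ∀ (φ : E → ℝ) (B a : ℝ), Measurable φ →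
      (∀ x, |φ x| ≤ B) → 0 ≤ a → (∀ x, |φ x| ≤ a * (1 + V x)) → ∀ n x,
      |(TT P)^[n] φ x - ∫ y, φ y ∂μ| ≤ C * a * χ ^ n * (1 + V x))
    (φ : E → ℝ) (B a : ℝ) (hφ : Measurable φ)
    (hB : ∀ x, |φ x| ≤ B) (ha : 0 ≤ a) (hφa : ∀ x, |φ x| ≤ a * (1 + V x)) (n : ℕ) :
    ∫ ω, φ (X n ω) ∂Q ≤ Q.real Set.univ * ∫ y, φ y ∂μ + C * a * χ ^ n * D := by
  have h1 := mc_iter Q X P h 0 n (fun _ => 1) φ measurable_const hφ 1 B (by simp) hB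
  simp only [one_mul, zero_add] at h1
  rw [h1]
  have hi : Integrable (fun ω => (TT P)^[n] φ (X 0 ω)) Q :=
    Integrable.of_bound ((TT_iter_meas P φ hφ n).comp (h.1 0)).aestronglyMeasurable B
      (Eventually.of_forall fun ω => TT_iter_bdd P φ B hB n _)
  have hi2 : Integrable (fun ω => 1 + V (X 0 ω)) Q := (integrable_const _).add hX0
  calc ∫ ω, (TT P)^[n] φ (X 0 ω) ∂Q
      ≤ ∫ ω, (∫ y, φ y ∂μ + C * a * χ ^ n * (1 + V (X 0 ω))) ∂Q := by
        refine integral_mono hi ((integrable_const _).add (hi2.const_mul _)) fun ω => ?_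
        have := (abs_le.1 (hH φ B a hφ hB ha hφa n (X 0 ω))).2
        simp only
        linarith
    _ = Q.real Set.univ * ∫ y, φ y ∂μ + C * a * χ ^ n * ∫ ω, (1 + V (X 0 ω)) ∂Q := by
        rw [integral_add (integrable_const _) (hi2.const_mul _), integral_const_mul]
        simp
    _ ≤ _ := by gcongr

end Harris


namespace Harris
variable {E : Type*} [MeasurableSpace E] {Ω : Type*} [MeasurableSpace Ω]

/-- Working hypotheses for the law of large numbers. -/
structure Setup (Q : Measure Ω) (X : ℕ → Ω → E) (P : Kernel E E) (V : E → ℝ) (μ : Measure E)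
    (C χ D : ℝ) : Prop where
  mc : MC Q X P
  hVm : Measurable V
  hV0 : ∀ x, 0 ≤ V x
  hC : 0 ≤ C
  hχ0 : 0 < χ
  hχ1 : χ < 1
  hD : ∀ i, Integrable (fun ω => V (X i ω)) Q ∧ ∫ ω, (1 + V (X i ω)) ∂Q ≤ D
  hμ : Integrable V μ
  hH : ∀ (φ : E → ℝ) (B a : ℝ), Measurable φ →
      (∀ x, |φ x| ≤ B) → 0 ≤ a → (∀ x, |φ x| ≤ a * (1 + V x)) → ∀ n x,
      |(TT P)^[n] φ x - ∫ y, φ y ∂μ| ≤ C * a * χ ^ n * (1 + V x)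

/-- Truncation on sublevel sets of `V`. -/
def tr (V : E → ℝ) (f : E → ℝ) (i : ℕ) : E → ℝ := {x | V x ≤ i}.indicator f

lemma tr_meas (V f : E → ℝ) (hV : Measurable V) (hf : Measurable f) (i : ℕ) :
    Measurable (tr V f i) := hf.indicator (measurableSet_le hV measurable_const)

lemma tr_nonneg (V f : E → ℝ) (hf : ∀ x, 0 ≤ f x) (i : ℕ) (x : E) : 0 ≤ tr V f i x :=
  Set.indicator_nonneg (fun x _ => hf x) x

lemma tr_le (V f : E → ℝ) (hf : ∀ x, 0 ≤ f x) (i : ℕ) (x : E) : tr V f i x ≤ f x :=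
  Set.indicator_le_self' (fun x _ => hf x) x

lemma tr_eq (V f : E → ℝ) (i : ℕ) (x : E) (h : V x ≤ i) : tr V f i x = f x :=
  Set.indicator_of_mem (s := {x | V x ≤ i}) h f

lemma tr_bdd (V f : E → ℝ) (hf1 : ∀ x, f x ≤ 1 + V x) (i : ℕ) (x : E) :
    tr V f i x ≤ 1 + i := by
  by_cases h : V x ≤ i
  · rw [tr_eq V f i x h]; linarith [hf1 x]
  · rw [tr, Set.indicator_of_notMem (by simpa using h)]; positivity

variable {Q : Measure Ω} [IsFiniteMeasure Q] {X : ℕ → Ω → E} {P : Kernel E E} [IsMarkovKernel P]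
  {V : E → ℝ} {μ : Measure E} [IsProbabilityMeasure μ] {C χ D : ℝ}

lemma Setup.D_nonneg (S : Setup Q X P V μ C χ D) : 0 ≤ D :=
  (integral_nonneg fun ω => by have := S.hV0 (X 0 ω); simp only [Pi.zero_apply]; linarith).trans
    (S.hD 0).2

lemma Setup.rate (S : Setup Q X P V μ C χ D) (φ : E → ℝ) (B a : ℝ) (hφ : Measurable φ)
    (hB : ∀ x, |φ x| ≤ B) (ha : 0 ≤ a) (hφa : ∀ x, |φ x| ≤ a * (1 + V x)) (n : ℕ) :
    ∫ ω, φ (X n ω) ∂Q ≤ Q.real Set.univ * ∫ y, φ y ∂μ + C * a * χ ^ n * D :=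
  law_rate Q X P V S.mc S.hV0 (S.hD 0).1 μ C χ D S.hC S.hχ0 (S.hD 0).2 S.hH φ B a hφ hB ha hφa n

lemma Setup.bc (S : Setup Q X P V μ C χ D) : ∀ᵐ ω ∂Q, ∀ᶠ i : ℕ in atTop, V (X i ω) ≤ i := by
  have hsum : Summable fun i : ℕ => μ.real {x | V x ∈ Set.Ioi (i:ℝ)} := by
    letI : MeasureSpace E := ⟨μ⟩
    have : IsProbabilityMeasure (volume : Measure E) := ‹IsProbabilityMeasure μ›
    have h1 := tsum_prob_mem_Ioi_lt_top (X := V) S.hμ S.hV0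
    exact ENNReal.summable_toReal h1.ne
  have hms : ∀ i : ℕ, MeasurableSet {x | V x ∈ Set.Ioi (i:ℝ)} := fun i => S.hVm measurableSet_Ioi
  have hb : ∀ i : ℕ, Q.real (X i ⁻¹' {x | V x ∈ Set.Ioi (i:ℝ)}) ≤
      Q.real Set.univ * μ.real {x | V x ∈ Set.Ioi (i:ℝ)} + C * 1 * χ ^ i * D := by
    intro i
    set A := {x | V x ∈ Set.Ioi (i:ℝ)}
    have := S.rate (A.indicator fun _ => 1) 1 1 (measurable_const.indicator (hms i))
      (fun x => by by_cases h : x ∈ A <;> simp [h]) zero_le_one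
      (fun x => by have := S.hV0 x; by_cases h : x ∈ A <;> simp [h] <;> linarith) i
    rw [integral_indicator_const _ (hms i)] at this
    have e : (fun ω => A.indicator (fun _ => (1:ℝ)) (X i ω)) =
        (X i ⁻¹' A).indicator fun _ => (1:ℝ) := by
      ext ω; by_cases h : X i ω ∈ A <;> simp [h]
    rw [e, integral_indicator_const _ (S.mc.1 i (hms i))] at this
    simp only [smul_eq_mul, mul_one] at this ⊢
    exact this
  have hs2 : Summable fun i : ℕ => Q.real (X i ⁻¹' {x | V x ∈ Set.Ioi (i:ℝ)}) := by
    refine Summable.of_nonneg_of_le (fun i => measureReal_nonneg) hb ?_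
    exact (hsum.mul_left _).add
      (((summable_geometric_of_lt_one S.hχ0.le S.hχ1).mul_left _).mul_right _)
  have h3 : ∑' i : ℕ, Q (X i ⁻¹' {x | V x ∈ Set.Ioi (i:ℝ)}) ≠ ⊤ := by
    have e : ∀ i : ℕ, Q (X i ⁻¹' {x | V x ∈ Set.Ioi (i:ℝ)}) =
        ENNReal.ofReal (Q.real (X i ⁻¹' {x | V x ∈ Set.Ioi (i:ℝ)})) := fun i => by simp
    simp_rw [e]
    rw [← ENNReal.ofReal_tsum_of_nonneg (fun i => measureReal_nonneg) hs2]
    exact ofReal_ne_top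
  filter_upwards [ae_eventually_notMem h3] with ω hω
  filter_upwards [hω] with i hi
  simpa using hi

lemma exists_poly_bound (hχ0 : 0 < χ) (hχ1 : χ < 1) :
    ∃ B0 : ℝ, 0 ≤ B0 ∧ ∀ i : ℕ, (1 + (i:ℝ)) * χ ^ i ≤ B0 := by
  have hs : Summable fun i : ℕ => (1 + (i:ℝ)) * χ ^ i := by
    have h1 := summable_geometric_of_lt_one hχ0.le hχ1
    have h2 := summable_pow_mul_geometric_of_norm_lt_one (R := ℝ) 1 (r := χ)
      (by rwa [Real.norm_eq_abs, abs_of_pos hχ0])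
    refine (h1.add h2).congr fun i => ?_
    simp; ring
  have hn : ∀ i : ℕ, 0 ≤ (1 + (i:ℝ)) * χ ^ i := fun i => by positivity
  exact ⟨∑' i : ℕ, (1 + (i:ℝ)) * χ ^ i, tsum_nonneg hn, fun i => hs.le_tsum i fun j _ => hn j⟩

/-- `μ((1+V)² ; V ≤ N)`. -/
def phI (V : E → ℝ) (μ : Measure E) (N : ℕ) : ℝ := ∫ x, tr V (fun x => (1 + V x) ^ 2) N x ∂μ

lemma ph_le (hV0 : ∀ x, 0 ≤ V x) (i : ℕ) (x : E) :
    tr V (fun x => (1 + V x) ^ 2) i x ≤ (1 + i) * (1 + V x) := by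
  have h0 := hV0 x
  by_cases h : V x ≤ i
  · rw [tr_eq V _ i x h]; nlinarith
  · rw [tr, Set.indicator_of_notMem (by simpa using h)]; positivity

lemma ph_bdd (hV0 : ∀ x, 0 ≤ V x) (i : ℕ) (x : E) :
    tr V (fun x => (1 + V x) ^ 2) i x ≤ (1 + i) ^ 2 := by
  have h0 := hV0 x
  by_cases h : V x ≤ i
  · rw [tr_eq V _ i x h]; gcongr
  · rw [tr, Set.indicator_of_notMem (by simpa using h)]; positivity

lemma ph_int (hVm : Measurable V) (hV0 : ∀ x, 0 ≤ V x) (i : ℕ) (m : Measure E)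
    [IsFiniteMeasure m] :
    Integrable (tr V (fun x => (1 + V x) ^ 2) i) m :=
  Integrable.of_bound (tr_meas V _ hVm (by fun_prop) i).aestronglyMeasurable ((1 + i) ^ 2)
    (Eventually.of_forall fun x => by
      rw [Real.norm_eq_abs, abs_of_nonneg (tr_nonneg V _ (fun x => sq_nonneg _) i x)]
      exact ph_bdd hV0 i x)

lemma phI_mono (hVm : Measurable V) (hV0 : ∀ x, 0 ≤ V x) {i N : ℕ} (h : i ≤ N) :
    phI V μ i ≤ phI V μ N := by
  refine integral_mono (ph_int hVm hV0 i μ) (ph_int hVm hV0 N μ) fun x => ?_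
  refine Set.indicator_le_indicator_of_subset (fun x hx => ?_) (fun x => sq_nonneg _) x
  have : (i:ℝ) ≤ N := by exact_mod_cast h
  exact le_trans (show V x ≤ i from hx) this

lemma phI_nonneg (N : ℕ) : 0 ≤ phI V μ N :=
  integral_nonneg fun x => tr_nonneg V _ (fun x => sq_nonneg _) N x

lemma geo_bound (hχ0 : 0 < χ) (hχ1 : χ < 1) (n : ℕ) :
    ∑ i ∈ Finset.range n, χ ^ (n - i) ≤ 1 / (1 - χ) := by
  have h1 : 0 < 1 - χ := by linarith
  induction n with
  | zero => simp; linarith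
  | succ n ih =>
    rw [Finset.sum_range_succ]
    have e : ∑ i ∈ Finset.range n, χ ^ (n + 1 - i) = χ * ∑ i ∈ Finset.range n, χ ^ (n - i) := by
      rw [Finset.mul_sum]
      refine Finset.sum_congr rfl fun i hi => ?_
      have : n + 1 - i = (n - i) + 1 := by have := Finset.mem_range.1 hi; omega
      rw [this, pow_succ, mul_comm]
    rw [e]
    have h2 := mul_le_mul_of_nonneg_left ih hχ0.le
    have h3 : 1 / (1 - χ) = χ * (1 / (1 - χ)) + 1 := by field_simp; ring
    have h4 : χ ^ (n + 1 - n) = χ := by simp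
    rw [h4]; linarith

/-- centered truncated function -/
def cen (V : E → ℝ) (μ : Measure E) (f : E → ℝ) (i : ℕ) : E → ℝ :=
  fun x => tr V f i x - ∫ y, tr V f i y ∂μ

lemma Setup.second_moment (S : Setup Q X P V μ C χ D) :
    ∃ C4 : ℝ, 0 ≤ C4 ∧ ∀ f : E → ℝ, Measurable f → (∀ x, 0 ≤ f x) → (∀ x, f x ≤ 1 + V x) →
      ∀ N : ℕ, Integrable (fun ω => (∑ i ∈ Finset.range N, cen V μ f i (X i ω)) ^ 2) Q ∧
      ∫ ω, (∑ i ∈ Finset.range N, cen V μ f i (X i ω)) ^ 2 ∂Q ≤ C4 * N * (1 + phI V μ N) := by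
  obtain ⟨B0, hB0, hB0'⟩ := exists_poly_bound S.hχ0 S.hχ1
  set c := 1 + ∫ x, V x ∂μ with hc
  have hμV : 0 ≤ ∫ x, V x ∂μ := integral_nonneg S.hV0
  have hc0 : 0 ≤ c := by linarith
  set q := Q.real Set.univ with hq
  have hq0 : 0 ≤ q := measureReal_nonneg
  have hD0 := S.D_nonneg
  have hC := S.hC
  have h1χ : 0 < 1 - χ := by linarith [S.hχ1]
  set C3 := q + C * B0 * D + c * D with hC3
  have hC30 : 0 ≤ C3 := by positivity
  set C1 := C * (1 + c) with hC1
  have hC10 : 0 ≤ C1 := by positivity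
  refine ⟨C1 * C3 * (2 / (1 - χ) + 1), by positivity, ?_⟩
  intro f hf hf0 hf1 N
  set g := cen V μ f with hg
  have hgm : ∀ i, Measurable (g i) := fun i => (tr_meas V f S.hVm hf i).sub_const _
  have hVi : Integrable (fun x => 1 + V x) μ := (integrable_const _).add S.hμ
  have htr_le : ∀ i x, tr V f i x ≤ 1 + V x := fun i x => (tr_le V f hf0 i x).trans (hf1 x)
  have htri : ∀ i, Integrable (tr V f i) μ := fun i =>
    hVi.mono' (tr_meas V f S.hVm hf i).aestronglyMeasurable (Eventually.of_forall fun x => by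
      rw [Real.norm_eq_abs, abs_of_nonneg (tr_nonneg V f hf0 i x)]
      exact htr_le i x)
  have hm0 : ∀ i, 0 ≤ ∫ y, tr V f i y ∂μ := fun i => integral_nonneg (tr_nonneg V f hf0 i)
  have hm1 : ∀ i, ∫ y, tr V f i y ∂μ ≤ c := fun i => by
    refine (integral_mono (htri i) hVi (htr_le i)).trans (le_of_eq ?_)
    rw [integral_add (integrable_const _) S.hμ]; simp [hc]
  have hgabs : ∀ i x, |g i x| ≤ tr V f i x + c := fun i x => by
    have h1 := tr_nonneg V f hf0 i x
    have h2 := hm0 i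
    have h3 := hm1 i
    rw [abs_le]; simp only [hg, cen]; constructor <;> linarith
  have hgB : ∀ i x, |g i x| ≤ 1 + i + c := fun i x => by
    have := hgabs i x
    have := tr_bdd V f hf1 i x
    linarith
  have hga : ∀ i x, |g i x| ≤ (1 + c) * (1 + V x) := fun i x => by
    have h1 := hgabs i x
    have h2 := htr_le i x
    have h3 := mul_nonneg hc0 (S.hV0 x)
    nlinarith
  have hgz : ∀ i, ∫ y, g i y ∂μ = 0 := fun i => by
    simp only [hg, cen]
    rw [integral_sub (htri i) (integrable_const _)]; simp
  have hGi : ∀ i j, Integrable (fun ω => g i (X i ω) * g j (X j ω)) Q := fun i j =>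
    Integrable.of_bound (((hgm i).comp (S.mc.1 i)).mul
      ((hgm j).comp (S.mc.1 j))).aestronglyMeasurable ((1 + i + c) * (1 + j + c))
      (Eventually.of_forall fun ω => by
        rw [Real.norm_eq_abs, abs_mul]
        exact mul_le_mul (hgB i _) (hgB j _) (abs_nonneg _) (by positivity))
  set H := C3 * (1 + phI V μ N) with hH
  have hph0 : 0 ≤ phI V μ N := phI_nonneg N
  have hH0 : 0 ≤ H := by positivity
  -- weighted moment bound
  have hW : ∀ i, i ≤ N → Integrable (fun ω => |g i (X i ω)| * (1 + V (X i ω))) Q ∧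
      ∫ ω, |g i (X i ω)| * (1 + V (X i ω)) ∂Q ≤ H := by
    intro i hiN
    have hVXi : Integrable (fun ω => 1 + V (X i ω)) Q := (integrable_const _).add (S.hD i).1
    have hphm : Measurable (tr V (fun x => (1 + V x) ^ 2) i) :=
      tr_meas V _ S.hVm (by have := S.hVm; fun_prop) i
    have hphX : Integrable (fun ω => tr V (fun x => (1 + V x) ^ 2) i (X i ω)) Q :=
      Integrable.of_bound (hphm.comp (S.mc.1 i)).aestronglyMeasurable ((1 + i) ^ 2)
        (Eventually.of_forall fun ω => by
          rw [Real.norm_eq_abs, abs_of_nonneg (tr_nonneg V _ (fun x => sq_nonneg _) i _)]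
          exact ph_bdd S.hV0 i _)
    have hbound : ∀ x, |g i x| * (1 + V x) ≤
        tr V (fun x => (1 + V x) ^ 2) i x + c * (1 + V x) := by
      intro x
      have hV := S.hV0 x
      have h1 := mul_le_mul_of_nonneg_right (hgabs i x) (by linarith : 0 ≤ 1 + V x)
      have h2 : tr V f i x * (1 + V x) ≤ tr V (fun x => (1 + V x) ^ 2) i x := by
        by_cases h : V x ≤ i
        · rw [tr_eq V _ i x h, tr_eq V _ i x h]
          have := hf1 x
          nlinarith
        · rw [tr, tr, Set.indicator_of_notMem (by simpa using h),
            Set.indicator_of_notMem (by simpa using h)]; simp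
      linarith
    have hdom : Integrable (fun ω => tr V (fun x => (1 + V x) ^ 2) i (X i ω) +
        c * (1 + V (X i ω))) Q := hphX.add (hVXi.const_mul c)
    have hI : Integrable (fun ω => |g i (X i ω)| * (1 + V (X i ω))) Q := by
      refine hdom.mono' ?_ (Eventually.of_forall fun ω => ?_)
      · have := (hgm i).comp (S.mc.1 i)
        have h2 := S.hVm.comp (S.mc.1 i)
        exact (this.abs.mul (h2.const_add 1)).aestronglyMeasurable
      · rw [Real.norm_eq_abs, abs_of_nonneg (mul_nonneg (abs_nonneg _)
          (by linarith [S.hV0 (X i ω)]))]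
        exact hbound _
    refine ⟨hI, (integral_mono hI hdom fun ω => hbound _).trans ?_⟩
    rw [integral_add hphX (hVXi.const_mul c), integral_const_mul]
    have h3 := S.rate _ ((1 + i) ^ 2) (1 + i) hphm (fun x => by
        rw [abs_of_nonneg (tr_nonneg V _ (fun x => sq_nonneg _) i _)]
        exact ph_bdd S.hV0 i _) (by positivity) (fun x => by
        rw [abs_of_nonneg (tr_nonneg V _ (fun x => sq_nonneg _) i _)]
        exact ph_le S.hV0 i _) i
    have h4 : phI V μ i ≤ phI V μ N := phI_mono S.hVm S.hV0 hiN
    have h5 : C * (1 + i) * χ ^ i * D ≤ C * B0 * D := by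
      have := hB0' i
      calc C * (1 + i) * χ ^ i * D = C * ((1 + i) * χ ^ i) * D := by ring
        _ ≤ _ := by gcongr
    have h6 := mul_le_mul_of_nonneg_left (S.hD i).2 hc0
    have h7 := mul_le_mul_of_nonneg_left h4 hq0
    have h8 : 0 ≤ (C * B0 * D + c * D) * phI V μ N := by positivity
    change _ ≤ q * phI V μ i + _ at h3
    rw [hH, hC3]; nlinarith
  have hpair : ∀ i j, i ≤ j → j ≤ N →
      ∫ ω, g i (X i ω) * g j (X j ω) ∂Q ≤ C1 * χ ^ (j - i) * H := by
    intro i j hij hjN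
    obtain ⟨n, rfl⟩ := Nat.exists_eq_add_of_le hij
    rw [mc_iter Q X P S.mc i n (g i) (g (i + n)) (hgm _) (hgm _) _ _ (hgB _) (hgB _)]
    have hw := hW i (hij.trans hjN)
    have hptw : ∀ ω, g i (X i ω) * (TT P)^[n] (g (i + n)) (X i ω) ≤
        C1 * χ ^ n * (|g i (X i ω)| * (1 + V (X i ω))) := by
      intro ω
      have h1 := S.hH (g (i + n)) _ (1 + c) (hgm _) (hgB _) (by positivity) (hga _) n (X i ω)
      rw [hgz, sub_zero] at h1
      calc g i (X i ω) * (TT P)^[n] (g (i + n)) (X i ω)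
          ≤ |g i (X i ω) * (TT P)^[n] (g (i + n)) (X i ω)| := le_abs_self _
        _ = |g i (X i ω)| * |(TT P)^[n] (g (i + n)) (X i ω)| := abs_mul _ _
        _ ≤ |g i (X i ω)| * (C * (1 + c) * χ ^ n * (1 + V (X i ω))) := by gcongr
        _ = _ := by rw [hC1]; ring
    have hTi : Integrable (fun ω => g i (X i ω) * (TT P)^[n] (g (i + n)) (X i ω)) Q :=
      Integrable.of_bound (((hgm i).comp (S.mc.1 i)).mul
        ((TT_iter_meas P _ (hgm (i + n)) n).comp (S.mc.1 i))).aestronglyMeasurable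
        ((1 + i + c) * (1 + (i + n : ℕ) + c))
        (Eventually.of_forall fun ω => by
          rw [Real.norm_eq_abs, abs_mul]
          exact mul_le_mul (hgB i _) (TT_iter_bdd P _ _ (hgB _) n _) (abs_nonneg _)
            (by positivity))
    refine (integral_mono hTi (hw.1.const_mul _) hptw).trans ?_
    rw [integral_const_mul, Nat.add_sub_cancel_left]
    have := S.hχ0
    exact mul_le_mul_of_nonneg_left hw.2 (by positivity)
  have hsumI : ∀ n : ℕ, Integrable (fun ω => (∑ i ∈ Finset.range n, g i (X i ω)) ^ 2) Q := by
    intro n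
    have : (fun ω => (∑ i ∈ Finset.range n, g i (X i ω)) ^ 2) = fun ω =>
        ∑ i ∈ Finset.range n, ∑ j ∈ Finset.range n, g i (X i ω) * g j (X j ω) := by
      ext ω; rw [sq, Finset.sum_mul_sum]
    rw [this]
    exact integrable_finsetSum _ fun i _ => integrable_finsetSum _ fun j _ => hGi i j
  refine ⟨hsumI N, ?_⟩
  have key : ∀ n : ℕ, n ≤ N → ∫ ω, (∑ i ∈ Finset.range n, g i (X i ω)) ^ 2 ∂Q ≤
      n * (C1 * (2 / (1 - χ) + 1) * H) := by
    intro n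
    induction n with
    | zero => simp
    | succ n ih =>
      intro hn
      have e : ∀ ω, (∑ i ∈ Finset.range (n + 1), g i (X i ω)) ^ 2 =
          (∑ i ∈ Finset.range n, g i (X i ω)) ^ 2 +
          (2 * ∑ i ∈ Finset.range n, g i (X i ω) * g n (X n ω)) + g n (X n ω) * g n (X n ω) := by
        intro ω
        rw [Finset.sum_range_succ, ← Finset.sum_mul]; ring
      simp_rw [e]
      have i1 : Integrable (fun ω => ∑ i ∈ Finset.range n, g i (X i ω) * g n (X n ω)) Q :=
        integrable_finsetSum _ fun i _ => hGi i n
      have i12 : Integrable (fun ω => (∑ i ∈ Finset.range n, g i (X i ω)) ^ 2 +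
          (2 * ∑ i ∈ Finset.range n, g i (X i ω) * g n (X n ω))) Q :=
        (hsumI n).add (i1.const_mul 2)
      rw [integral_add i12 (hGi n n), integral_add (hsumI n) (i1.const_mul 2),
        integral_const_mul, integral_finsetSum _ fun i _ => hGi i n]
      have h1 := ih (by omega)
      have h2 : ∑ i ∈ Finset.range n, ∫ ω, g i (X i ω) * g n (X n ω) ∂Q ≤
          C1 * H * (1 / (1 - χ)) := by
        calc _ ≤ ∑ i ∈ Finset.range n, C1 * χ ^ (n - i) * H :=
              Finset.sum_le_sum fun i hi => hpair i n (Finset.mem_range.1 hi).le (by omega)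
          _ = C1 * H * ∑ i ∈ Finset.range n, χ ^ (n - i) := by
              rw [Finset.mul_sum]; exact Finset.sum_congr rfl fun i _ => by ring
          _ ≤ _ := mul_le_mul_of_nonneg_left (geo_bound S.hχ0 S.hχ1 n) (by positivity)
      have h3 := hpair n n le_rfl (by omega)
      simp only [Nat.sub_self, pow_zero, mul_one] at h3
      push_cast
      have h5 : ((n:ℝ) + 1) * (C1 * (2 / (1 - χ) + 1) * H) = n * (C1 * (2 / (1 - χ) + 1) * H) +
          (2 * (C1 * H * (1 / (1 - χ))) + C1 * H) := by ring
      rw [h5]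
      linarith
  refine (key N le_rfl).trans (le_of_eq ?_)
  rw [hH]; ring

lemma geo_tail (c v : ℝ) (hc : 1 < c) (hv : 0 < v) (M : ℕ) :
    ∑ n ∈ Finset.range M, (if v ≤ 2 * c ^ n then c⁻¹ ^ n else 0) ≤ 2 / v / (1 - c⁻¹) := by
  classical
  have hc0 : 0 < c := by linarith
  have hex : ∃ n : ℕ, v ≤ 2 * c ^ n := by
    obtain ⟨n, hn⟩ := pow_unbounded_of_one_lt v hc
    exact ⟨n, by have : 0 < c ^ n := by positivity
                 linarith⟩
  have hci : c⁻¹ < 1 := inv_lt_one_of_one_lt₀ hc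
  set n0 := Nat.find hex with hn0
  have h1 : ∑ n ∈ Finset.range M, (if v ≤ 2 * c ^ n then c⁻¹ ^ n else 0) ≤
      ∑ n ∈ Finset.Ico n0 M, c⁻¹ ^ n := by
    rw [← Finset.sum_filter]
    refine Finset.sum_le_sum_of_subset_of_nonneg (fun n hn => ?_) fun n _ _ => by positivity
    rw [Finset.mem_filter, Finset.mem_range] at hn
    rw [Finset.mem_Ico]
    exact ⟨Nat.find_min' hex hn.2, hn.1⟩
  refine h1.trans ((geom_sum_Ico_le_of_lt_one (by positivity) hci).trans ?_)
  have h2 : v ≤ 2 * c ^ n0 := Nat.find_spec hex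
  have h3 : c⁻¹ ^ n0 ≤ 2 / v := by
    rw [inv_pow, inv_le_iff_one_le_mul₀ (by positivity), div_mul_eq_mul_div, le_div_iff₀ hv]
    linarith
  have : 0 < 1 - c⁻¹ := by linarith
  gcongr

lemma summable_ph (hVm : Measurable V) (hV0 : ∀ x, 0 ≤ V x) (hμ : Integrable V μ)
    (c : ℝ) (hc : 1 < c) :
    Summable fun n : ℕ => (1 + phI V μ ⌊c ^ n⌋₊) / (⌊c ^ n⌋₊ : ℝ) := by
  have hc0 : 0 < c := by linarith
  have hci : c⁻¹ < 1 := inv_lt_one_of_one_lt₀ hc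
  have hδ : 0 < 1 - c⁻¹ := by linarith
  have hk1 : ∀ n : ℕ, (1:ℝ) ≤ ⌊c ^ n⌋₊ := fun n => by
    exact_mod_cast (Nat.one_le_floor_iff _).2 (one_le_pow₀ hc.le)
  have hinv : ∀ n : ℕ, 1 / (⌊c ^ n⌋₊ : ℝ) ≤ (1 - c⁻¹)⁻¹ * c⁻¹ ^ n := fun n => by
    have h1 := mul_pow_le_nat_floor_pow hc n
    have h2 : 0 < (1 - c⁻¹) * c ^ n := by positivity
    calc 1 / (⌊c ^ n⌋₊ : ℝ) ≤ 1 / ((1 - c⁻¹) * c ^ n) := one_div_le_one_div_of_le h2 h1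
      _ = _ := by rw [one_div, mul_inv, inv_pow]
  have hs1 : Summable fun n : ℕ => 1 / (⌊c ^ n⌋₊ : ℝ) :=
    Summable.of_nonneg_of_le (fun n => by positivity) hinv
      ((summable_geometric_of_lt_one (by positivity) hci).mul_left _)
  have hs2 : Summable fun n : ℕ => phI V μ ⌊c ^ n⌋₊ / (⌊c ^ n⌋₊ : ℝ) := by
    set A := (1 - c⁻¹)⁻¹ * (2 / (1 - c⁻¹)) with hA
    refine summable_of_sum_range_le (c := ∫ x, A * (1 + V x) ∂μ)
      (fun n => div_nonneg (phI_nonneg _) (by positivity)) fun M => ?_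
    have e : ∑ n ∈ Finset.range M, phI V μ ⌊c ^ n⌋₊ / (⌊c ^ n⌋₊ : ℝ) =
        ∫ x, ∑ n ∈ Finset.range M,
          tr V (fun x => (1 + V x) ^ 2) ⌊c ^ n⌋₊ x / (⌊c ^ n⌋₊ : ℝ) ∂μ := by
      rw [integral_finsetSum _ fun n _ => (ph_int hVm hV0 _ μ).div_const _]
      simp_rw [integral_div]; rfl
    rw [e]
    refine integral_mono (integrable_finsetSum _ fun n _ => (ph_int hVm hV0 _ μ).div_const _)
      (((integrable_const _).add hμ).const_mul A) fun x => ?_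
    have hv : 0 < 1 + V x := by linarith [hV0 x]
    calc ∑ n ∈ Finset.range M, tr V (fun x => (1 + V x) ^ 2) ⌊c ^ n⌋₊ x / (⌊c ^ n⌋₊ : ℝ)
        ≤ ∑ n ∈ Finset.range M, (1 + V x) ^ 2 * ((1 - c⁻¹)⁻¹ *
            (if 1 + V x ≤ 2 * c ^ n then c⁻¹ ^ n else 0)) := by
          refine Finset.sum_le_sum fun n _ => ?_
          by_cases h : V x ≤ (⌊c ^ n⌋₊ : ℕ)
          · have h2 : (⌊c ^ n⌋₊ : ℝ) ≤ c ^ n := Nat.floor_le (by positivity)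
            have h3 := hk1 n
            rw [tr_eq V _ _ x h, if_pos (by linarith), div_eq_mul_one_div]
            exact mul_le_mul_of_nonneg_left (hinv n) (by positivity)
          · rw [tr, Set.indicator_of_notMem (by simpa using h), zero_div]
            have : (0:ℝ) ≤ if 1 + V x ≤ 2 * c ^ n then c⁻¹ ^ n else 0 := by
              split_ifs <;> positivity
            positivity
      _ = (1 + V x) ^ 2 * (1 - c⁻¹)⁻¹ *
          ∑ n ∈ Finset.range M, (if 1 + V x ≤ 2 * c ^ n then c⁻¹ ^ n else 0) := by
          rw [Finset.mul_sum]; exact Finset.sum_congr rfl fun n _ => by ring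
      _ ≤ (1 + V x) ^ 2 * (1 - c⁻¹)⁻¹ * (2 / (1 + V x) / (1 - c⁻¹)) :=
          mul_le_mul_of_nonneg_left (geo_tail c _ hc hv M) (by positivity)
      _ = A * (1 + V x) := by rw [hA]; field_simp
  refine (hs1.add hs2).congr fun n => ?_
  rw [← add_div]

lemma Setup.subseq (S : Setup Q X P V μ C χ D) (f : E → ℝ) (hf : Measurable f)
    (hf0 : ∀ x, 0 ≤ f x) (hf1 : ∀ x, f x ≤ 1 + V x) (c : ℝ) (hc : 1 < c) :
    ∀ᵐ ω ∂Q, Tendsto (fun n : ℕ => (∑ i ∈ Finset.range ⌊c ^ n⌋₊, cen V μ f i (X i ω)) /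
      (⌊c ^ n⌋₊ : ℝ)) atTop (𝓝 0) := by
  obtain ⟨C4, hC4, h4⟩ := S.second_moment
  have hk1 : ∀ n : ℕ, (1:ℝ) ≤ ⌊c ^ n⌋₊ := fun n => by
    exact_mod_cast (Nat.one_le_floor_iff _).2 (one_le_pow₀ hc.le)
  have hs := (summable_ph (μ := μ) S.hVm S.hV0 S.hμ c hc).mul_left C4
  set Z : ℕ → Ω → ℝ := fun n ω => (∑ i ∈ Finset.range ⌊c ^ n⌋₊, cen V μ f i (X i ω)) /
      (⌊c ^ n⌋₊ : ℝ) with hZ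
  have hgm : ∀ i, Measurable (cen V μ f i) := fun i => (tr_meas V f S.hVm hf i).sub_const _
  have hZm : ∀ n, Measurable (Z n) := fun n =>
    (Finset.measurable_sum _ fun i _ => (hgm i).comp (S.mc.1 i)).div_const _
  have hZ2 : ∀ n, ∫⁻ ω, ENNReal.ofReal (Z n ω ^ 2) ∂Q ≤
      ENNReal.ofReal (C4 * ((1 + phI V μ ⌊c ^ n⌋₊) / (⌊c ^ n⌋₊ : ℝ))) := by
    intro n
    have hk := hk1 n
    obtain ⟨hi, hb⟩ := h4 f hf hf0 hf1 ⌊c ^ n⌋₊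
    have e : (fun ω => Z n ω ^ 2) = fun ω =>
        (∑ i ∈ Finset.range ⌊c ^ n⌋₊, cen V μ f i (X i ω)) ^ 2 / (⌊c ^ n⌋₊ : ℝ) ^ 2 := by
      ext ω; simp only [hZ, div_pow]
    have hi' : Integrable (fun ω => Z n ω ^ 2) Q := by rw [e]; exact hi.div_const _
    rw [← ofReal_integral_eq_lintegral_ofReal hi' (Eventually.of_forall fun ω => sq_nonneg _)]
    refine ENNReal.ofReal_le_ofReal ?_
    rw [e, integral_div, div_le_iff₀ (by positivity)]
    refine hb.trans (le_of_eq ?_)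
    field_simp
  have hfin : ∫⁻ ω, ∑' n, ENNReal.ofReal (Z n ω ^ 2) ∂Q ≠ ⊤ := by
    rw [lintegral_tsum fun n => ((hZm n).pow_const 2).ennreal_ofReal.aemeasurable]
    refine ((ENNReal.tsum_le_tsum hZ2).trans_lt ?_).ne
    rw [← ENNReal.ofReal_tsum_of_nonneg _ hs]
    · exact ofReal_lt_top
    · intro n
      have : 0 ≤ phI V μ ⌊c ^ n⌋₊ := phI_nonneg _
      positivity
  filter_upwards [ae_lt_top (Measurable.ennreal_tsum fun n =>
    ((hZm n).pow_const 2).ennreal_ofReal) hfin] with ω hω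
  have h5 := ENNReal.tendsto_atTop_zero_of_tsum_ne_top hω.ne
  have h6 : Tendsto (fun n => Z n ω ^ 2) atTop (𝓝 0) := by
    have := (ENNReal.tendsto_toReal zero_ne_top).comp h5
    refine (this.congr fun n => ?_)
    simp [ENNReal.toReal_ofReal (sq_nonneg (Z n ω))]
  have h7 := h6.sqrt
  simp only [Real.sqrt_zero, Real.sqrt_sq_eq_abs] at h7
  exact (tendsto_zero_iff_abs_tendsto_zero _).2 h7

lemma Setup.lln (S : Setup Q X P V μ C χ D) (f : E → ℝ) (hf : Measurable f)
    (hf0 : ∀ x, 0 ≤ f x) (hf1 : ∀ x, f x ≤ 1 + V x) :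
    ∀ᵐ ω ∂Q, Tendsto (fun n : ℕ => (∑ i ∈ Finset.range n, f (X i ω)) / (n : ℝ)) atTop
      (𝓝 (∫ x, f x ∂μ)) := by
  set c : ℕ → ℝ := fun k => 1 + 1 / ((k:ℝ) + 1) with hcdef
  have hc : ∀ k, 1 < c k := fun k => by
    have : 0 < 1 / ((k:ℝ) + 1) := by positivity
    simp only [hcdef]; linarith
  have hclim : Tendsto c atTop (𝓝 1) := by
    have := tendsto_one_div_add_atTop_nhds_zero_nat (𝕜 := ℝ)
    have h := this.const_add 1
    rw [add_zero] at h
    exact h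
  have hVi : Integrable (fun x => 1 + V x) μ := (integrable_const _).add S.hμ
  have hm : Tendsto (fun i : ℕ => ∫ x, tr V f i x ∂μ) atTop (𝓝 (∫ x, f x ∂μ)) := by
    refine tendsto_integral_of_dominated_convergence (fun x => 1 + V x)
      (fun i => (tr_meas V f S.hVm hf i).aestronglyMeasurable) hVi
      (fun i => Eventually.of_forall fun x => ?_) (Eventually.of_forall fun x => ?_)
    · rw [Real.norm_eq_abs, abs_of_nonneg (tr_nonneg V f hf0 i x)]
      exact (tr_le V f hf0 i x).trans (hf1 x)
    · refine tendsto_const_nhds.congr' ?_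
      filter_upwards [eventually_ge_atTop ⌈V x⌉₊] with i hi
      exact (tr_eq V f i x (Nat.ceil_le.1 hi)).symm
  have hces := hm.cesaro
  filter_upwards [S.bc, ae_all_iff.2 fun k => S.subseq f hf hf0 hf1 (c k) (hc k)] with ω h1 h2
  have h3 : Tendsto (fun n : ℕ => (∑ i ∈ Finset.range n, tr V f i (X i ω)) / (n : ℝ)) atTop
      (𝓝 (∫ x, f x ∂μ)) := by
    refine tendsto_div_of_monotone_of_tendsto_div_floor_pow _ _ ?_ c hc hclim fun k => ?_
    · refine monotone_nat_of_le_succ fun n => ?_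
      rw [Finset.sum_range_succ]
      linarith [tr_nonneg V f hf0 n (X n ω)]
    · have hk := (hces.comp ((tendsto_nat_floor_atTop (α := ℝ)).comp
        (tendsto_pow_atTop_atTop_of_one_lt (hc k)))).add (h2 k)
      rw [add_zero] at hk
      refine hk.congr fun n => ?_
      simp only [cen, Function.comp_apply, Finset.sum_sub_distrib]
      ring
  have h4 : Tendsto (fun i : ℕ => f (X i ω) - tr V f i (X i ω)) atTop (𝓝 0) := by
    refine tendsto_const_nhds.congr' ?_
    filter_upwards [h1] with i hi
    rw [tr_eq V f i _ hi, sub_self]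
  have h5 := h3.add h4.cesaro
  rw [add_zero] at h5
  refine h5.congr fun n => ?_
  rw [Finset.sum_sub_distrib]; ring

end Harris


namespace Harris
section coupling
variable {E : Type*} [MeasurableSpace E]

/-- Normalised product of two measures with the same mass. -/
def np (σ τ : Measure E) : Measure (E × E) := (σ Set.univ)⁻¹ • σ.prod τ

lemma np_fst (σ τ : Measure E) [IsFiniteMeasure σ] [IsFiniteMeasure τ]
    (h : σ Set.univ = τ Set.univ) : (np σ τ).map Prod.fst = σ := by
  rw [np, Measure.map_smul, Measure.map_fst_prod, ← h, smul_smul]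
  by_cases h0 : σ Set.univ = 0
  · rw [Measure.measure_univ_eq_zero.1 h0]; simp
  · rw [ENNReal.inv_mul_cancel h0 (measure_ne_top _ _), one_smul]

lemma np_snd (σ τ : Measure E) [IsFiniteMeasure σ] [IsFiniteMeasure τ]
    (h : σ Set.univ = τ Set.univ) : (np σ τ).map Prod.snd = τ := by
  rw [np, Measure.map_smul, Measure.map_snd_prod, smul_smul]
  by_cases h0 : σ Set.univ = 0
  · rw [Measure.measure_univ_eq_zero.1 (h.symm.trans h0)]; simp
  · rw [ENNReal.inv_mul_cancel h0 (measure_ne_top _ _), one_smul]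

lemma np_cost (σ τ : Measure E) [IsFiniteMeasure σ] [IsFiniteMeasure τ]
    (h : σ Set.univ = τ Set.univ) (c : E × E → ℝ≥0∞) (G : E → ℝ≥0∞) (hG : Measurable G)
    (S : Set E) (hσ : ∀ᵐ x ∂σ, x ∈ S) (hτ : ∀ᵐ x ∂τ, x ∈ S)
    (hc : ∀ x ∈ S, ∀ y ∈ S, c (x, y) ≤ G x + G y) :
    ∫⁻ p, c p ∂(np σ τ) ≤ ∫⁻ x, G x ∂σ + ∫⁻ x, G x ∂τ := by
  have h1 : ∀ᵐ p ∂(σ.prod τ), p.1 ∈ S ∧ p.2 ∈ S :=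
    (Measure.quasiMeasurePreserving_fst.ae hσ).and (Measure.quasiMeasurePreserving_snd.ae hτ)
  have h2 : ∀ᵐ p ∂(np σ τ), c p ≤ G p.1 + G p.2 := by
    have : ∀ᵐ p ∂(σ.prod τ), c p ≤ G p.1 + G p.2 := by
      filter_upwards [h1] with p hp
      exact hc p.1 hp.1 p.2 hp.2
    exact Measure.ae_smul_measure this _
  refine (lintegral_mono_ae h2).trans (le_of_eq ?_)
  rw [lintegral_add_left (f := fun p : E × E => G p.1) (hG.comp measurable_fst),
    ← lintegral_map (f := G) hG measurable_fst, ← lintegral_map (f := G) hG measurable_snd,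
    np_fst σ τ h, np_snd σ τ h]

lemma sum_smul_restrict {ι : Type*} [Fintype ι] (A : ι → Set E) (hA : ∀ k, MeasurableSet (A k))
    (hd : Pairwise (Function.onFun Disjoint A)) (hu : ⋃ k, A k = Set.univ) (m : Measure E) :
    ∑ k, m.restrict (A k) = m := by
  rw [← Measure.sum_fintype, ← Measure.restrict_iUnion hd hA, hu, Measure.restrict_univ]

lemma coupling_exists {ι : Type*} [Fintype ι] (A : ι → Set E) (hA : ∀ k, MeasurableSet (A k))
    (hd : Pairwise (Function.onFun Disjoint A)) (hu : ⋃ k, A k = Set.univ)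
    (m μ : Measure E) [IsProbabilityMeasure m] [IsProbabilityMeasure μ]
    (c : E × E → ℝ≥0∞) (F G : E → ℝ≥0∞) (hF : Measurable F) (hG : Measurable G)
    (hc : ∀ x y, c (x, y) ≤ F x + F y)
    (hcG : ∀ k, ∀ x ∈ A k, ∀ y ∈ A k, c (x, y) ≤ G x + G y) :
    ∃ ρ ∈ couplings m μ, ∫⁻ p, c p ∂ρ ≤ ∫⁻ x, G x ∂m + ∫⁻ x, G x ∂μ +
      ((∑ k, (1 - min (m (A k)) (μ (A k)) / m (A k)) * ∫⁻ x in A k, F x ∂m) +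
       ∑ k, (1 - min (m (A k)) (μ (A k)) / μ (A k)) * ∫⁻ x in A k, F x ∂μ) := by
  set p : ι → ℝ≥0∞ := fun k => min (m (A k)) (μ (A k)) / m (A k) with hp
  set q : ι → ℝ≥0∞ := fun k => min (m (A k)) (μ (A k)) / μ (A k) with hq
  have hp1 : ∀ k, p k ≤ 1 := fun k => ENNReal.div_le_of_le_mul (by simp)
  have hq1 : ∀ k, q k ≤ 1 := fun k => ENNReal.div_le_of_le_mul (by simp)
  have hpa : ∀ k, p k * m (A k) = min (m (A k)) (μ (A k)) := fun k => by
    by_cases h0 : m (A k) = 0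
    · simp [h0]
    · exact ENNReal.div_mul_cancel h0 (measure_ne_top _ _)
  have hqa : ∀ k, q k * μ (A k) = min (m (A k)) (μ (A k)) := fun k => by
    by_cases h0 : μ (A k) = 0
    · simp [h0]
    · exact ENNReal.div_mul_cancel h0 (measure_ne_top _ _)
  set σ : ι → Measure E := fun k => p k • m.restrict (A k) with hσ
  set τ : ι → Measure E := fun k => q k • μ.restrict (A k) with hτ
  set m' : Measure E := ∑ k, (1 - p k) • m.restrict (A k) with hm'
  set μ' : Measure E := ∑ k, (1 - q k) • μ.restrict (A k) with hμ'
  have hm : (∑ k, σ k) + m' = m := by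
    rw [hm', ← Finset.sum_add_distrib]
    conv_rhs => rw [← sum_smul_restrict A hA hd hu m]
    refine Finset.sum_congr rfl fun k _ => ?_
    rw [hσ, ← add_smul, add_tsub_cancel_of_le (hp1 k), one_smul]
  have hμ : (∑ k, τ k) + μ' = μ := by
    rw [hμ', ← Finset.sum_add_distrib]
    conv_rhs => rw [← sum_smul_restrict A hA hd hu μ]
    refine Finset.sum_congr rfl fun k _ => ?_
    rw [hτ, ← add_smul, add_tsub_cancel_of_le (hq1 k), one_smul]
  have fσ : ∀ k, IsFiniteMeasure (σ k) := fun k =>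
    Measure.smul_finite _ (ne_top_of_le_ne_top one_ne_top (hp1 k))
  have fτ : ∀ k, IsFiniteMeasure (τ k) := fun k =>
    Measure.smul_finite _ (ne_top_of_le_ne_top one_ne_top (hq1 k))
  have fm' : IsFiniteMeasure m' := isFiniteMeasure_of_le m (by
    conv_rhs => rw [← hm]
    exact Measure.le_add_left le_rfl)
  have fμ' : IsFiniteMeasure μ' := isFiniteMeasure_of_le μ (by
    conv_rhs => rw [← hμ]
    exact Measure.le_add_left le_rfl)
  have eστ : ∀ k, σ k Set.univ = τ k Set.univ := fun k => by
    simp only [hσ, hτ, Measure.smul_apply, smul_eq_mul, Measure.restrict_apply_univ, hpa, hqa]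
  have e' : m' Set.univ = μ' Set.univ := by
    have h1 : (∑ k, σ k Set.univ) + m' Set.univ = 1 := by
      have := congrArg (fun ν : Measure E => ν Set.univ) hm
      simpa using this
    have h2 : (∑ k, τ k Set.univ) + μ' Set.univ = 1 := by
      have := congrArg (fun ν : Measure E => ν Set.univ) hμ
      simpa using this
    simp_rw [← eστ] at h2
    have hfin : ∑ k, σ k Set.univ ≠ ⊤ := (ENNReal.sum_lt_top.2 fun k _ => measure_lt_top _ _).ne
    exact (ENNReal.add_right_inj hfin).1 (h1.trans h2.symm)
  set ρ : Measure (E × E) := (∑ k, np (σ k) (τ k)) + np m' μ' with hρ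
  have hfst : ρ.map Prod.fst = m := by
    rw [hρ, Measure.map_add _ _ measurable_fst, np_fst _ _ e', ← Measure.mapₗ_apply_of_measurable measurable_fst, map_sum]
    simp_rw [Measure.mapₗ_apply_of_measurable measurable_fst, np_fst _ _ (eστ _)]
    exact hm
  have hsnd : ρ.map Prod.snd = μ := by
    rw [hρ, Measure.map_add _ _ measurable_snd, np_snd _ _ e', ← Measure.mapₗ_apply_of_measurable measurable_snd, map_sum]
    simp_rw [Measure.mapₗ_apply_of_measurable measurable_snd, np_snd _ _ (eστ _)]
    exact hμ
  refine ⟨ρ, ⟨?_, hfst, hsnd⟩, ?_⟩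
  · constructor
    have : ρ.map Prod.fst Set.univ = 1 := by rw [hfst]; exact measure_univ
    rwa [Measure.map_apply measurable_fst MeasurableSet.univ, Set.preimage_univ] at this
  · rw [hρ, lintegral_add_measure, lintegral_finset_sum_measure]
    have hS : ∀ k, ∫⁻ p, c p ∂(np (σ k) (τ k)) ≤ ∫⁻ x, G x ∂(σ k) + ∫⁻ x, G x ∂(τ k) := fun k =>
      np_cost _ _ (eστ k) c G hG (A k) (Measure.ae_smul_measure (ae_restrict_mem (hA k)) _)
        (Measure.ae_smul_measure (ae_restrict_mem (hA k)) _) (hcG k)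
    have hT := np_cost m' μ' e' c F hF Set.univ (by simp) (by simp) (fun x _ y _ => hc x y)
    refine add_le_add ?_ (hT.trans (le_of_eq ?_))
    · refine (Finset.sum_le_sum fun k _ => hS k).trans ?_
      rw [Finset.sum_add_distrib, ← lintegral_finset_sum_measure, ← lintegral_finset_sum_measure]
      refine add_le_add (lintegral_mono' ?_ le_rfl) (lintegral_mono' ?_ le_rfl)
      · conv_rhs => rw [← hm]
        exact Measure.le_add_right le_rfl
      · conv_rhs => rw [← hμ]
        exact Measure.le_add_right le_rfl
    · simp only [hm', hμ', lintegral_finset_sum_measure, lintegral_smul_measure, smul_eq_mul]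
      rfl

lemma coupling_limit {ι : Type*} [Fintype ι] (A : ι → Set E) (hA : ∀ k, MeasurableSet (A k))
    (hd : Pairwise (Function.onFun Disjoint A)) (hu : ⋃ k, A k = Set.univ) (t : ι)
    (m : ℕ → Measure E) (hm : ∀ᶠ N in atTop, IsProbabilityMeasure (m N))
    (μ : Measure E) [IsProbabilityMeasure μ]
    (c : E × E → ℝ≥0∞) (F : E → ℝ≥0∞) (hF : Measurable F) (hFμ : ∫⁻ x, F x ∂μ ≠ ⊤)
    (hc : ∀ x y, c (x, y) ≤ F x + F y) (η : ℝ≥0∞)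
    (hcG : ∀ k, k ≠ t → ∀ x ∈ A k, ∀ y ∈ A k, c (x, y) ≤ η)
    (h1 : ∀ k, Tendsto (fun N => m N (A k)) atTop (𝓝 (μ (A k))))
    (h2 : ∀ k, Tendsto (fun N => ∫⁻ x in A k, F x ∂(m N)) atTop (𝓝 (∫⁻ x in A k, F x ∂μ)))
    (ε : ℝ≥0∞) (hε : 2 * (η + ∫⁻ x in A t, F x ∂μ) < ε) :
    ∀ᶠ N in atTop, ∃ ρ ∈ couplings (m N) μ, ∫⁻ p, c p ∂ρ < ε := by
  set G : E → ℝ≥0∞ := fun x => η + (A t).indicator F x with hGdef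
  have hG : Measurable G := measurable_const.add (hF.indicator (hA t))
  have hcG' : ∀ k, ∀ x ∈ A k, ∀ y ∈ A k, c (x, y) ≤ G x + G y := by
    intro k x hx y hy
    by_cases hk : k = t
    · subst hk
      simp only [hGdef, Set.indicator_of_mem hx, Set.indicator_of_mem hy]
      exact (hc x y).trans (add_le_add le_add_self le_add_self)
    · refine (hcG k hk x hx y hy).trans ?_
      simp only [hGdef]
      exact le_add_right (le_add_right le_rfl)
  have hGi : ∀ ν : Measure E, IsProbabilityMeasure ν →
      ∫⁻ x, G x ∂ν = η + ∫⁻ x in A t, F x ∂ν := by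
    intro ν hν
    simp only [hGdef]
    rw [lintegral_add_left measurable_const, lintegral_indicator (hA t)]; simp
  have hfin : ∀ k, ∫⁻ x in A k, F x ∂μ ≠ ⊤ := fun k =>
    ne_top_of_le_ne_top hFμ (setLIntegral_le_lintegral _ _)
  have hmin : ∀ k, Tendsto (fun N => min (m N (A k)) (μ (A k))) atTop (𝓝 (μ (A k))) := fun k => by
    have := (h1 k).min (tendsto_const_nhds (x := μ (A k)))
    rwa [min_self] at this
  have T1 : ∀ k, Tendsto (fun N => (1 - min (m N (A k)) (μ (A k)) / m N (A k)) *
      ∫⁻ x in A k, F x ∂(m N)) atTop (𝓝 0) := by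
    intro k
    by_cases h0 : μ (A k) = 0
    · have h3 := h2 k
      rw [Measure.restrict_eq_zero.2 h0, lintegral_zero_measure] at h3
      refine tendsto_of_tendsto_of_tendsto_of_le_of_le tendsto_const_nhds h3
        (fun _ => zero_le) fun N => ?_
      exact mul_le_of_le_one_left zero_le tsub_le_self
    · have h3 := ENNReal.Tendsto.div (hmin k) (Or.inl h0) (h1 k) (Or.inl (measure_ne_top _ _))
      rw [ENNReal.div_self h0 (measure_ne_top _ _)] at h3
      have h4 := ENNReal.Tendsto.sub (tendsto_const_nhds (x := (1:ℝ≥0∞)) (f := atTop)) h3 (Or.inl one_ne_top)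
      rw [tsub_self] at h4
      have h5 := ENNReal.Tendsto.mul h4 (Or.inr (hfin k)) (h2 k) (Or.inr zero_ne_top)
      rwa [zero_mul] at h5
  have T2 : ∀ k, Tendsto (fun N => (1 - min (m N (A k)) (μ (A k)) / μ (A k)) *
      ∫⁻ x in A k, F x ∂μ) atTop (𝓝 0) := by
    intro k
    by_cases h0 : μ (A k) = 0
    · simp [Measure.restrict_eq_zero.2 h0]
    · have h3 := ENNReal.Tendsto.div (hmin k) (Or.inl h0) (tendsto_const_nhds (x := μ (A k)))
        (Or.inl (measure_ne_top _ _))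
      rw [ENNReal.div_self h0 (measure_ne_top _ _)] at h3
      have h4 := ENNReal.Tendsto.sub (tendsto_const_nhds (x := (1:ℝ≥0∞)) (f := atTop)) h3 (Or.inl one_ne_top)
      rw [tsub_self] at h4
      have h5 := ENNReal.Tendsto.mul h4 (Or.inr (hfin k))
        (tendsto_const_nhds (x := ∫⁻ x in A k, F x ∂μ)) (Or.inr zero_ne_top)
      rwa [zero_mul] at h5
  have hlim := (((tendsto_const_nhds (x := η)).add (h2 t)).add
    (tendsto_const_nhds (x := η + ∫⁻ x in A t, F x ∂μ))).add
    ((tendsto_finsetSum Finset.univ fun k _ => T1 k).add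
      (tendsto_finsetSum Finset.univ fun k _ => T2 k))
  simp only [Finset.sum_const_zero, add_zero] at hlim
  rw [← two_mul] at hlim
  filter_upwards [hm, hlim.eventually_lt_const hε] with N hN hlt
  obtain ⟨ρ, hρ, hle⟩ := coupling_exists A hA hd hu (m N) μ c F G hF hG hc hcG'
  refine ⟨ρ, hρ, hle.trans_lt ?_⟩
  rw [hGi _ hN, hGi μ inferInstance]
  exact hlt

end coupling
end Harris


namespace Harris
section empirical
variable {E : Type*} [MeasurableSpace E] [NormedAddCommGroup E] {Ω : Type*} [MeasurableSpace Ω]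

lemma emp_lintegral (X : ℕ → Ω → E) (N : ℕ) (ω : Ω) (f : E → ℝ≥0∞) (hf : Measurable f) :
    ∫⁻ x, f x ∂(emp X N ω) = (N : ℝ≥0∞)⁻¹ * ∑ i ∈ Finset.range N, f (X i ω) := by
  rw [emp, lintegral_smul_measure, lintegral_finset_sum_measure, smul_eq_mul]
  simp_rw [lintegral_dirac' _ hf]

lemma emp_prob (X : ℕ → Ω → E) (N : ℕ) (hN : 1 ≤ N) (ω : Ω) : IsProbabilityMeasure (emp X N ω) := by
  constructor
  have h := emp_lintegral X N ω (fun _ => 1) measurable_const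
  rw [lintegral_one] at h
  rw [h]
  have h0 : (N : ℝ≥0∞) ≠ 0 := by exact_mod_cast (by omega : N ≠ 0)
  simp [ENNReal.inv_mul_cancel h0 (natCast_ne_top N)]

lemma emp_tendsto (X : ℕ → Ω → E) (ω : Ω) (f : E → ℝ) (hf : Measurable f) (hf0 : ∀ x, 0 ≤ f x)
    (μ : Measure E) (hi : Integrable f μ)
    (h : Tendsto (fun n : ℕ => (∑ i ∈ Finset.range n, f (X i ω)) / (n : ℝ)) atTop
      (𝓝 (∫ x, f x ∂μ))) :
    Tendsto (fun N => ∫⁻ x, ENNReal.ofReal (f x) ∂(emp X N ω)) atTop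
      (𝓝 (∫⁻ x, ENNReal.ofReal (f x) ∂μ)) := by
  rw [← ofReal_integral_eq_lintegral_ofReal hi (Eventually.of_forall hf0)]
  refine (ENNReal.tendsto_ofReal h).congr' ?_
  filter_upwards [eventually_ge_atTop 1] with N hN
  rw [emp_lintegral X N ω _ hf.ennreal_ofReal, ENNReal.ofReal_div_of_pos (by exact_mod_cast hN),
    ENNReal.ofReal_sum_of_nonneg (fun i _ => hf0 _), ENNReal.ofReal_natCast, div_eq_mul_inv,
    mul_comm]

variable {Q : Measure Ω} [IsFiniteMeasure Q] {X : ℕ → Ω → E} {P : Kernel E E} [IsMarkovKernel P]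
  {V : E → ℝ} {μ : Measure E} [IsProbabilityMeasure μ] {C χ D : ℝ}

lemma Setup.ae_set (S : Setup Q X P V μ C χ D) (A : Set E) (hA : MeasurableSet A) :
    ∀ᵐ ω ∂Q, Tendsto (fun N => emp X N ω A) atTop (𝓝 (μ A)) ∧
      Tendsto (fun N => ∫⁻ x in A, ENNReal.ofReal (1 + V x) ∂(emp X N ω)) atTop
        (𝓝 (∫⁻ x in A, ENNReal.ofReal (1 + V x) ∂μ)) := by
  have hVi : Integrable (fun x => 1 + V x) μ := (integrable_const _).add S.hμ
  have hVm : Measurable fun x => 1 + V x := measurable_const.add S.hVm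
  have p1 : ∀ x, 0 ≤ A.indicator (fun _ => (1:ℝ)) x :=
    fun x => Set.indicator_nonneg (fun _ _ => zero_le_one) x
  have p2 : ∀ x, 0 ≤ A.indicator (fun x => 1 + V x) x :=
    fun x => Set.indicator_nonneg (fun x _ => by have := S.hV0 x; linarith) x
  have e1 : ∀ ν : Measure E, ∫⁻ x, ENNReal.ofReal (A.indicator (fun _ => (1:ℝ)) x) ∂ν = ν A := by
    intro ν
    rw [← lintegral_indicator_one hA]
    congr 1; ext x; by_cases h : x ∈ A <;> simp [h]
  have e2 : ∀ ν : Measure E, ∫⁻ x, ENNReal.ofReal (A.indicator (fun x => 1 + V x) x) ∂ν =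
      ∫⁻ x in A, ENNReal.ofReal (1 + V x) ∂ν := by
    intro ν
    rw [← lintegral_indicator hA]
    congr 1; ext x; by_cases h : x ∈ A <;> simp [h]
  filter_upwards [S.lln (A.indicator fun _ => (1:ℝ)) (measurable_const.indicator hA) p1
      (fun x => by have := S.hV0 x; by_cases h : x ∈ A <;> simp [h] <;> linarith),
    S.lln (A.indicator fun x => 1 + V x) (hVm.indicator hA) p2
      (fun x => by have := S.hV0 x; by_cases h : x ∈ A <;> simp [h] <;> linarith)] with ω h1 h2
  have t1 := emp_tendsto X ω _ (measurable_const.indicator hA) p1 μ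
    ((integrable_const _).indicator hA) h1
  have t2 := emp_tendsto X ω _ (hVm.indicator hA) p2 μ (hVi.indicator hA) h2
  simp_rw [e1] at t1
  simp_rw [e2] at t2
  exact ⟨t1, t2⟩

/-- Small cells. -/
def cell (E : Type*) [NormedAddCommGroup E] [TopologicalSpace.SeparableSpace E] (j : ℕ) : ℕ → Set E :=
  disjointed fun k => Metric.ball (TopologicalSpace.denseSeq E k) (1 / ((j:ℝ) + 1))

/-- Tail cell together with small cells. -/
def part (E : Type*) [NormedAddCommGroup E] [TopologicalSpace.SeparableSpace E] (j n : ℕ) :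
    Option (Fin n) → Set E
  | none => (⋃ i : Fin n, cell E j i)ᶜ
  | some i => cell E j i

section
variable [TopologicalSpace.SeparableSpace E] [BorelSpace E]

lemma cell_meas (j k : ℕ) : MeasurableSet (cell E j k) :=
  MeasurableSet.disjointed (fun _ => measurableSet_ball) k

lemma cell_iUnion (j : ℕ) : ⋃ k, cell E j k = Set.univ := by
  rw [cell, iUnion_disjointed, Set.eq_univ_iff_forall]
  intro x
  obtain ⟨k, hy⟩ := (TopologicalSpace.denseRange_denseSeq E).exists_dist_lt x
    (by positivity : (0:ℝ) < 1 / ((j:ℝ) + 1))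
  exact Set.mem_iUnion.2 ⟨k, hy⟩

lemma part_meas (j n : ℕ) (k : Option (Fin n)) : MeasurableSet (part E j n k) := by
  cases k with
  | none => exact (MeasurableSet.iUnion fun i : Fin n => cell_meas (E := E) j i).compl
  | some i => exact cell_meas j i

lemma part_disj (j n : ℕ) : Pairwise (Function.onFun Disjoint (part E j n)) := by
  intro a b hab
  have key : ∀ i : Fin n, Disjoint (part E j n none) (part E j n (some i)) := fun i =>
    Set.disjoint_left.2 fun x hx hx' => hx (Set.mem_iUnion.2 ⟨i, hx'⟩)
  cases a with
  | none => cases b with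
    | none => exact absurd rfl hab
    | some i => exact key i
  | some i => cases b with
    | none => exact (key i).symm
    | some i' => exact disjoint_disjointed (fun k => Metric.ball (TopologicalSpace.denseSeq E k) (1 / ((j:ℝ) + 1))) (fun h : (i : ℕ) = i' => hab (congrArg some (Fin.ext h)))

lemma part_univ (j n : ℕ) : ⋃ k, part E j n k = Set.univ := by
  rw [Set.eq_univ_iff_forall]
  intro x
  by_cases h : x ∈ ⋃ i : Fin n, cell E j i
  · obtain ⟨i, hi⟩ := Set.mem_iUnion.1 h
    exact Set.mem_iUnion.2 ⟨some i, hi⟩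
  · exact Set.mem_iUnion.2 ⟨none, h⟩

lemma part_tail (j : ℕ) : Tendsto (fun n => μ (part E j n none)) atTop (𝓝 0) := by
  have h := tendsto_measure_iInter_atTop (μ := μ) (s := fun n => part E j n none)
    (fun n => (part_meas j n none).nullMeasurableSet)
    (fun a b hab => Set.compl_subset_compl.2 (Set.iUnion_subset fun i =>
      Set.subset_iUnion (fun i : Fin b => cell E j i) ⟨i, i.2.trans_le hab⟩))
    ⟨0, measure_ne_top _ _⟩
  have e : ⋂ n, part E j n none = ∅ := by
    rw [Set.eq_empty_iff_forall_notMem]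
    intro x hx
    obtain ⟨k, hk⟩ := Set.mem_iUnion.1 ((cell_iUnion (E := E) j).symm ▸ Set.mem_univ x : x ∈ ⋃ k, cell E j k)
    exact (Set.mem_iInter.1 hx (k + 1)) (Set.mem_iUnion.2 ⟨⟨k, by omega⟩, hk⟩)
  rw [e, measure_empty] at h
  exact h

lemma Setup.coup (S : Setup Q X P V μ C χ D) (c : E × E → ℝ≥0∞) (c0 : ℝ≥0∞) (hc0 : c0 ≠ ⊤)
    (hc : ∀ x y, c (x, y) ≤ c0 * ENNReal.ofReal (1 + V x) + c0 * ENNReal.ofReal (1 + V y))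
    (hs : ∀ η : ℝ≥0∞, 0 < η → ∃ r : ℝ, 0 < r ∧ ∀ x y, dist x y < r → c (x, y) ≤ η) :
    ∀ᵐ ω ∂Q, ∀ ε : ℝ≥0∞, 0 < ε → ∀ᶠ N in atTop, ∃ ρ ∈ couplings (emp X N ω) μ,
      ∫⁻ p, c p ∂ρ < ε := by
  have hVi : Integrable (fun x => 1 + V x) μ := (integrable_const _).add S.hμ
  have hVm : Measurable fun x => ENNReal.ofReal (1 + V x) :=
    (measurable_const.add S.hVm).ennreal_ofReal
  have hFm : Measurable fun x => c0 * ENNReal.ofReal (1 + V x) := hVm.const_mul c0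
  have hFμ : ∫⁻ x, c0 * ENNReal.ofReal (1 + V x) ∂μ ≠ ⊤ := by
    rw [lintegral_const_mul _ hVm]
    refine mul_ne_top hc0 ?_
    rw [← ofReal_integral_eq_lintegral_ofReal hVi
      (Eventually.of_forall fun x => by have := S.hV0 x; simp only [Pi.zero_apply]; linarith)]
    exact ofReal_ne_top
  filter_upwards [ae_all_iff.2 fun j : ℕ => ae_all_iff.2 fun n : ℕ =>
    ae_all_iff.2 fun k : Option (Fin n) => S.ae_set (part E j n k) (part_meas j n k)] with ω hω
  intro ε hε
  obtain ⟨η, hη0, hη⟩ : ∃ η : ℝ≥0∞, 0 < η ∧ 2 * (η + η) < ε := by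
    have ht : Tendsto (fun η : ℝ≥0∞ => 2 * (η + η)) (𝓝 0) (𝓝 (2 * (0 + 0))) :=
      ENNReal.Tendsto.const_mul (tendsto_id.add tendsto_id) (Or.inr ofNat_ne_top)
    simp only [add_zero, mul_zero] at ht
    have h2 := (ht.mono_left (nhdsWithin_le_nhds (s := Set.Ioi 0))).eventually_lt_const hε
    obtain ⟨η, h, h'⟩ := (h2.and self_mem_nhdsWithin).exists
    exact ⟨η, h', h⟩
  obtain ⟨r, hr, hrc⟩ := hs η hη0
  obtain ⟨j, hj⟩ := exists_nat_one_div_lt (half_pos hr)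
  have htail := tendsto_setLIntegral_zero hFμ (part_tail (E := E) (μ := μ) j)
  obtain ⟨n, hn⟩ := (htail.eventually_lt_const hη0).exists
  refine coupling_limit (part E j n) (part_meas j n) (part_disj j n) (part_univ j n) none
    (fun N => emp X N ω) ?_ μ c _ hFm hFμ hc η ?_ (fun k => (hω j n k).1) (fun k => ?_) ε ?_
  · filter_upwards [eventually_ge_atTop 1] with N hN using emp_prob X N hN ω
  · intro k hk x hx y hy
    cases k with
    | none => exact absurd rfl hk
    | some i =>
      apply hrc
      have hx' := disjointed_subset (fun k => Metric.ball (TopologicalSpace.denseSeq E k) (1 / ((j:ℝ) + 1))) i hx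
      have hy' := disjointed_subset (fun k => Metric.ball (TopologicalSpace.denseSeq E k) (1 / ((j:ℝ) + 1))) i hy
      rw [Metric.mem_ball] at hx' hy'
      have := dist_triangle_right x y (TopologicalSpace.denseSeq E i)
      linarith
  · simp_rw [lintegral_const_mul _ hVm]
    exact ENNReal.Tendsto.const_mul (hω j n k).2 (Or.inr hc0)
  · refine lt_of_le_of_lt ?_ hη
    gcongr
end
end empirical
end Harris


namespace Harris

/-- Transport cost. -/
def cst {E : Type*} [PseudoMetricSpace E] (ℓ : ℝ) (p : E × E) : ℝ≥0∞ :=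
  if ℓ = 0 then ENNReal.ofReal (min 1 (dist p.1 p.2)) else ENNReal.ofReal (dist p.1 p.2 ^ ℓ)

lemma cst_small {E : Type*} [PseudoMetricSpace E] (ℓ : ℝ) (hℓ : 0 ≤ ℓ) (η : ℝ≥0∞) (hη : 0 < η) :
    ∃ r : ℝ, 0 < r ∧ ∀ x y : E, dist x y < r → cst ℓ (x, y) ≤ η := by
  by_cases ht : η = ⊤
  · exact ⟨1, one_pos, fun x y _ => by rw [ht]; exact le_top⟩
  have hpos : 0 < η.toReal := ENNReal.toReal_pos hη.ne' ht
  by_cases h0 : ℓ = 0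
  · refine ⟨η.toReal, hpos, fun x y h => ?_⟩
    rw [cst, if_pos h0]
    exact ENNReal.ofReal_le_of_le_toReal ((min_le_right _ _).trans h.le)
  · refine ⟨η.toReal ^ (1 / ℓ), Real.rpow_pos_of_pos hpos _, fun x y h => ?_⟩
    rw [cst, if_neg h0]
    refine ENNReal.ofReal_le_of_le_toReal ?_
    refine (Real.rpow_le_rpow dist_nonneg h.le hℓ).trans (le_of_eq ?_)
    rw [← Real.rpow_mul hpos.le, one_div, inv_mul_cancel₀ h0, Real.rpow_one]

lemma cst_le {E : Type*} [NormedAddCommGroup E] (ℓ : ℝ) (hℓ : 0 ≤ ℓ) (V : E → ℝ)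
    (hV0 : ∀ x, 0 ≤ V x) (Cl : ℝ) (hL3 : ∀ x : E, ‖x‖ ^ ℓ ≤ Cl * (1 + V x)) :
    ∃ c0 : ℝ≥0∞, c0 ≠ ⊤ ∧ ∀ x y : E, cst ℓ (x, y) ≤
      c0 * ENNReal.ofReal (1 + V x) + c0 * ENNReal.ofReal (1 + V y) := by
  by_cases h0 : ℓ = 0
  · refine ⟨1, one_ne_top, fun x y => ?_⟩
    rw [cst, if_pos h0, one_mul, one_mul]
    refine le_add_right (ENNReal.ofReal_le_ofReal ((min_le_left _ _).trans ?_))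
    linarith [hV0 x]
  · have hCl : 0 ≤ Cl := by
      have h1 := hL3 0
      have h2 := hV0 0
      have h3 : (0:ℝ) ≤ ‖(0:E)‖ ^ ℓ := Real.rpow_nonneg (norm_nonneg _) _
      by_contra hneg
      push Not at hneg
      nlinarith
    have h2 : (0:ℝ) ≤ 2 ^ ℓ := by positivity
    refine ⟨ENNReal.ofReal (2 ^ ℓ * Cl), ofReal_ne_top, fun x y => ?_⟩
    rw [cst, if_neg h0, ← ENNReal.ofReal_mul (by positivity), ← ENNReal.ofReal_mul (by positivity),
      ← ENNReal.ofReal_add (by have := hV0 x; positivity) (by have := hV0 y; positivity)]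
    refine ENNReal.ofReal_le_ofReal ?_
    have hm : max ‖x‖ ‖y‖ ^ ℓ ≤ ‖x‖ ^ ℓ + ‖y‖ ^ ℓ := by
      have hx : 0 ≤ ‖x‖ ^ ℓ := Real.rpow_nonneg (norm_nonneg _) _
      have hy : 0 ≤ ‖y‖ ^ ℓ := Real.rpow_nonneg (norm_nonneg _) _
      rcases max_choice ‖x‖ ‖y‖ with h | h <;> rw [h] <;> linarith
    calc dist x y ^ ℓ ≤ (2 * max ‖x‖ ‖y‖) ^ ℓ := by
          refine Real.rpow_le_rpow dist_nonneg ?_ hℓ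
          rw [dist_eq_norm]
          have := norm_sub_le x y
          have := le_max_left ‖x‖ ‖y‖
          have := le_max_right ‖x‖ ‖y‖
          linarith
      _ = 2 ^ ℓ * max ‖x‖ ‖y‖ ^ ℓ := Real.mul_rpow zero_le_two (le_max_of_le_left (norm_nonneg _))
      _ ≤ 2 ^ ℓ * (Cl * (1 + V x) + Cl * (1 + V y)) := by
          refine mul_le_mul_of_nonneg_left (hm.trans (add_le_add (hL3 x) (hL3 y))) h2
      _ = _ := by ring

lemma Wl_tendsto {E : Type*} [MeasurableSpace E] [PseudoMetricSpace E] (ℓ : ℝ)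
    (m : ℕ → Measure E) (μ : Measure E)
    (h : ∀ ε : ℝ≥0∞, 0 < ε → ∀ᶠ N in atTop, ∃ ρ ∈ couplings (m N) μ, ∫⁻ p, cst ℓ p ∂ρ < ε) :
    Tendsto (fun N => Wl ℓ (m N) μ) atTop (𝓝 0) := by
  rw [ENNReal.tendsto_nhds_zero]
  intro ε hε
  by_cases h0 : ℓ = 0
  · filter_upwards [h ε hε] with N ⟨ρ, hρ, hlt⟩
    refine (iInf₂_le ρ hρ).trans ?_
    rw [if_pos h0]
    simp only [cst, if_pos h0] at hlt
    exact hlt.le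
  · have hp : 0 < max ℓ 1 := lt_max_of_lt_right one_pos
    filter_upwards [h (ε ^ max ℓ 1) (ENNReal.rpow_pos_of_nonneg hε hp.le)] with N ⟨ρ, hρ, hlt⟩
    refine (iInf₂_le ρ hρ).trans ?_
    rw [if_neg h0]
    simp only [cst, if_neg h0] at hlt
    rw [one_div]
    exact (ENNReal.rpow_inv_le_iff hp).2 hlt.le

end Harris

/-- LLN for Markov chains under L1, L2 and L3. -/
theorem stmt9 {d : ℕ} (ℓ : ℝ) (hℓ : 0 ≤ ℓ)
    {Ω : Type*} [MeasurableSpace Ω] (Pr : Measure Ω) [IsProbabilityMeasure Pr]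
    (P : Kernel (Euc d) (Euc d)) [IsMarkovKernel P]
    (V : Euc d → ℝ) (hVm : Measurable V) (hV0 : ∀ x, 0 ≤ V x)
    (γ K R ρ : ℝ) (hγ : γ ∈ Set.Ioo (0:ℝ) 1) (hK : 0 ≤ K)
    (hR : 2 * K / (1 - γ) < R) (hρ : ρ ∈ Set.Ioc (0:ℝ) 1)
    (hL1 : Lyap1 P V γ K) (hL2 : Lyap2 P V R ρ)
    (Cl : ℝ) (hL3 : ∀ x : Euc d, ‖x‖ ^ ℓ ≤ Cl * (1 + V x))
    (μ : Measure (Euc d)) (hμp : IsProbabilityMeasure μ) (hinv : μ.bind ⇑P = μ)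
    (ν₁ : Measure (Euc d)) (hν₁ : IsProbabilityMeasure ν₁)
    (X : ℕ → Ω → Euc d) (hchain : IsMarkovChain Pr X ν₁ P) :
    ∀ᵐ ω ∂Pr, Tendsto (fun N => Wl ℓ (emp X N ω) μ) atTop (𝓝 0) := by
  obtain ⟨hX, -, hch⟩ := hchain
  have hMC := Harris.MC_of_chain Pr X P hX hch
  obtain ⟨C, χ, hC, hχ0, hχ1, hH⟩ :=
    Harris.harris P V γ K hVm hV0 hγ hK hL1 R ρ hR hρ hL2 μ hinv
  have hVμ := Harris.inv_V P V γ K hVm hV0 hγ hK hL1 μ hinv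
  obtain ⟨c0, hc0, hc⟩ := Harris.cst_le ℓ hℓ V hV0 Cl hL3
  have key : ∀ M : ℕ, ∀ᵐ ω ∂Pr, V (X 0 ω) ≤ M →
      Tendsto (fun N => Wl ℓ (emp X N ω) μ) atTop (𝓝 0) := by
    intro M
    have hSm : MeasurableSet {x | V x ≤ M} := measurableSet_le hVm measurable_const
    have hms : MeasurableSet (X 0 ⁻¹' {x | V x ≤ M}) := hX 0 hSm
    have hMC' := Harris.MC_restrict Pr X P hMC {x | V x ≤ M} hSm
    have hint : Integrable (fun ω => V (X 0 ω)) (Pr.restrict (X 0 ⁻¹' {x | V x ≤ M})) := by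
      refine Integrable.of_bound (hVm.comp (hX 0)).aestronglyMeasurable M ?_
      filter_upwards [ae_restrict_mem hms] with ω hω
      rw [Real.norm_eq_abs, abs_of_nonneg (hV0 _)]
      exact hω
    obtain ⟨D, hD⟩ := Harris.mc_V _ X P V γ K hMC' hVm hV0 hγ hK hL1 hint
    have S : Harris.Setup (Pr.restrict (X 0 ⁻¹' {x | V x ≤ M})) X P V μ C χ D :=
      ⟨hMC', hVm, hV0, hC, hχ0, hχ1, hD, hVμ, hH⟩
    have h := S.coup (Harris.cst ℓ) c0 hc0 hc (Harris.cst_small ℓ hℓ)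
    rw [ae_restrict_iff' hms] at h
    filter_upwards [h] with ω hω hM
    exact Harris.Wl_tendsto ℓ _ μ (hω hM)
  filter_upwards [ae_all_iff.2 key] with ω hω
  exact hω ⌈V (X 0 ω)⌉₊ (Nat.le_ceil _)
end
end

section
/- Let ℓ ≥ 0, let P be a Markov transition kernel on ℝ^d satisfying L1, L2' and L3 with invariant probability measure μ, and let U : 𝒫_ℓ(ℝ^d) → ℝ satisfy RU1, RU2 and RU6 at μ with radius r > 0 and exponent α ∈ (1/2,1]. For m in the W_ℓ-ball B(μ,r), the Poisson equation F(m,x) − PF(m,x) = δU/δm(m,x) − ∫ δU/δm(m,y) μ(dy) admits the solution F(m,·) = Σ_{n∈ℕ}(Pⁿ(δU/δm(m,·)) − μ(δU/δm(m,·))), and there is a finite constant C̄ not depending on m, m₁, m₂ ∈ B(μ,r) such that: (i) ‖F(m,·)‖_{√V,1} ≤ C̄; (ii) ‖F(m₁,·) − F(m₂,·)‖_{√V,1} ≤ C̄ · sup_x |δU/δm(m₁,x) − δU/δm(m₂,x)|/(1+√V(x)); (iii) ‖F(m₁,·) − F(m₂,·)‖_{√V,1} ≤ C̄ · (∫(1+|y|^{ℓ/(2α)})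 |m₂−m₁|(dy))^α. -/
open MeasureTheory ProbabilityTheory Filter ENNReal Topology

noncomputable section

open Paper


namespace Poisson

variable {E : Type*} [MeasurableSpace E]

/-- One step of the kernel on functions. -/
def Q (P : Kernel E E) (f : E → ℝ) (x : E) : ℝ := ∫ y, f y ∂(P x)

/-- Drift structure. -/
structure Drift (P : Kernel E E) (W : E → ℝ) (g k : ℝ) : Prop where
  meas : Measurable W
  nn : ∀ x, 0 ≤ W x
  int : ∀ x, Integrable W (P x)
  le : ∀ x, ∫ y, W y ∂(P x) ≤ g * W x + k
  g0 : 0 ≤ g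
  g1 : g < 1
  k0 : 0 ≤ k

/-- Measurable with growth. -/
def Gr (W : E → ℝ) (M : ℝ) (f : E → ℝ) : Prop :=
  Measurable f ∧ ∀ x, |f x| ≤ M * (1 + W x)

lemma Gr.integrable {W : E → ℝ} {M : ℝ} {f : E → ℝ} (hf : Gr W M f) {m : Measure E}
    [IsFiniteMeasure m] (hW : Integrable W m) : Integrable f m := by
  refine Integrable.mono' (g := fun x => M * (1 + W x)) ?_ hf.1.aestronglyMeasurable ?_
  · exact ((integrable_const 1).add hW).const_mul M
  · exact ae_of_all _ fun x => by simpa using hf.2 x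

lemma Gr.M0 {W : E → ℝ} {M : ℝ} {f : E → ℝ} (hf : Gr W M f) (hW : ∀ x, 0 ≤ W x) (x : E) :
    0 ≤ M := by
  have h := (abs_nonneg _).trans (hf.2 x)
  have := hW x
  by_contra hM
  push Not at hM
  nlinarith

lemma Gr.Q {P : Kernel E E} [IsMarkovKernel P] {W : E → ℝ} {g k : ℝ} (D : Drift P W g k)
    {M : ℝ} {f : E → ℝ} (hf : Gr W M f) : Gr W (M * (1 + k)) (Q P f) := by
  refine ⟨(hf.1.stronglyMeasurable.integral_kernel).measurable, fun x => ?_⟩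
  have hM := hf.M0 D.nn x
  have h1 : |Poisson.Q P f x| ≤ ∫ y, M * (1 + W y) ∂(P x) := by
    unfold Poisson.Q
    refine (abs_integral_le_integral_abs).trans ?_
    exact integral_mono (hf.integrable (D.int x)).abs
      (((integrable_const 1).add (D.int x)).const_mul M) hf.2
  rw [integral_const_mul, integral_add (integrable_const 1) (D.int x)] at h1
  simp only [integral_const, probReal_univ, smul_eq_mul, mul_one] at h1
  refine h1.trans ?_
  rw [mul_assoc]
  refine mul_le_mul_of_nonneg_left ?_ hM
  have := D.le x
  have := D.nn x
  have := D.g0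
  have := D.g1
  have := D.k0
  nlinarith [mul_nonneg D.k0 (D.nn x)]

lemma Gr.iter {P : Kernel E E} [IsMarkovKernel P] {W : E → ℝ} {g k : ℝ} (D : Drift P W g k)
    {M : ℝ} {f : E → ℝ} (hf : Gr W M f) (n : ℕ) : Gr W (M * (1 + k) ^ n) ((Poisson.Q P)^[n] f) := by
  induction n generalizing f M with
  | zero => simpa using hf
  | succ n ih =>
    rw [Function.iterate_succ_apply, pow_succ', ← mul_assoc]
    exact ih (hf.Q D)

lemma integral_bind' {P : Kernel E E} [IsMarkovKernel P] (m : Measure E) [IsFiniteMeasure m]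
    {f : E → ℝ} (hf : Integrable f (m.bind P)) :
    ∫ y, f y ∂(m.bind P) = ∫ x, Q P f x ∂m := by
  unfold Q
  rw [Measure.comp_eq_comp_const_apply] at hf ⊢
  rw [Kernel.integral_comp hf, Kernel.const_apply]

lemma integrable_bind {P : Kernel E E} [IsMarkovKernel P] {W : E → ℝ} {g k : ℝ}
    (D : Drift P W g k) (m : Measure E) [IsFiniteMeasure m] (hW : Integrable W m) :
    Integrable W (m.bind P) := by
  rw [Measure.integrable_comp_iff D.meas.aestronglyMeasurable]
  refine ⟨ae_of_all _ D.int, ?_⟩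
  have h : Gr W 1 W := ⟨D.meas, fun x => by rw [abs_of_nonneg (D.nn x)]; linarith⟩
  have := (h.Q D).integrable hW
  refine this.congr (ae_of_all _ fun x => ?_)
  simp only [Poisson.Q]
  exact integral_congr_ae (ae_of_all _ fun y => by simp [abs_of_nonneg (D.nn y)])

lemma kIter_prob {P : Kernel E E} [IsMarkovKernel P] (m : Measure E) [IsProbabilityMeasure m]
    (n : ℕ) : IsProbabilityMeasure (kIter P m n) := by
  induction n with
  | zero => simpa [kIter]
  | succ n ih =>
    show IsProbabilityMeasure ((kIter P m n).bind P)
    infer_instance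

lemma kIter_int {P : Kernel E E} [IsMarkovKernel P] {W : E → ℝ} {g k : ℝ}
    (D : Drift P W g k) (m : Measure E) [IsProbabilityMeasure m] (hW : Integrable W m)
    (n : ℕ) : Integrable W (kIter P m n) := by
  induction n with
  | zero => simpa [kIter]
  | succ n ih =>
    have := kIter_prob (P := P) m n
    exact integrable_bind D _ ih

lemma dirac_int {W : E → ℝ} (hW : Measurable W) (x : E) : Integrable W (Measure.dirac x) :=
  integrable_dirac' hW.stronglyMeasurable (by simp)

lemma Pn_eq {P : Kernel E E} [IsMarkovKernel P] {W : E → ℝ} {g k : ℝ}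
    (D : Drift P W g k) {M : ℝ} {f : E → ℝ} (hf : Gr W M f) (n : ℕ) (x : E) :
    Pn P n f x = (Q P)^[n] f x := by
  induction n generalizing f M with
  | zero => simpa [Pn, kIter] using integral_dirac' _ _ hf.1.stronglyMeasurable
  | succ n ih =>
    rw [Function.iterate_succ_apply, ← ih (hf.Q D)]
    have := kIter_prob (P := P) (Measure.dirac x) n
    have := kIter_prob (P := P) (Measure.dirac x) (n+1)
    exact integral_bind' _ (hf.integrable (kIter_int D _ (dirac_int D.meas x) (n+1)))

lemma inv_Q {P : Kernel E E} [IsMarkovKernel P] {W : E → ℝ} {g k : ℝ}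
    (D : Drift P W g k) {M : ℝ} {f : E → ℝ} (hf : Gr W M f) (μ : Measure E)
    [IsProbabilityMeasure μ] (hinv : μ.bind P = μ) (hW : Integrable W μ) :
    ∫ x, Q P f x ∂μ = ∫ x, f x ∂μ := by
  conv_rhs => rw [← hinv]
  rw [integral_bind']
  rw [hinv]; exact hf.integrable hW

lemma inv_iter {P : Kernel E E} [IsMarkovKernel P] {W : E → ℝ} {g k : ℝ}
    (D : Drift P W g k) {M : ℝ} {f : E → ℝ} (hf : Gr W M f) (μ : Measure E)
    [IsProbabilityMeasure μ] (hinv : μ.bind P = μ) (hW : Integrable W μ) (n : ℕ) :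
    ∫ x, (Q P)^[n] f x ∂μ = ∫ x, f x ∂μ := by
  induction n generalizing f M with
  | zero => rfl
  | succ n ih =>
    simp only [Function.iterate_succ_apply]
    rw [ih (hf.Q D), inv_Q D hf μ hinv hW]

/-- Centering. -/
lemma center [Nonempty E] {f B : E → ℝ} (h : ∀ x y, |f x - f y| ≤ B x + B y) :
    ∃ c, ∀ x, |f x - c| ≤ B x := by
  have hb : ∀ y, f y + B y ∈ upperBounds (Set.range fun x => f x - B x) := by
    rintro y _ ⟨x, rfl⟩
    have := (abs_le.1 (h x y)).2
    show f x - B x ≤ f y + B y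
    linarith
  refine ⟨sSup (Set.range fun x => f x - B x), fun x => ?_⟩
  have h1 := le_csSup ⟨_, hb x⟩ (Set.mem_range_self (f := fun x => f x - B x) x)
  have h2 := csSup_le (Set.range_nonempty fun x => f x - B x) (hb x)
  rw [abs_le]; constructor <;> linarith

lemma contract [Nonempty E] {P : Kernel E E} [IsMarkovKernel P] {W : E → ℝ} {g k S ρ β χ A : ℝ}
    (D : Drift P W g k)
    (hmin : ∀ x y, W x + W y ≤ S → ENNReal.ofReal ρ ≤ (P x ⊓ P y) Set.univ)
    (hβ : 0 < β) (hA : 0 ≤ A) (hρ : 0 ≤ ρ)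
    (hχ1 : 1 - ρ + β * k ≤ χ) (hχ2 : g ≤ χ) (hχ3 : ∀ s, S ≤ s → 2 + β * (g * s + 2 * k) ≤ χ * (2 + β * s))
    {f : E → ℝ} (hfm : Measurable f)
    (hf : ∀ x y, |f x - f y| ≤ A * (2 + β * (W x + W y))) :
    ∀ x y, |Q P f x - Q P f y| ≤ χ * A * (2 + β * (W x + W y)) := by
  intro x y
  obtain ⟨c, hc⟩ := center (f := f) (B := fun x => A * (1 + β * W x)) (fun x y => by
    refine (hf x y).trans (le_of_eq (by ring)))
  set h : E → ℝ := fun z => f z - c with hh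
  have hhm : Measurable h := hfm.sub_const c
  have key : ∀ (m : Measure E) [IsFiniteMeasure m], Integrable W m → Integrable h m ∧
      |∫ z, h z ∂m| ≤ A * (m.real Set.univ + β * ∫ z, W z ∂m) := by
    intro m _ hm
    have i1 : Integrable (fun z => A * (1 + β * W z)) m :=
      ((integrable_const 1).add (hm.const_mul β)).const_mul A
    have i2 : Integrable h m := Integrable.mono' i1 hhm.aestronglyMeasurable
      (ae_of_all _ fun z => by simpa using hc z)
    refine ⟨i2, (abs_integral_le_integral_abs).trans ?_⟩
    refine (integral_mono i2.abs i1 hc).trans (le_of_eq ?_)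
    rw [integral_const_mul, integral_add (integrable_const 1) (hm.const_mul β), integral_const_mul]
    simp
  have hQ : ∀ z, Q P f z = ∫ w, h w ∂(P z) + c := by
    intro z
    have : f = fun w => h w + c := by ext w; simp [hh]
    unfold Q
    conv_lhs => rw [this]
    rw [integral_add (key _ (D.int z)).1 (integrable_const c)]
    simp
  rw [hQ, hQ, add_sub_add_right_eq_sub]
  have hx := D.le x
  have hy := D.le y
  have hWx := D.nn x
  have hWy := D.nn y
  rcases le_total S (W x + W y) with hs | hs
  · have kx := (key _ (D.int x)).2
    have ky := (key _ (D.int y)).2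
    simp only [probReal_univ] at kx ky
    have := hχ3 _ hs
    calc _ ≤ _ := abs_sub _ _
      _ ≤ A * (2 + β * (g * (W x + W y) + 2 * k)) := by
        have e1 : A * (β * ∫ z, W z ∂(P x)) ≤ A * (β * (g * W x + k)) := by gcongr
        have e2 : A * (β * ∫ z, W z ∂(P y)) ≤ A * (β * (g * W y + k)) := by gcongr
        linarith
      _ ≤ A * (χ * (2 + β * (W x + W y))) := by gcongr
      _ = _ := by ring
  · have hν := hmin x y hs
    set ν := P x ⊓ P y with hνd
    have l1 : ν ≤ P x := inf_le_left
    have l2 : ν ≤ P y := inf_le_right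
    have : IsFiniteMeasure ν := isFiniteMeasure_of_le _ l1
    have hνr : ρ ≤ ν.real Set.univ := by
      rw [measureReal_def]
      exact (ENNReal.ofReal_le_iff_le_toReal (measure_ne_top _ _)).1 hν
    have part : ∀ z, ν ≤ P z → ∃ a : Measure E, IsFiniteMeasure a ∧ Integrable W a ∧
        ∫ w, h w ∂(P z) = ∫ w, h w ∂a + ∫ w, h w ∂ν ∧ a.real Set.univ ≤ 1 - ρ ∧
        ∫ w, W w ∂a ≤ g * W z + k := by
      intro z hz
      have e := Measure.sub_add_cancel_of_le hz
      have la : P z - ν ≤ P z := Measure.sub_le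
      have fa : IsFiniteMeasure (P z - ν) := isFiniteMeasure_of_le _ la
      refine ⟨P z - ν, fa, (D.int z).mono_measure la, ?_, ?_, ?_⟩
      · conv_lhs => rw [← e]
        exact integral_add_measure (key _ ((D.int z).mono_measure la)).1
          (key _ ((D.int z).mono_measure hz)).1
      · have : (P z).real Set.univ = (P z - ν).real Set.univ + ν.real Set.univ := by
          conv_lhs => rw [← e]
          exact measureReal_add_apply
        rw [probReal_univ] at this
        linarith
      · refine le_trans ?_ (D.le z)
        exact integral_mono_measure la (ae_of_all _ D.nn) (D.int z)
    obtain ⟨a, fa, ia, ea, ma, wa⟩ := part x l1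
    obtain ⟨b, fb, ib, eb, mb, wb⟩ := part y l2
    rw [ea, eb, add_sub_add_right_eq_sub]
    have kx := (key _ ia).2
    have ky := (key _ ib).2
    calc _ ≤ _ := abs_sub _ _
      _ ≤ A * ((1 - ρ) + β * (g * W x + k)) + A * ((1 - ρ) + β * (g * W y + k)) := by
        refine add_le_add (kx.trans ?_) (ky.trans ?_) <;> gcongr
      _ = A * (2 * (1 - ρ + β * k) + g * (β * (W x + W y))) := by ring
      _ ≤ A * (2 * χ + χ * (β * (W x + W y))) := by gcongr
      _ = _ := by ring

lemma contract_iter [Nonempty E] {P : Kernel E E} [IsMarkovKernel P] {W : E → ℝ} {g k S ρ β χ A : ℝ}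
    (D : Drift P W g k)
    (hmin : ∀ x y, W x + W y ≤ S → ENNReal.ofReal ρ ≤ (P x ⊓ P y) Set.univ)
    (hβ : 0 < β) (hA : 0 ≤ A) (hρ : 0 ≤ ρ)
    (hχ1 : 1 - ρ + β * k ≤ χ) (hχ2 : g ≤ χ) (hχ3 : ∀ s, S ≤ s → 2 + β * (g * s + 2 * k) ≤ χ * (2 + β * s))
    {f : E → ℝ} (hfm : Measurable f)
    (hf : ∀ x y, |f x - f y| ≤ A * (2 + β * (W x + W y))) (n : ℕ) :
    ∀ x y, |(Q P)^[n] f x - (Q P)^[n] f y| ≤ χ ^ n * A * (2 + β * (W x + W y)) := by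
  induction n generalizing f A with
  | zero => simpa using hf
  | succ n ih =>
    intro x y
    rw [Function.iterate_succ_apply, pow_succ, mul_assoc (χ ^ n)]
    exact ih (mul_nonneg (D.g0.trans hχ2) hA)
      (hfm.stronglyMeasurable.integral_kernel).measurable
      (contract D hmin hβ hA hρ hχ1 hχ2 hχ3 hfm hf) x y

/-- Geometric ergodicity. -/
lemma ergodic [Nonempty E] {P : Kernel E E} [IsMarkovKernel P] {W : E → ℝ} {g k S ρ : ℝ}
    (D : Drift P W g k)
    (hmin : ∀ x y, W x + W y ≤ S → ENNReal.ofReal ρ ≤ (P x ⊓ P y) Set.univ)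
    (hρ : 0 < ρ) (hρ1 : ρ ≤ 1) (hS : 2 * k < (1 - g) * S) (μ : Measure E) [IsProbabilityMeasure μ]
    (hinv : μ.bind P = μ) (hW : Integrable W μ) :
    ∃ χ C : ℝ, 0 ≤ χ ∧ χ < 1 ∧ 0 ≤ C ∧ ∀ (M : ℝ) (f : E → ℝ), Gr W M f → ∀ n x,
      |Pn P n f x - ∫ y, f y ∂μ| ≤ χ ^ n * (M * C * (1 + W x)) := by
  have k0 := D.k0
  have g0 := D.g0
  have g1 := D.g1
  have S0 : 0 < S := by
    by_contra h
    push Not at h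
    nlinarith
  set β := ρ / (2 * (k + 1)) with hβd
  have hβ : 0 < β := by positivity
  have hβ1 : β ≤ 1 := by
    rw [hβd, div_le_one (by positivity)]; linarith
  have hβk : β * k ≤ ρ / 2 := by
    rw [hβd, div_mul_eq_mul_div, div_le_div_iff₀ (by positivity) (by positivity)]
    nlinarith
  set c3 := (2 + β * (g * S + 2 * k)) / (2 + β * S) with hc3
  have hd : 0 < 2 + β * S := by positivity
  have c31 : c3 < 1 := by
    rw [hc3, div_lt_one hd]
    nlinarith
  set χ := max (max (1 - ρ + β * k) g) c3 with hχ
  have x1 : 1 - ρ + β * k ≤ χ := (le_max_left _ _).trans (le_max_left _ _)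
  have x2 : g ≤ χ := (le_max_right _ _).trans (le_max_left _ _)
  have x3 : c3 ≤ χ := le_max_right _ _
  have χ1 : χ < 1 := by
    refine max_lt (max_lt ?_ g1) c31
    linarith
  have hχ3 : ∀ s, S ≤ s → 2 + β * (g * s + 2 * k) ≤ χ * (2 + β * s) := by
    intro s hs
    have e : 2 + β * (g * S + 2 * k) ≤ χ * (2 + β * S) := by
      rwa [hc3, div_le_iff₀ hd] at x3
    have : g * (β * (s - S)) ≤ χ * (β * (s - S)) :=
      mul_le_mul_of_nonneg_right x2 (mul_nonneg hβ.le (by linarith))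
    nlinarith
  have χ0 := g0.trans x2
  have iW0 : 0 ≤ ∫ y, W y ∂μ := integral_nonneg D.nn
  refine ⟨χ, (2 + ∫ y, W y ∂μ) / β, χ0, χ1, by positivity, fun M f hf n x => ?_⟩
  have hM := hf.M0 D.nn x
  have h0 : ∀ x y, |f x - f y| ≤ M / β * (2 + β * (W x + W y)) := by
    intro x y
    calc _ ≤ _ := abs_sub _ _
      _ ≤ M * (1 + W x) + M * (1 + W y) := add_le_add (hf.2 x) (hf.2 y)
      _ = M / β * (β * 2 + β * (W x + W y)) := by field_simp; ring
      _ ≤ _ := by gcongr; linarith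
  have hn := contract_iter D hmin hβ (by positivity : 0 ≤ M / β) hρ.le x1 x2 hχ3 hf.1 h0 n
  have hG := hf.iter D n
  have iG := hG.integrable hW
  rw [Pn_eq D hf, ← inv_iter D hf μ hinv hW n]
  have : (Q P)^[n] f x - ∫ y, (Q P)^[n] f y ∂μ = ∫ y, ((Q P)^[n] f x - (Q P)^[n] f y) ∂μ := by
    rw [integral_sub (integrable_const _) iG]; simp
  rw [this]
  have i1 : Integrable (fun y => χ ^ n * (M / β) * (2 + β * (W x + W y))) μ :=
    ((integrable_const _).add (((integrable_const _).add hW).const_mul β)).const_mul _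
  refine (abs_integral_le_integral_abs).trans ?_
  refine (integral_mono ((integrable_const _).sub iG).abs i1 (hn x)).trans ?_
  have i3 : Integrable (fun y => W x + W y) μ := (integrable_const _).add hW
  rw [integral_const_mul, integral_add (integrable_const _) (i3.const_mul β),
    integral_const_mul, integral_add (integrable_const _) hW]
  simp only [integral_const, probReal_univ, smul_eq_mul, one_mul]
  set I := ∫ y, W y ∂μ
  rw [mul_assoc]
  refine mul_le_mul_of_nonneg_left ?_ (pow_nonneg χ0 n)
  calc M / β * (2 + β * (W x + I)) ≤ M / β * ((2 + I) * (1 + W x)) := by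
        have := D.nn x
        gcongr
        have : β * (W x + I) ≤ W x + I := mul_le_of_le_one_left (by positivity) hβ1
        nlinarith [mul_nonneg iW0 (D.nn x)]
    _ = _ := by ring

lemma inv_moment {P : Kernel E E} [IsMarkovKernel P] {W : E → ℝ} {g k : ℝ}
    (D : Drift P W g k) (μ : Measure E) [IsProbabilityMeasure μ]
    (hinv : μ.bind P = μ) : Integrable W μ := by
  have k0 := D.k0
  have g0 := D.g0
  have g1 := D.g1
  set c := k / (1 - g) with hc
  have hc0 : 0 ≤ c := div_nonneg k0 (by linarith)
  have hck : g * c + k = c := by rw [hc]; have : 1 - g ≠ 0 := by linarith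
                                 field_simp; ring
  have bi : ∀ (m : Measure E) [IsProbabilityMeasure m] (a b : ℝ) (N : ℝ), 0 ≤ a → 0 ≤ b → 0 ≤ N →
      Integrable (fun x => min (a * W x + b) N) m := by
    intro m _ a b N ha hb hN
    refine Integrable.mono' (integrable_const N)
      (((D.meas.const_mul a).add_const b).min measurable_const).aestronglyMeasurable
      (ae_of_all _ fun x => ?_)
    have := D.nn x
    rw [Real.norm_of_nonneg (by positivity)]
    exact min_le_right _ _
  have step : ∀ (a b N : ℝ), 0 ≤ a → 0 ≤ b → 0 ≤ N →
      ∫ x, min (a * W x + b) N ∂μ ≤ ∫ x, min (a * g * W x + (a * k + b)) N ∂μ := by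
    intro a b N ha hb hN
    conv_lhs => rw [← hinv]
    rw [integral_bind' μ (by rw [hinv]; exact bi μ a b N ha hb hN)]
    refine integral_mono_of_nonneg ?_ (bi μ _ _ N (by positivity) (by positivity) hN)
      (ae_of_all _ fun x => ?_)
    · exact ae_of_all _ fun x => integral_nonneg fun y => by
        have := D.nn y
        simp only [Pi.zero_apply]
        positivity
    · simp only [Q]
      refine le_min ?_ ?_
      · calc _ ≤ ∫ y, (a * W y + b) ∂(P x) := by
              refine integral_mono (bi _ a b N ha hb hN)
                (((D.int x).const_mul a).add (integrable_const b)) fun y => min_le_left _ _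
          _ = a * ∫ y, W y ∂(P x) + b := by
              rw [integral_add ((D.int x).const_mul a) (integrable_const b), integral_const_mul]
              simp
          _ ≤ a * (g * W x + k) + b := by have := D.le x; gcongr
          _ = _ := by ring
      · calc _ ≤ ∫ y, N ∂(P x) :=
              integral_mono (bi _ a b N ha hb hN) (integrable_const N) fun y => min_le_right _ _
          _ = N := by simp
  have it : ∀ (N : ℝ), 0 ≤ N → ∀ n : ℕ, 
      ∫ x, min (W x) N ∂μ ≤ ∫ x, min (g ^ n * W x + c * (1 - g ^ n)) N ∂μ := by
    intro N hN n
    induction n with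
    | zero => simp
    | succ n ih =>
      have hp : g ^ n ≤ 1 := pow_le_one₀ g0 g1.le
      refine ih.trans ((step (g ^ n) (c * (1 - g ^ n)) N (by positivity)
        (mul_nonneg hc0 (by linarith)) hN).trans (le_of_eq ?_))
      congr 1
      ext x
      have : g ^ n * k + c * (1 - g ^ n) = c * (1 - g ^ (n+1)) := by
        rw [pow_succ]; linear_combination (g ^ n) * hck
      rw [this, pow_succ]
  have bd : ∀ (N : ℝ), 0 ≤ N → ∫ x, min (W x) N ∂μ ≤ c := by
    intro N hN
    have lim : Tendsto (fun n : ℕ => ∫ x, min (g ^ n * W x + c * (1 - g ^ n)) N ∂μ) atTop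
        (𝓝 (∫ x, min c N ∂μ)) := by
      refine tendsto_integral_of_dominated_convergence (fun _ => N) (fun n => ?_)
        (integrable_const N) (fun n => ae_of_all _ fun x => ?_) (ae_of_all _ fun x => ?_)
      · exact (((D.meas.const_mul _).add_const _).min measurable_const).aestronglyMeasurable
      · have hp : g ^ n ≤ 1 := pow_le_one₀ g0 g1.le
        have h1 : 0 ≤ c * (1 - g ^ n) := mul_nonneg hc0 (by linarith)
        have := D.nn x
        rw [Real.norm_of_nonneg (by positivity)]
        exact min_le_right _ _
      · have hg := tendsto_pow_atTop_nhds_zero_of_lt_one g0 g1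
        have : Tendsto (fun n : ℕ => min (g ^ n * W x + c * (1 - g ^ n)) N) atTop
            (𝓝 (min (0 * W x + c * (1 - 0)) N)) :=
          (((hg.mul_const _).add ((hg.const_sub 1).const_mul c))).min tendsto_const_nhds
        simpa using this
    refine (ge_of_tendsto' lim (it N hN)).trans ?_
    simp
  refine ⟨D.meas.aestronglyMeasurable, ?_⟩
  have hl : ∫⁻ x, ENNReal.ofReal (W x) ∂μ ≤ ENNReal.ofReal c := by
    have : ∀ x, ENNReal.ofReal (W x) = ⨆ N : ℕ, ENNReal.ofReal (min (W x) N) := by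
      intro x
      apply le_antisymm
      · obtain ⟨N, hN⟩ := exists_nat_ge (W x)
        refine le_iSup_of_le N ?_
        rw [min_eq_left hN]
      · exact iSup_le fun N => ENNReal.ofReal_le_ofReal (min_le_left _ _)
    simp_rw [this]
    rw [lintegral_iSup]
    · refine iSup_le fun N => ?_
      have iN := bi μ 1 0 N (by norm_num) le_rfl (Nat.cast_nonneg N)
      simp only [one_mul, add_zero] at iN
      rw [← ofReal_integral_eq_lintegral_ofReal iN
        (ae_of_all _ fun x => le_min (D.nn x) (Nat.cast_nonneg N))]
      exact ENNReal.ofReal_le_ofReal (bd N (Nat.cast_nonneg N))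
    · intro N
      exact (D.meas.min measurable_const).ennreal_ofReal
    · intro a b hab x
      exact ENNReal.ofReal_le_ofReal (min_le_min le_rfl (by exact_mod_cast hab))
  rw [hasFiniteIntegral_iff_ofReal (ae_of_all _ D.nn)]
  exact hl.trans_lt ENNReal.ofReal_lt_top

lemma drift_sqrt {P : Kernel E E} [IsMarkovKernel P] {V : E → ℝ} {γ K : ℝ}
    (hVm : Measurable V) (hV0 : ∀ x, 0 ≤ V x) (hγ : γ ∈ Set.Ioo (0:ℝ) 1) (hK : 0 ≤ K)
    (hL1 : Lyap1 P V γ K) : Drift P (fun x => √(V x)) (√γ) (√K) := by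
  have hVi : ∀ x, Integrable V (P x) := fun x => by
    refine ⟨hVm.aestronglyMeasurable, ?_⟩
    rw [hasFiniteIntegral_iff_ofReal (ae_of_all _ hV0)]
    exact (hL1 x).trans_lt ENNReal.ofReal_lt_top
  have hsi : ∀ x, Integrable (fun x => √(V x)) (P x) := fun x => by
    refine Integrable.mono' ((integrable_const 1).add (hVi x)) hVm.sqrt.aestronglyMeasurable
      (ae_of_all _ fun y => ?_)
    rw [Real.norm_of_nonneg (Real.sqrt_nonneg _)]
    show √(V y) ≤ 1 + V y
    nlinarith [Real.sq_sqrt (hV0 y), sq_nonneg (√(V y) - 1), Real.sqrt_nonneg (V y)]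
  refine ⟨hVm.sqrt, fun x => Real.sqrt_nonneg _, hsi, fun x => ?_, Real.sqrt_nonneg _, ?_,
    Real.sqrt_nonneg _⟩
  · set m := ∫ y, √(V y) ∂(P x) with hm
    have hb : ∫ y, V y ∂(P x) ≤ γ * V x + K := by
      have hp : 0 ≤ γ * V x + K := add_nonneg (mul_nonneg hγ.1.le (hV0 x)) hK
      have := hL1 x
      rw [← ofReal_integral_eq_lintegral_ofReal (hVi x) (ae_of_all _ hV0)] at this
      exact (ENNReal.ofReal_le_ofReal_iff hp).1 this
    have h0 : 0 ≤ ∫ y, (V y - 2 * m * √(V y) + m ^ 2) ∂(P x) := by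
      refine integral_nonneg fun y => ?_
      show 0 ≤ V y - 2 * m * √(V y) + m ^ 2
      nlinarith [Real.sq_sqrt (hV0 y), sq_nonneg (√(V y) - m)]
    have i4 : Integrable (fun y => V y - 2 * m * √(V y)) (P x) :=
      (hVi x).sub ((hsi x).const_mul _)
    rw [integral_add i4 (integrable_const _),
      integral_sub (hVi x) ((hsi x).const_mul _), integral_const_mul, ← hm] at h0
    simp only [integral_const, probReal_univ, smul_eq_mul, one_mul] at h0
    have a1 := Real.sqrt_nonneg γ
    have a2 := Real.sqrt_nonneg (V x)
    have a3 := Real.sqrt_nonneg K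
    refine le_of_sq_le_sq ?_ (by positivity)
    calc m ^ 2 ≤ γ * V x + K := by nlinarith
      _ = √γ ^ 2 * √(V x) ^ 2 + √K ^ 2 := by
        rw [Real.sq_sqrt hγ.1.le, Real.sq_sqrt (hV0 x), Real.sq_sqrt hK]
      _ ≤ _ := by nlinarith [mul_nonneg (mul_nonneg a1 a2) a3]
  · rw [Real.sqrt_lt' one_pos]; simpa using hγ.2

/-- The Poisson solution. -/
def sol (P : Kernel E E) (μ : Measure E) (f : E → ℝ) (x : E) : ℝ :=
  ∑' n, (Pn P n f x - ∫ y, f y ∂μ)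

/-- Geometric ergodicity property. -/
def Erg (P : Kernel E E) (μ : Measure E) (W : E → ℝ) (χ C : ℝ) : Prop :=
  ∀ (M : ℝ) (f : E → ℝ), Gr W M f → ∀ n x,
      |Pn P n f x - ∫ y, f y ∂μ| ≤ χ ^ n * (M * C * (1 + W x))

lemma sol_hasSum {P : Kernel E E} {μ : Measure E} {W : E → ℝ} {χ C : ℝ} (he : Erg P μ W χ C)
    (χ0 : 0 ≤ χ) (χ1 : χ < 1) {M : ℝ} {f : E → ℝ} (hf : Gr W M f) (x : E) :
    Summable (fun n => Pn P n f x - ∫ y, f y ∂μ) := by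
  refine Summable.of_norm_bounded ((summable_geometric_of_lt_one χ0 χ1).mul_right
    (M * C * (1 + W x))) fun n => ?_
  exact he M f hf n x

lemma sol_tail {P : Kernel E E} {μ : Measure E} {W : E → ℝ} {χ C : ℝ} (he : Erg P μ W χ C)
    (χ0 : 0 ≤ χ) (χ1 : χ < 1) {M : ℝ} {f : E → ℝ} (hf : Gr W M f) (n : ℕ) (x : E) :
    |(∑ k ∈ Finset.range n, (Pn P k f x - ∫ y, f y ∂μ)) - sol P μ f x| ≤
      χ ^ n * (M * (C / (1 - χ)) * (1 + W x)) := by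
  have hs := sol_hasSum he χ0 χ1 hf x
  have e := hs.sum_add_tsum_nat_add n
  have : (∑ k ∈ Finset.range n, (Pn P k f x - ∫ y, f y ∂μ)) - sol P μ f x =
      - ∑' k, (Pn P (k + n) f x - ∫ y, f y ∂μ) := by
    unfold sol; rw [← e]; ring
  rw [this, abs_neg]
  have hg : HasSum (fun j => χ ^ j * (χ ^ n * (M * C * (1 + W x))))
      ((1 - χ)⁻¹ * (χ ^ n * (M * C * (1 + W x)))) :=
    (hasSum_geometric_of_lt_one χ0 χ1).mul_right _
  have := tsum_of_norm_bounded hg (f := fun j => Pn P (j + n) f x - ∫ y, f y ∂μ) (fun j => by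
    refine (he M f hf (j + n) x).trans (le_of_eq ?_)
    rw [pow_add]; ring)
  rw [Real.norm_eq_abs] at this
  refine this.trans (le_of_eq ?_)
  rw [div_eq_mul_inv]; ring

lemma sol_bound {P : Kernel E E} {μ : Measure E} {W : E → ℝ} {χ C : ℝ} (he : Erg P μ W χ C)
    (χ0 : 0 ≤ χ) (χ1 : χ < 1) {M : ℝ} {f : E → ℝ} (hf : Gr W M f) (x : E) :
    |sol P μ f x| ≤ M * (C / (1 - χ)) * (1 + W x) := by
  simpa using sol_tail he χ0 χ1 hf 0 x

lemma sol_sub {P : Kernel E E} [IsMarkovKernel P] {μ : Measure E} [IsProbabilityMeasure μ]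
    {W : E → ℝ} {χ C g k : ℝ} (D : Drift P W g k)
    (hW : Integrable W μ) (he : Erg P μ W χ C)
    (χ0 : 0 ≤ χ) (χ1 : χ < 1) {M M' : ℝ} {f f' : E → ℝ} (hf : Gr W M f) (hf' : Gr W M' f') (x : E) :
    sol P μ f x - sol P μ f' x = sol P μ (fun y => f y - f' y) x := by
  unfold sol
  rw [← (sol_hasSum he χ0 χ1 hf x).tsum_sub (sol_hasSum he χ0 χ1 hf' x)]
  congr 1
  ext n
  have := kIter_prob (P := P) (Measure.dirac x) n
  have hi := kIter_int D _ (dirac_int D.meas x) n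
  unfold Pn
  rw [integral_sub (hf.integrable hi) (hf'.integrable hi),
    integral_sub (hf.integrable hW) (hf'.integrable hW)]
  ring

lemma sol_poisson {P : Kernel E E} [IsMarkovKernel P] {μ : Measure E} [IsProbabilityMeasure μ]
    {W : E → ℝ} {χ C g k : ℝ} (D : Drift P W g k) (C0 : 0 ≤ C) (he : Erg P μ W χ C)
    (χ0 : 0 ≤ χ) (χ1 : χ < 1) {M : ℝ} {f : E → ℝ} (hf : Gr W M f) (x : E) :
    sol P μ f x - ∫ y, sol P μ f y ∂(P x) = f x - ∫ y, f y ∂μ := by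
  have hM := hf.M0 D.nn x
  set I := ∫ y, f y ∂μ with hI
  let T : ℕ → E → ℝ := fun n y => ∑ k ∈ Finset.range n, (Pn P k f y - I)
  have hmeas : ∀ n, Measurable fun y => Pn P n f y := fun n => by
    have : (fun y => Pn P n f y) = (Q P)^[n] f := by ext y; exact Pn_eq D hf n y
    rw [this]; exact (hf.iter D n).1
  have hgr : ∀ n, Gr W (M * (1 + k) ^ n) fun y => Pn P n f y := fun n => by
    have : (fun y => Pn P n f y) = (Q P)^[n] f := by ext y; exact Pn_eq D hf n y
    rw [this]; exact (hf.iter D n)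
  have lim1 : ∀ y, Tendsto (fun n => T n y) atTop (𝓝 (sol P μ f y)) := fun y =>
    (sol_hasSum he χ0 χ1 hf y).hasSum.tendsto_sum_nat
  have c0 : 0 ≤ M * (C / (1 - χ)) := mul_nonneg hM (div_nonneg C0 (by linarith))
  have bT : ∀ n y, |T n y| ≤ 2 * (M * (C / (1 - χ))) * (1 + W y) := fun n y => by
    have h1 := sol_tail he χ0 χ1 hf n y
    have h2 := sol_bound he χ0 χ1 hf y
    have h3 : χ ^ n * (M * (C / (1 - χ)) * (1 + W y)) ≤ M * (C / (1 - χ)) * (1 + W y) :=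
      mul_le_of_le_one_left (mul_nonneg c0 (by linarith [D.nn y])) (pow_le_one₀ χ0 χ1.le)
    have := abs_add_le (T n y - sol P μ f y) (sol P μ f y)
    rw [sub_add_cancel] at this
    simp only [T] at this ⊢
    linarith
  have lim2 : Tendsto (fun n => ∫ y, T n y ∂(P x)) atTop (𝓝 (∫ y, sol P μ f y ∂(P x))) := by
    refine tendsto_integral_of_dominated_convergence
      (fun y => 2 * (M * (C / (1 - χ))) * (1 + W y)) (fun n => ?_) ?_
      (fun n => ae_of_all _ (bT n)) (ae_of_all _ lim1)
    · exact (Finset.measurable_fun_sum _ fun i _ => (hmeas i).sub_const I).aestronglyMeasurable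
    · exact ((integrable_const 1).add (D.int x)).const_mul _
  have e : ∀ n, ∫ y, T n y ∂(P x) = T (n + 1) x - (f x - I) := by
    intro n
    simp only [T]
    have i5 : ∀ i, Integrable (fun y => Pn P i f y - I) (P x) := fun i =>
      ((hgr i).integrable (D.int x)).sub (integrable_const I)
    rw [integral_finsetSum _ fun i _ => i5 i,
      Finset.sum_range_succ']
    have z : Pn P 0 f x = f x := Pn_eq D hf 0 x
    rw [z, add_sub_cancel_right]
    refine Finset.sum_congr rfl fun i _ => ?_
    rw [integral_sub ((hgr i).integrable (D.int x)) (integrable_const I), Pn_eq D hf,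
      Function.iterate_succ_apply']
    simp only [Pn_eq D hf, integral_const, probReal_univ, smul_eq_mul, one_mul]
    rfl
  have lim3 : Tendsto (fun n => ∫ y, T n y ∂(P x)) atTop (𝓝 (sol P μ f x - (f x - I))) := by
    simp_rw [e]
    exact ((tendsto_add_atTop_iff_nat 1).2 (lim1 x)).sub_const _
  have := tendsto_nhds_unique lim2 lim3
  rw [this]; ring

end Poisson

/-- Poisson equation lemma: solution, uniform bound and stability in `m`. -/
theorem stmt12 {d : ℕ} (ℓ : ℝ) (hℓ : 0 ≤ ℓ)
    (P : Kernel (Euc d) (Euc d)) [IsMarkovKernel P]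
    (V : Euc d → ℝ) (hVm : Measurable V) (hV0 : ∀ x, 0 ≤ V x)
    (γ K R ρ : ℝ) (hγ : γ ∈ Set.Ioo (0:ℝ) 1) (hK : 0 ≤ K)
    (hR : 4 * K / (1 - Real.sqrt γ) ^ 2 < R) (hρ : ρ ∈ Set.Ioc (0:ℝ) 1)
    (hL1 : Lyap1 P V γ K) (hL2 : Lyap2 P V R ρ)
    (Cl : ℝ) (hL3 : ∀ x : Euc d, ‖x‖ ^ ℓ ≤ Cl * (1 + V x))
    (μ : Measure (Euc d)) (hμp : IsProbabilityMeasure μ) (hinv : μ.bind ⇑P = μ)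
    (U : Measure (Euc d) → ℝ) (DU : Measure (Euc d) → Euc d → ℝ)
    (r : ℝ) (hr : 0 < r) (α : ℝ) (hα : α ∈ Set.Ioc (1/2 : ℝ) 1)
    (h1 : RU1 ℓ r U μ DU) (h2 : RU2 ℓ r μ DU) (h6 : RU6 ℓ α r μ DU) :
    ∃ Cbar : ℝ, ∃ F : Measure (Euc d) → Euc d → ℝ,
      (∀ m ∈ ball ℓ μ r,
        -- the series `∑ (Pⁿ(δU/δm(m,·)) - μ(δU/δm(m,·)))` converges to `F m` in `‖·‖_{√V,1}`
        (∀ ε > (0:ℝ), ∃ N₀ : ℕ, ∀ n ≥ N₀, ∀ x,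
          |(∑ k ∈ Finset.range n, (Pn P k (DU m) x - ∫ y, DU m y ∂μ)) - F m x|
            ≤ ε * (1 + Real.sqrt (V x))) ∧
        -- `F m` solves the Poisson equation
        (∀ x, F m x - ∫ y, F m y ∂(P x) = DU m x - ∫ y, DU m y ∂μ) ∧
        -- (i) `‖F(m,·)‖_{√V,1} ≤ C̄`
        (∀ x, |F m x| ≤ Cbar * (1 + Real.sqrt (V x)))) ∧
      ∀ m₁ ∈ ball ℓ μ r, ∀ m₂ ∈ ball ℓ μ r,
        -- (ii) `‖F(m₁,·) - F(m₂,·)‖_{√V,1} ≤ C̄ sup_x |δU/δm(m₁,x)-δU/δm(m₂,x)|/(1+√V(x))`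
        (∀ M : ℝ, (∀ x, |DU m₁ x - DU m₂ x| ≤ M * (1 + Real.sqrt (V x))) →
          ∀ x, |F m₁ x - F m₂ x| ≤ Cbar * M * (1 + Real.sqrt (V x))) ∧
        -- (iii) Hölder-type stability
        (∀ x, |F m₁ x - F m₂ x| ≤
          Cbar * (∫ y, (1 + ‖y‖ ^ (ℓ / (2 * α))) ∂(mdiff m₂ m₁)) ^ α *
            (1 + Real.sqrt (V x))) := by
  classical
  have hn : Nonempty (Euc d) := ⟨0⟩
  set W : Euc d → ℝ := fun x => √(V x) with hWd
  have D : Poisson.Drift P W (√γ) (√K) := Poisson.drift_sqrt hVm hV0 hγ hK hL1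
  have hW := Poisson.inv_moment D μ hinv
  have g1 : 0 < 1 - √γ := by have := D.g1; linarith
  have hR0 : 0 ≤ R := (div_nonneg (by positivity) (by positivity)).trans hR.le
  have hS : 2 * √K < (1 - √γ) * √R := by
    rw [div_lt_iff₀ (by positivity)] at hR
    refine lt_of_pow_lt_pow_left₀ 2 (by positivity) ?_
    rw [mul_pow, mul_pow, Real.sq_sqrt hK, Real.sq_sqrt hR0]
    linarith
  have hmin : ∀ x y, W x + W y ≤ √R → ENNReal.ofReal ρ ≤ (P x ⊓ P y) Set.univ := by
    intro x y h
    refine hL2 x y ?_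
    have a := Real.sqrt_nonneg (V x)
    have b := Real.sqrt_nonneg (V y)
    have : (√(V x) + √(V y)) ^ 2 ≤ √R ^ 2 := pow_le_pow_left₀ (by positivity) h 2
    rw [Real.sq_sqrt hR0] at this
    nlinarith [Real.sq_sqrt (hV0 x), Real.sq_sqrt (hV0 y), mul_nonneg a b]
  obtain ⟨χ, C, χ0, χ1, C0, he⟩ := Poisson.ergodic D hmin hρ.1 hρ.2 hS μ hinv hW
  change Poisson.Erg P μ W χ C at he
  have χ2 : 0 < 1 - χ := by linarith
  obtain ⟨C2, hC2⟩ := h2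
  obtain ⟨C6, hC6⟩ := h6
  -- growth comparison
  set B := 1 + √|Cl| with hB
  have hB0 : 0 ≤ B := by positivity
  have hcmp : ∀ x : Euc d, 1 + ‖x‖ ^ (ℓ / 2) ≤ B * (1 + W x) := by
    intro x
    have e : ‖x‖ ^ (ℓ / 2) = √(‖x‖ ^ ℓ) := by
      rw [Real.sqrt_eq_rpow, ← Real.rpow_mul (norm_nonneg x)]; congr 1; ring
    have v := hV0 x
    have w := Real.sqrt_nonneg (V x)
    have h3 : ‖x‖ ^ ℓ ≤ |Cl| * (1 + W x) ^ 2 := by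
      refine (hL3 x).trans ?_
      refine (mul_le_mul_of_nonneg_right (le_abs_self Cl) (by linarith)).trans ?_
      refine mul_le_mul_of_nonneg_left ?_ (abs_nonneg _)
      simp only [hWd]
      nlinarith [Real.sq_sqrt v]
    have h4 : √(‖x‖ ^ ℓ) ≤ √|Cl| * (1 + W x) := by
      refine (Real.sqrt_le_sqrt h3).trans (le_of_eq ?_)
      rw [Real.sqrt_mul (abs_nonneg _), Real.sqrt_sq (by simp only [hWd]; positivity)]
    rw [e, hB]
    have : 0 ≤ W x := w
    nlinarith
  have hGr : ∀ m ∈ ball ℓ μ r, Poisson.Gr W (|C2| * B) (DU m) := by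
    intro m hm
    refine ⟨(h1 m hm).1, fun x => (hC2 m hm x).trans ?_⟩
    have p : 0 ≤ 1 + ‖x‖ ^ (ℓ / 2) := by positivity
    refine (mul_le_mul_of_nonneg_right (le_abs_self C2) p).trans ?_
    rw [mul_assoc]
    exact mul_le_mul_of_nonneg_left (hcmp x) (abs_nonneg _)
  set L := C / (1 - χ) with hL
  have L0 : 0 ≤ L := div_nonneg C0 χ2.le
  have W0 : ∀ x, 0 ≤ W x := D.nn
  set Cb := L + |C2| * B * L + |C6| * B * L with hCb
  have q2 : 0 ≤ |C2| * B * L := by positivity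
  have q6 : 0 ≤ |C6| * B * L := by positivity
  have hii : ∀ m₁ ∈ ball ℓ μ r, ∀ m₂ ∈ ball ℓ μ r, ∀ M : ℝ,
      (∀ x, |DU m₁ x - DU m₂ x| ≤ M * (1 + W x)) →
        ∀ x, |Poisson.sol P μ (DU m₁) x - Poisson.sol P μ (DU m₂) x| ≤ M * L * (1 + W x) := by
    intro m₁ hm₁ m₂ hm₂ M hM x
    rw [Poisson.sol_sub D hW he χ0 χ1 (hGr m₁ hm₁) (hGr m₂ hm₂)]
    exact Poisson.sol_bound he χ0 χ1 ⟨(h1 m₁ hm₁).1.sub (h1 m₂ hm₂).1, hM⟩ x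
  refine ⟨Cb, fun m => Poisson.sol P μ (DU m), fun m hm => ⟨?_, ?_, ?_⟩, fun m₁ hm₁ m₂ hm₂ => ⟨?_, ?_⟩⟩
  · intro ε hε
    have lim : Tendsto (fun n : ℕ => χ ^ n * (|C2| * B * L)) atTop (𝓝 (0 * (|C2| * B * L))) :=
      (tendsto_pow_atTop_nhds_zero_of_lt_one χ0 χ1).mul_const _
    rw [zero_mul] at lim
    obtain ⟨N₀, hN⟩ := eventually_atTop.1 (lim.eventually (gt_mem_nhds hε))
    refine ⟨N₀, fun n hn x => (Poisson.sol_tail he χ0 χ1 (hGr m hm) n x).trans ?_⟩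
    rw [← mul_assoc]
    exact mul_le_mul_of_nonneg_right (hN n hn).le (by linarith [W0 x])
  · exact fun x => Poisson.sol_poisson D C0 he χ0 χ1 (hGr m hm) x
  · intro x
    refine (Poisson.sol_bound he χ0 χ1 (hGr m hm) x).trans ?_
    exact mul_le_mul_of_nonneg_right (by linarith) (by linarith [W0 x])
  · intro M hM x
    refine (hii m₁ hm₁ m₂ hm₂ M hM x).trans ?_
    have hM0 : 0 ≤ M := Poisson.Gr.M0 (W := W) (f := fun x => DU m₁ x - DU m₂ x)
      ⟨(h1 m₁ hm₁).1.sub (h1 m₂ hm₂).1, hM⟩ W0 x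
    rw [mul_comm M L]
    exact mul_le_mul_of_nonneg_right (mul_le_mul_of_nonneg_right (by linarith) hM0)
      (by linarith [W0 x])
  · intro x
    set J := (∫ y, (1 + ‖y‖ ^ (ℓ / (2 * α))) ∂(mdiff m₂ m₁)) ^ α with hJ
    have J0 : 0 ≤ J := Real.rpow_nonneg (integral_nonneg fun y => by positivity) _
    refine (hii m₁ hm₁ m₂ hm₂ (|C6| * B * J) (fun z => ?_) x).trans ?_
    · rw [abs_sub_comm]
      refine (hC6 m₁ hm₁ m₂ hm₂ z).trans ?_
      rw [← hJ]
      calc C6 * J * (1 + ‖z‖ ^ (ℓ / 2)) ≤ |C6| * J * (B * (1 + W z)) := by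
            have := hcmp z
            have := le_abs_self C6
            gcongr
        _ = _ := by ring
    · rw [show |C6| * B * J * L = |C6| * B * L * J by ring]
      exact mul_le_mul_of_nonneg_right (mul_le_mul_of_nonneg_right (by linarith) J0)
        (by linarith [W0 x])
end
end

section
/- Let ℓ > 0, n ∈ ℕ with n ≥ 2, and let φ : (ℝ^d)^n → ℝ be a symmetric continuous function with lim_{|x₁|→∞} sup_{(x₂,…,x_n)∈(ℝ^d)^{n−1}} |φ(x₁,x₂,…,x_n)| / ∏_{i=1}^n (1+|x_i|^{ℓ/2}) = 0. For μ̃ ∈ 𝒫_ℓ(ℝ^d) define δU/δm(μ̃,x₁) = n ∫_{(ℝ^d)^{n−1}} (φ(x₁,x₂,…,x_n) − φ(0,x₂,…,x_n)) μ̃(dx₂)⋯μ̃(dx_n). Then for every μ ∈ 𝒫_ℓ(ℝ^d), sup_{x₁∈ℝ^d} |δU/δm(μ̃,x₁) − δU/δm(μ,x₁)| / (1+|x₁|^{ℓ/2}) converges to 0 as W_ℓ(μ̃,μ) → 0. -/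
open MeasureTheory ProbabilityTheory Filter ENNReal Topology

noncomputable section

open Paper


/-- The linear functional derivative of the U-statistic functional associated to `φ`:
`δU/δm(m, x₁) = n ∫ (φ(x₁, rest) - φ(0, rest)) m^{⊗(n-1)}(drest)` with `n = k+1`. -/
def USderiv {d : ℕ} (k : ℕ) (φ : (Fin (k + 1) → Euc d) → ℝ) (m : Measure (Euc d))
    (x₁ : Euc d) : ℝ :=
  ((k : ℝ) + 1) *
    ∫ rest : Fin k → Euc d, (φ (Fin.cons x₁ rest) - φ (Fin.cons 0 rest))
      ∂(Measure.pi fun _ => m)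

lemma wt_cont {d : ℕ} {ℓ : ℝ} (hℓ : 0 < ℓ) : Continuous (fun x : Euc d => ‖x‖ ^ ℓ) :=
  continuous_norm.rpow_const (fun _ => Or.inr hℓ.le)

lemma wt_pos {d : ℕ} {ℓ : ℝ} (x : Euc d) : 0 < 1 + ‖x‖ ^ (ℓ / 2) := by
  have := Real.rpow_nonneg (norm_nonneg x) (ℓ/2)
  linarith

lemma decomp {d : ℕ} (ℓ : ℝ) (hℓ : 0 < ℓ) (k : ℕ)
    (φ : (Fin (k + 1) → Euc d) → ℝ) (hφc : Continuous φ)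
    (hsym : ∀ (e : Equiv.Perm (Fin (k + 1))) (x : Fin (k + 1) → Euc d), φ (x ∘ e) = φ x)
    (hlim : ∀ ε > (0:ℝ), ∃ M : ℝ, ∀ x : Fin (k + 1) → Euc d, M ≤ ‖x 0‖ →
      |φ x| ≤ ε * ∏ i, (1 + ‖x i‖ ^ (ℓ / 2))) (η : ℝ) (hη : 0 < η) :
    ∃ G : (Fin (k + 1) → Euc d) → ℝ, Continuous G ∧ HasCompactSupport G ∧
      ∀ x (r : Fin k → Euc d),
        |φ (Fin.cons x r) - (1 + ‖x‖ ^ (ℓ / 2)) * G (Fin.cons x r)| ≤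
          (1 + ‖x‖ ^ (ℓ / 2)) * (η * ∏ i, (1 + ‖r i‖ ^ (ℓ / 2))) := by
  obtain ⟨M, hM⟩ := hlim η hη
  have hM' : ∀ (x : Fin (k + 1) → Euc d) (i : Fin (k+1)), M ≤ ‖x i‖ →
      |φ x| ≤ η * ∏ i, (1 + ‖x i‖ ^ (ℓ / 2)) := by
    intro x i hi
    have := hM (x ∘ Equiv.swap 0 i) (by simpa using hi)
    rw [hsym] at this
    refine this.trans_eq ?_
    congr 1
    exact Equiv.prod_comp (Equiv.swap 0 i) (fun i => 1 + ‖x i‖ ^ (ℓ / 2))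
  have hw : Continuous (fun x : Euc d => 1 + ‖x‖ ^ (ℓ/2)) :=
    continuous_const.add (wt_cont (by positivity))
  set P : (Fin (k + 1) → Euc d) → ℝ := fun x => ∏ i, (1 + ‖x i‖ ^ (ℓ / 2)) with hP
  have hPc : Continuous P := continuous_finsetProd _ fun i _ => hw.comp (continuous_apply i)
  have hPpos : ∀ x, 0 < P x := fun x => Finset.prod_pos fun i _ => wt_pos _
  set S : ℝ → ℝ := fun t => t - max (-η) (min η t) with hS
  have hSc : Continuous S := by fun_prop
  have hS0 : ∀ t, |t| ≤ η → S t = 0 := by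
    intro t ht
    rw [abs_le] at ht
    simp [hS, min_eq_right ht.2, max_eq_right ht.1]
  have hS1 : ∀ t, |t - S t| ≤ η := by
    intro t
    have ht : t - S t = max (-η) (min η t) := sub_sub_cancel _ _
    rw [ht, abs_le]
    exact ⟨le_max_left _ _, max_le (by linarith) (min_le_left _ _)⟩
  refine ⟨fun x => S (φ x / P x) * ∏ i : Fin k, (1 + ‖x i.succ‖ ^ (ℓ / 2)), ?_, ?_, ?_⟩
  · refine (hSc.comp (hφc.div hPc fun x => (hPpos x).ne')).mul ?_
    exact continuous_finsetProd _ fun i _ => hw.comp (continuous_apply i.succ)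
  · refine HasCompactSupport.intro (isCompact_closedBall (0 : Fin (k+1) → Euc d) (max M 0)) ?_
    intro x hx
    have : ∃ i, M ≤ ‖x i‖ := by
      by_contra! h
      apply hx
      rw [mem_closedBall_zero_iff, pi_norm_le_iff_of_nonneg (le_max_right _ _)]
      exact fun i => (h i).le.trans (le_max_left _ _)
    obtain ⟨i, hi⟩ := this
    have := hM' x i hi
    rw [hS0, zero_mul]
    rw [abs_div, abs_of_pos (hPpos x), div_le_iff₀ (hPpos x)]
    exact this
  · intro x r
    set X : Fin (k+1) → Euc d := Fin.cons x r with hX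
    have hPX : P X = (1 + ‖x‖ ^ (ℓ / 2)) * ∏ i : Fin k, (1 + ‖r i‖ ^ (ℓ / 2)) := by
      simp [hP, Fin.prod_univ_succ, hX]
    have h1 : φ X - (1 + ‖x‖ ^ (ℓ / 2)) *
        (S (φ X / P X) * ∏ i : Fin k, (1 + ‖X i.succ‖ ^ (ℓ / 2))) =
        (φ X / P X - S (φ X / P X)) * P X := by
      generalize hT : S (φ X / P X) = T
      rw [sub_mul (φ X / P X) T (P X), div_mul_cancel₀ _ (hPpos X).ne']
      rw [hPX]
      simp only [hX, Fin.cons_succ]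
      ring
    simp only
    rw [h1, abs_mul, abs_of_pos (hPpos X)]
    calc _ ≤ η * P X := mul_le_mul_of_nonneg_right (hS1 _) (hPpos X).le
      _ = _ := by rw [hPX]; ring

lemma modulus {d : ℕ} (ℓ : ℝ) (hℓ : 0 < ℓ) (k : ℕ) (G : (Fin (k + 1) → Euc d) → ℝ)
    (hG : Continuous G) (hGc : HasCompactSupport G) (ε : ℝ) (hε : 0 < ε) :
    ∃ K : ℝ, 0 ≤ K ∧ ∀ x (y z : Fin k → Euc d),
      |G (Fin.cons x y) - G (Fin.cons x z)| ≤ ε + K * ∑ i, dist (y i) (z i) ^ ℓ := by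
  obtain ⟨C, hC⟩ := hGc.exists_bound_of_continuous hG
  have hC0 : 0 ≤ C := (norm_nonneg _).trans (hC 0)
  have huc := hGc.uniformContinuous_of_continuous hG
  obtain ⟨δ, hδ, h⟩ := Metric.uniformContinuous_iff.1 huc ε hε
  refine ⟨2 * C / δ ^ ℓ, by positivity, fun x y z => ?_⟩
  have hsum : 0 ≤ ∑ i, dist (y i) (z i) ^ ℓ :=
    Finset.sum_nonneg fun i _ => Real.rpow_nonneg dist_nonneg _
  by_cases hd : ∀ i, dist (y i) (z i) < δ
  · have : dist (Fin.cons x y : Fin (k+1) → Euc d) (Fin.cons x z) < δ := by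
      rw [dist_pi_lt_iff hδ]
      intro i
      refine Fin.cases ?_ (fun j => ?_) i
      · simpa using hδ
      · simpa using hd j
    have := h this
    rw [Real.dist_eq] at this
    have h2 : 0 ≤ 2 * C / δ ^ ℓ * ∑ i, dist (y i) (z i) ^ ℓ := by positivity
    linarith
  · push Not at hd
    obtain ⟨i, hi⟩ := hd
    have h1 : δ ^ ℓ ≤ ∑ i, dist (y i) (z i) ^ ℓ :=
      (Real.rpow_le_rpow hδ.le hi hℓ.le).trans
        (Finset.single_le_sum (f := fun i => dist (y i) (z i) ^ ℓ)
          (fun i _ => Real.rpow_nonneg dist_nonneg _) (Finset.mem_univ i))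
    have h2 : 2 * C ≤ 2 * C / δ ^ ℓ * ∑ i, dist (y i) (z i) ^ ℓ := by
      have hp : 0 < δ ^ ℓ := by positivity
      rw [div_mul_eq_mul_div, le_div_iff₀ hp]
      exact mul_le_mul_of_nonneg_left h1 (by positivity)
    have h3 := hC (Fin.cons x y)
    have h4 := hC (Fin.cons x z)
    have h5 := norm_sub_le (G (Fin.cons x y)) (G (Fin.cons x z))
    simp only [Real.norm_eq_abs] at h3 h4 h5
    linarith

lemma int_pow {d : ℕ} {ℓ : ℝ} (hℓ : 0 < ℓ) {m : Measure (Euc d)} (hm : MemP ℓ m) :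
    Integrable (fun x => ‖x‖ ^ ℓ) m := by
  refine ⟨(wt_cont hℓ).aestronglyMeasurable, ?_⟩
  rw [hasFiniteIntegral_iff_ofReal (ae_of_all _ fun x => Real.rpow_nonneg (norm_nonneg x) _)]
  exact hm.2

lemma wt_le {d : ℕ} {ℓ : ℝ} (x : Euc d) :
    1 + ‖x‖ ^ (ℓ / 2) ≤ 2 + ‖x‖ ^ ℓ := by
  have h0 : (‖x‖ ^ (ℓ/2)) ^ 2 = ‖x‖ ^ ℓ := by
    rw [← Real.rpow_natCast, ← Real.rpow_mul (norm_nonneg x)]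
    congr 1
    push_cast; ring
  nlinarith [sq_nonneg (‖x‖ ^ (ℓ/2) - 1)]

lemma int_wt {d : ℕ} {ℓ : ℝ} (hℓ : 0 < ℓ) {m : Measure (Euc d)} (hm : MemP ℓ m) :
    Integrable (fun x => 1 + ‖x‖ ^ (ℓ / 2)) m := by
  have := hm.1
  refine Integrable.mono' ((integrable_const (2:ℝ)).add (int_pow hℓ hm)) ?_ ?_
  · exact (continuous_const.add (wt_cont (by positivity))).aestronglyMeasurable
  · refine ae_of_all _ fun x => ?_
    rw [Real.norm_of_nonneg (wt_pos x).le]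
    exact wt_le x

lemma int_pi {d : ℕ} {ℓ : ℝ} (hℓ : 0 < ℓ) (k : ℕ) {m : Measure (Euc d)} (hm : MemP ℓ m) :
    Integrable (fun r : Fin k → Euc d => ∏ i, (1 + ‖r i‖ ^ (ℓ / 2))) (Measure.pi fun _ => m) := by
  have := hm.1
  exact Integrable.fintype_prod (f := fun _ x => 1 + ‖x‖ ^ (ℓ / 2)) fun _ => int_wt hℓ hm

lemma intval_pi {d : ℕ} {ℓ : ℝ} (k : ℕ) {m : Measure (Euc d)} (hm : MemP ℓ m) :
    ∫ r : Fin k → Euc d, ∏ i, (1 + ‖r i‖ ^ (ℓ / 2)) ∂(Measure.pi fun _ => m)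
      = (∫ x, (1 + ‖x‖ ^ (ℓ / 2)) ∂m) ^ k := by
  have := hm.1
  rw [integral_fintype_prod_eq_prod (fun _ x => 1 + ‖x‖ ^ (ℓ / 2))]
  simp

lemma cons_cont {d k : ℕ} (x : Euc d) :
    Continuous (fun r : Fin k → Euc d => (Fin.cons x r : Fin (k+1) → Euc d)) := by
  fun_prop

/-- integrability of `G` slices -/
lemma int_G {d k : ℕ} (G : (Fin (k + 1) → Euc d) → ℝ)
    (hG : Continuous G) (hGc : HasCompactSupport G) (m : Measure (Euc d)) [IsProbabilityMeasure m]
    (x : Euc d) : Integrable (fun r : Fin k → Euc d => G (Fin.cons x r)) (Measure.pi fun _ => m) := by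
  obtain ⟨C, hC⟩ := hGc.exists_bound_of_continuous hG
  exact Integrable.of_bound (hG.comp (cons_cont x)).aestronglyMeasurable C
    (ae_of_all _ fun r => hC _)

lemma int_phi {d : ℕ} {ℓ : ℝ} (hℓ : 0 < ℓ) {k : ℕ}
    {φ : (Fin (k + 1) → Euc d) → ℝ} (hφc : Continuous φ) {η : ℝ}
    {G : (Fin (k + 1) → Euc d) → ℝ} (hG : Continuous G) (hGc : HasCompactSupport G)
    (hφG : ∀ x (r : Fin k → Euc d),
        |φ (Fin.cons x r) - (1 + ‖x‖ ^ (ℓ / 2)) * G (Fin.cons x r)| ≤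
          (1 + ‖x‖ ^ (ℓ / 2)) * (η * ∏ i, (1 + ‖r i‖ ^ (ℓ / 2))))
    {m : Measure (Euc d)} (hm : MemP ℓ m) (x : Euc d) :
    Integrable (fun r : Fin k → Euc d => φ (Fin.cons x r)) (Measure.pi fun _ => m) ∧
    |∫ r : Fin k → Euc d, φ (Fin.cons x r) ∂(Measure.pi fun _ => m) -
      (1 + ‖x‖ ^ (ℓ / 2)) * ∫ r : Fin k → Euc d, G (Fin.cons x r) ∂(Measure.pi fun _ => m)| ≤
      (1 + ‖x‖ ^ (ℓ / 2)) * (η * (∫ x, (1 + ‖x‖ ^ (ℓ / 2)) ∂m) ^ k) := by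
  have := hm.1
  have iG := (int_G G hG hGc m x).const_mul (1 + ‖x‖ ^ (ℓ / 2))
  have iW := ((int_pi hℓ k hm).const_mul η).const_mul (1 + ‖x‖ ^ (ℓ / 2))
  have iD : Integrable (fun r : Fin k → Euc d =>
      φ (Fin.cons x r) - (1 + ‖x‖ ^ (ℓ / 2)) * G (Fin.cons x r)) (Measure.pi fun _ => m) :=
    iW.mono' ((hφc.comp (cons_cont x)).sub
      (continuous_const.mul (hG.comp (cons_cont x)))).aestronglyMeasurable
      (ae_of_all _ fun r => hφG x r)
  have iφ : Integrable (fun r : Fin k → Euc d => φ (Fin.cons x r)) (Measure.pi fun _ => m) := by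
    refine (iD.add iG).congr (ae_of_all _ fun r => ?_)
    simp
  refine ⟨iφ, ?_⟩
  rw [← integral_const_mul, ← integral_sub iφ iG, ← intval_pi k hm, ← integral_const_mul,
    ← integral_const_mul]
  refine (abs_integral_le_integral_abs).trans ?_
  exact integral_mono iD.abs iW fun r => hφG x r

/-- coupling estimate -/
lemma coup {d : ℕ} {ℓ : ℝ} (hℓ : 0 < ℓ) {k : ℕ}
    {G : (Fin (k + 1) → Euc d) → ℝ} (hG : Continuous G) (hGc : HasCompactSupport G)
    {ε K : ℝ}
    (h : ∀ x (y z : Fin k → Euc d),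
      |G (Fin.cons x y) - G (Fin.cons x z)| ≤ ε + K * ∑ i, dist (y i) (z i) ^ ℓ)
    {m μ : Measure (Euc d)} {ρ : Measure (Euc d × Euc d)} (hρ : ρ ∈ couplings m μ)
    (hi : Integrable (fun p : Euc d × Euc d => dist p.1 p.2 ^ ℓ) ρ) (x : Euc d) :
    |∫ r : Fin k → Euc d, G (Fin.cons x r) ∂(Measure.pi fun _ => m) -
      ∫ r : Fin k → Euc d, G (Fin.cons x r) ∂(Measure.pi fun _ => μ)| ≤
      ε + K * (k * ∫ p, dist p.1 p.2 ^ ℓ ∂ρ) := by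
  obtain ⟨hρp, h1, h2⟩ := hρ
  have hm : IsProbabilityMeasure m := by
    rw [← h1]; exact Measure.isProbabilityMeasure_map measurable_fst.aemeasurable
  have hμ : IsProbabilityMeasure μ := by
    rw [← h2]; exact Measure.isProbabilityMeasure_map measurable_snd.aemeasurable
  have mp1 : MeasurePreserving (fun (a : Fin k → Euc d × Euc d) i => (a i).1)
      (Measure.pi fun _ => ρ) (Measure.pi fun _ => m) :=
    measurePreserving_pi (fun _ => ρ) (fun _ => m) (f := fun _ => Prod.fst)
      fun _ => ⟨measurable_fst, h1⟩
  have mp2 : MeasurePreserving (fun (a : Fin k → Euc d × Euc d) i => (a i).2)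
      (Measure.pi fun _ => ρ) (Measure.pi fun _ => μ) :=
    measurePreserving_pi (fun _ => ρ) (fun _ => μ) (f := fun _ => Prod.snd)
      fun _ => ⟨measurable_snd, h2⟩
  have i1 := int_G G hG hGc m x
  have i2 := int_G G hG hGc μ x
  have j1 : Integrable (fun a : Fin k → Euc d × Euc d => G (Fin.cons x fun i => (a i).1))
      (Measure.pi fun _ => ρ) := mp1.integrable_comp_of_integrable i1
  have j2 : Integrable (fun a : Fin k → Euc d × Euc d => G (Fin.cons x fun i => (a i).2))
      (Measure.pi fun _ => ρ) := mp2.integrable_comp_of_integrable i2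
  have e1 : ∫ r : Fin k → Euc d, G (Fin.cons x r) ∂(Measure.pi fun _ => m) =
      ∫ a : Fin k → Euc d × Euc d, G (Fin.cons x fun i => (a i).1) ∂(Measure.pi fun _ => ρ) := by
    rw [← mp1.map_eq, integral_map mp1.measurable.aemeasurable]
    exact (hG.comp (cons_cont x)).aestronglyMeasurable
  have e2 : ∫ r : Fin k → Euc d, G (Fin.cons x r) ∂(Measure.pi fun _ => μ) =
      ∫ a : Fin k → Euc d × Euc d, G (Fin.cons x fun i => (a i).2) ∂(Measure.pi fun _ => ρ) := by
    rw [← mp2.map_eq, integral_map mp2.measurable.aemeasurable]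
    exact (hG.comp (cons_cont x)).aestronglyMeasurable
  have js : ∀ i : Fin k, Integrable (fun a : Fin k → Euc d × Euc d => dist (a i).1 (a i).2 ^ ℓ)
      (Measure.pi fun _ => ρ) := fun i =>
    integrable_comp_eval (μ := fun _ : Fin k => ρ) (i := i)
      (f := fun p : Euc d × Euc d => dist p.1 p.2 ^ ℓ) hi
  have jsum : Integrable (fun a : Fin k → Euc d × Euc d =>
      K * ∑ i, dist (a i).1 (a i).2 ^ ℓ) (Measure.pi fun _ => ρ) :=
    (integrable_finsetSum _ fun i _ => js i).const_mul K
  have e3 : ∫ a : Fin k → Euc d × Euc d, (ε + K * ∑ i, dist (a i).1 (a i).2 ^ ℓ)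
      ∂(Measure.pi fun _ => ρ) = ε + K * (k * ∫ p, dist p.1 p.2 ^ ℓ ∂ρ) := by
    rw [integral_add (integrable_const _) jsum, integral_const_mul,
      integral_finsetSum _ fun i _ => js i]
    have : ∀ i : Fin k, ∫ a : Fin k → Euc d × Euc d, dist (a i).1 (a i).2 ^ ℓ
        ∂(Measure.pi fun _ => ρ) = ∫ p, dist p.1 p.2 ^ ℓ ∂ρ := fun i =>
      integral_comp_eval (μ := fun _ : Fin k => ρ) (i := i)
        (f := fun p : Euc d × Euc d => dist p.1 p.2 ^ ℓ) hi.aestronglyMeasurable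
    simp [this]
  rw [e1, e2, ← integral_sub j1 j2, ← e3]
  refine (abs_integral_le_integral_abs).trans ?_
  exact integral_mono (j1.sub j2).abs ((integrable_const _).add jsum) fun a => h x _ _

lemma moment {d : ℕ} {ℓ : ℝ} (hℓ : 0 < ℓ) {m μ : Measure (Euc d)} (hm : MemP ℓ m)
    (hμ : MemP ℓ μ) {ρ : Measure (Euc d × Euc d)} (hρ : ρ ∈ couplings m μ)
    (hi : Integrable (fun p : Euc d × Euc d => dist p.1 p.2 ^ ℓ) ρ) :
    ∫ x, (1 + ‖x‖ ^ (ℓ / 2)) ∂m ≤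
      2 + 2 ^ ℓ * (∫ p, dist p.1 p.2 ^ ℓ ∂ρ + ∫ x, ‖x‖ ^ ℓ ∂μ) := by
  obtain ⟨hρp, h1, h2⟩ := hρ
  have mp1 : MeasurePreserving Prod.fst ρ m := ⟨measurable_fst, h1⟩
  have mp2 : MeasurePreserving Prod.snd ρ μ := ⟨measurable_snd, h2⟩
  have e2 : ∫ x, ‖x‖ ^ ℓ ∂μ = ∫ p, ‖p.2‖ ^ ℓ ∂ρ := by
    rw [← h2, integral_map measurable_snd.aemeasurable (wt_cont hℓ).aestronglyMeasurable]
  have e1 : ∫ x, (1 + ‖x‖ ^ (ℓ / 2)) ∂m = ∫ p, (1 + ‖p.1‖ ^ (ℓ / 2)) ∂ρ := by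
    rw [← h1, integral_map measurable_fst.aemeasurable]
    exact (continuous_const.add (wt_cont (by positivity))).aestronglyMeasurable
  have j2 : Integrable (fun p : Euc d × Euc d => ‖p.2‖ ^ ℓ) ρ :=
    mp2.integrable_comp_of_integrable (int_pow hℓ hμ)
  have j1 : Integrable (fun p : Euc d × Euc d => 1 + ‖p.1‖ ^ (ℓ / 2)) ρ :=
    mp1.integrable_comp_of_integrable (int_wt hℓ hm)
  have jr : Integrable (fun p : Euc d × Euc d => 2 ^ ℓ * (dist p.1 p.2 ^ ℓ + ‖p.2‖ ^ ℓ)) ρ :=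
    (hi.add j2).const_mul (2 ^ ℓ)
  have e3 : 2 + 2 ^ ℓ * (∫ p, dist p.1 p.2 ^ ℓ ∂ρ + ∫ p, ‖p.2‖ ^ ℓ ∂ρ) =
      ∫ p : Euc d × Euc d, (2 + 2 ^ ℓ * (dist p.1 p.2 ^ ℓ + ‖p.2‖ ^ ℓ)) ∂ρ := by
    rw [integral_add (integrable_const _) jr, integral_const_mul, integral_add hi j2]
    simp
  rw [e1, e2, e3]
  refine integral_mono j1 ((integrable_const _).add jr) fun p => ?_
  refine (wt_le p.1).trans ?_
  have hn : ‖p.1‖ ≤ 2 * max (dist p.1 p.2) ‖p.2‖ := by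
    have : ‖p.1‖ ≤ dist p.1 p.2 + ‖p.2‖ := by
      rw [dist_eq_norm]; simpa using norm_add_le (p.1 - p.2) p.2
    have a := le_max_left (dist p.1 p.2) ‖p.2‖
    have b := le_max_right (dist p.1 p.2) ‖p.2‖
    linarith
  have h0 : 0 ≤ max (dist p.1 p.2) ‖p.2‖ := dist_nonneg.trans (le_max_left _ _)
  have h3 : ‖p.1‖ ^ ℓ ≤ 2 ^ ℓ * (max (dist p.1 p.2) ‖p.2‖) ^ ℓ := by
    rw [← Real.mul_rpow (by norm_num) h0]
    exact Real.rpow_le_rpow (norm_nonneg _) hn hℓ.le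
  have h4 : (max (dist p.1 p.2) ‖p.2‖) ^ ℓ ≤ dist p.1 p.2 ^ ℓ + ‖p.2‖ ^ ℓ := by
    have a : 0 ≤ dist p.1 p.2 ^ ℓ := Real.rpow_nonneg dist_nonneg _
    have b : 0 ≤ ‖p.2‖ ^ ℓ := Real.rpow_nonneg (norm_nonneg _) _
    rcases max_choice (dist p.1 p.2) ‖p.2‖ with h | h <;> rw [h] <;> linarith
  have h5 := mul_le_mul_of_nonneg_left h4 (by positivity : (0:ℝ) ≤ 2 ^ ℓ)
  linarith

lemma get_coupling {d : ℕ} {ℓ : ℝ} (hℓ : 0 < ℓ) {m μ : Measure (Euc d)} {s : ℝ} (hs : 0 < s)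
    (h : Wl ℓ m μ < ENNReal.ofReal (s ^ (1 / max ℓ 1))) :
    ∃ ρ ∈ couplings m μ, Integrable (fun p : Euc d × Euc d => dist p.1 p.2 ^ ℓ) ρ ∧
      ∫ p, dist p.1 p.2 ^ ℓ ∂ρ ≤ s := by
  unfold Wl at h
  simp only [iInf_lt_iff, hℓ.ne', if_false] at h
  obtain ⟨ρ, hρ, h⟩ := h
  have hp : 0 < 1 / max ℓ 1 := by positivity
  rw [← ENNReal.ofReal_rpow_of_pos hs, ENNReal.rpow_lt_rpow_iff hp] at h
  have hc : Continuous (fun p : Euc d × Euc d => dist p.1 p.2 ^ ℓ) :=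
    continuous_dist.rpow_const (fun _ => Or.inr hℓ.le)
  have h0 : 0 ≤ᵐ[ρ] (fun p : Euc d × Euc d => dist p.1 p.2 ^ ℓ) :=
    ae_of_all _ fun p => Real.rpow_nonneg dist_nonneg _
  refine ⟨ρ, hρ, ⟨hc.aestronglyMeasurable, ?_⟩, ?_⟩
  · rw [hasFiniteIntegral_iff_ofReal h0]
    exact h.trans ENNReal.ofReal_lt_top
  · rw [integral_eq_lintegral_of_nonneg_ae h0 hc.aestronglyMeasurable]
    exact ENNReal.toReal_le_of_le_ofReal hs.le h.le

/-- RU3 for the U-statistic functional. -/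
theorem stmt17 {d : ℕ} (ℓ : ℝ) (hℓ : 0 < ℓ) (k : ℕ) (hk : 1 ≤ k)
    (φ : (Fin (k + 1) → Euc d) → ℝ) (hφc : Continuous φ)
    (hsym : ∀ (e : Equiv.Perm (Fin (k + 1))) (x : Fin (k + 1) → Euc d), φ (x ∘ e) = φ x)
    (hlim : ∀ ε > (0:ℝ), ∃ M : ℝ, ∀ x : Fin (k + 1) → Euc d, M ≤ ‖x 0‖ →
      |φ x| ≤ ε * ∏ i, (1 + ‖x i‖ ^ (ℓ / 2)))
    (μ : Measure (Euc d)) (hμ : MemP ℓ μ) :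
    ∀ ε > (0:ℝ), ∃ δ > (0:ℝ), ∀ m : Measure (Euc d), MemP ℓ m →
      Wl ℓ m μ < ENNReal.ofReal δ → ∀ x₁ : Euc d,
        |USderiv k φ m x₁ - USderiv k φ μ x₁| ≤ ε * (1 + ‖x₁‖ ^ (ℓ / 2)) := by
  intro ε hε
  set I := ∫ x, ‖x‖ ^ ℓ ∂μ with hI
  have hI0 : 0 ≤ I := integral_nonneg fun x => Real.rpow_nonneg (norm_nonneg x) _
  set A : ℝ := 2 + 2 ^ ℓ * (1 + I) with hA
  have hA0 : 0 < A := by positivity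
  set e : ℝ := ε / (2 * (k + 1)) with he
  have he0 : 0 < e := by positivity
  obtain ⟨G, hG, hGc, hφG⟩ := decomp ℓ hℓ k φ hφc hsym hlim (e / 4 / A ^ k) (by positivity)
  obtain ⟨K, hK, hmod⟩ := modulus ℓ hℓ k G hG hGc (e / 4) (by positivity)
  set s : ℝ := min 1 (e / 4 / (K * k + 1)) with hs
  have hs0 : 0 < s := by positivity
  have hs2 : K * (k * s) ≤ e / 4 := by
    have : s ≤ e / 4 / (K * k + 1) := min_le_right _ _
    rw [le_div_iff₀ (by positivity)] at this
    nlinarith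
  refine ⟨s ^ (1 / max ℓ 1), by positivity, fun m hm hW x₁ => ?_⟩
  obtain ⟨ρ, hρ, hi, hle⟩ := get_coupling hℓ hs0 hW
  have hmA : (∫ x, (1 + ‖x‖ ^ (ℓ / 2)) ∂m) ^ k ≤ A ^ k := by
    refine pow_le_pow_left₀ (integral_nonneg fun x => (wt_pos x).le) ?_ k
    refine (moment hℓ hm hμ hρ hi).trans ?_
    have : ∫ p, dist p.1 p.2 ^ ℓ ∂ρ ≤ 1 := hle.trans (min_le_left _ _)
    rw [hA]; gcongr
  have hμA : (∫ x, (1 + ‖x‖ ^ (ℓ / 2)) ∂μ) ^ k ≤ A ^ k := by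
    have := hμ.1
    refine pow_le_pow_left₀ (integral_nonneg fun x => (wt_pos x).le) ?_ k
    have h1 : ∫ x, (1 + ‖x‖ ^ (ℓ / 2)) ∂μ ≤ ∫ x, (2 + ‖x‖ ^ ℓ) ∂μ :=
      integral_mono (int_wt hℓ hμ) ((integrable_const _).add (int_pow hℓ hμ)) fun x => wt_le x
    rw [integral_add (integrable_const _) (int_pow hℓ hμ)] at h1
    simp only [integral_const, probReal_univ, one_smul] at h1
    have h2 : (1:ℝ) ≤ 2 ^ ℓ := Real.one_le_rpow (by norm_num) hℓ.le
    rw [hA]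
    nlinarith
  have hη : ∀ B, B ≤ A ^ k → e / 4 / A ^ k * B ≤ e / 4 := by
    intro B hB
    calc _ ≤ e / 4 / A ^ k * A ^ k := mul_le_mul_of_nonneg_left hB (by positivity)
      _ = e / 4 := div_mul_cancel₀ _ (by positivity)
  have key : ∀ x : Euc d, |∫ r : Fin k → Euc d, φ (Fin.cons x r) ∂(Measure.pi fun _ => m) -
      ∫ r : Fin k → Euc d, φ (Fin.cons x r) ∂(Measure.pi fun _ => μ)| ≤
      (1 + ‖x‖ ^ (ℓ / 2)) * e := by
    intro x
    have a1 := (int_phi hℓ hφc hG hGc hφG hm x).2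
    have a2 := (int_phi hℓ hφc hG hGc hφG hμ x).2
    have a3 := coup hℓ hG hGc hmod hρ hi x
    have hw := wt_pos (ℓ := ℓ) x
    set w := 1 + ‖x‖ ^ (ℓ / 2)
    have b1 := a1.trans (mul_le_mul_of_nonneg_left (hη _ hmA) hw.le)
    have b2 := a2.trans (mul_le_mul_of_nonneg_left (hη _ hμA) hw.le)
    have b3 : K * (k * ∫ p, dist p.1 p.2 ^ ℓ ∂ρ) ≤ e / 4 := by
      refine le_trans ?_ hs2
      gcongr
    have b4 := mul_le_mul_of_nonneg_left (a3.trans (add_le_add le_rfl b3)) hw.le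
    rw [← abs_of_pos hw, ← abs_mul, abs_of_pos hw, mul_sub] at b4
    rw [abs_le] at *
    constructor <;> linarith
  unfold USderiv
  have im := fun x => (int_phi hℓ hφc hG hGc hφG hm x).1
  have iμ := fun x => (int_phi hℓ hφc hG hGc hφG hμ x).1
  rw [integral_sub (im _) (im _), integral_sub (iμ _) (iμ _), ← mul_sub, abs_mul,
    abs_of_pos (by positivity : (0:ℝ) < (k:ℝ) + 1)]
  have k1 := key x₁
  have k0 := key 0
  have hw0 : 1 + ‖(0 : Euc d)‖ ^ (ℓ / 2) = 1 := by
    rw [norm_zero, Real.zero_rpow (by positivity), add_zero]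
  rw [hw0] at k0
  have hw1 : 1 ≤ 1 + ‖x₁‖ ^ (ℓ / 2) := by
    have := Real.rpow_nonneg (norm_nonneg x₁) (ℓ/2)
    linarith
  set w := 1 + ‖x₁‖ ^ (ℓ / 2)
  have k0' : (1:ℝ) * e ≤ w * e := mul_le_mul_of_nonneg_right hw1 he0.le
  have hfin : ε * w = ((k:ℝ) + 1) * (2 * (w * e)) := by
    rw [he]; field_simp
  rw [hfin]
  refine mul_le_mul_of_nonneg_left ?_ (by positivity)
  rw [abs_le] at *
  constructor <;> linarith
end
end
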